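/- arXiv:1705.05624 — 2 statements merged into one kernel-verified Lean document; each statement's English description precedes it below -/
import Mathlib

section
/- Let n ≥ m and f: ℝⁿ → ℝᵐ satisfy: (a) ap-limsup_{y→x} |f(y)-f(x)|/|y-x| < ∞ for all x outside a countable set N₀; (b) the set of x where ap-limsup_{y→x} |f(y)-f(x)-F₁(x)(y-x)|/|y-x|² = ∞ is H^m-null; (c) for each i = 2,…,n-m, the set of x where ap-limsup_{y→x} |f(y) - Σ_{j=0}^{i} F_j(x)(y-x)^j/j!|/|y-x|^{i+1} = ∞ is H^{i+m-1}-null. Then Lᵐ(f(C_f)) = 0, where C_f = {x : F₁(x) is defined and rank F₁(x) < m}. -/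
open MeasureTheory Metric Filter Set

noncomputable section

/-- `ℝⁿ` as a Euclidean space. -/
abbrev Ec (n : ℕ) := EuclideanSpace ℝ (Fin n)

/-- The set `A` has vanishing Lebesgue density at `x`. -/
def apSmall {n : ℕ} (x : Ec n) (A : Set (Ec n)) : Prop :=
  Tendsto (fun r : ℝ => volume (A ∩ ball x r) / volume (ball x r))
    (nhdsWithin 0 (Ioi 0)) (nhds 0)

/-- `f` is approximately differentiable of order `k` at `x`, with Taylor polynomial
`y ↦ ∑_{j ≤ k} (p j) (y-x)^j = p.partialSum (k+1) (y-x)` (here the coefficient maps `p j`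
already incorporate the factor `1/j!`): the approximate limit of
`|f y - p_k(x;y)|/|y-x|^k` as `y → x` is `0`. -/
def IsApproxTaylor {n m : ℕ} (f : Ec n → Ec m) (k : ℕ) (x : Ec n)
    (p : FormalMultilinearSeries ℝ (Ec n) (Ec m)) : Prop :=
  ∀ ε > (0 : ℝ),
    apSmall x {y | y ≠ x ∧ ε * ‖y - x‖ ^ k ≤ ‖f y - p.partialSum (k + 1) (y - x)‖}
/-- The degree-`i` approximate Taylor polynomial of `f` at `x`, evaluated at `y`:
`f(x) + F₁(x)(y-x) + ⋯ + Fᵢ(x)(y-x)ⁱ/i!`, where the coefficient maps `p x j` already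
incorporate the factor `1/j!` (i.e. `p x j = F_j(x)/j!`). -/
def taylorPoly {n m : ℕ} (f : Ec n → Ec m)
    (p : Ec n → FormalMultilinearSeries ℝ (Ec n) (Ec m)) (i : ℕ) (x y : Ec n) : Ec m :=
  f x + ∑ j ∈ Finset.Icc 1 i, p x j (fun _ => y - x)

/-- `F₁(x)` is defined at `x` (i.e. `f` is approximately differentiable of order 1 at `x`
with linear part `v ↦ (p x 1)(v)`). -/
def ApproxDiff1At {n m : ℕ} (f : Ec n → Ec m)
    (p : Ec n → FormalMultilinearSeries ℝ (Ec n) (Ec m)) (x : Ec n) : Prop :=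
  ∀ ε > (0 : ℝ),
    apSmall x {y | y ≠ x ∧ ε * ‖y - x‖ ≤ ‖f y - taylorPoly f p 1 x y‖}

/-- The generalized critical set: points where the approximate derivative `F₁(x)` is
defined and does not have maximal rank (i.e. `v ↦ (p x 1)(v) : ℝⁿ → ℝᵐ` is not surjective). -/
def approxCrit {n m : ℕ} (f : Ec n → Ec m)
    (p : Ec n → FormalMultilinearSeries ℝ (Ec n) (Ec m)) : Set (Ec n) :=
  {x | ApproxDiff1At f p x ∧ ¬ Function.Surjective fun v : Ec n => p x 1 (fun _ => v)}

theorem exists_lagrange_bound (N : ℕ) : ∃ C : ℝ, 0 ≤ C ∧ ∀ g : Polynomial ℝ, g.natDegree ≤ N →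
    ∀ M : ℝ, (∀ j ∈ Finset.range (N + 1), |g.eval (((j : ℝ) + 1) / (N + 1))| ≤ M) →
      |g.eval 0| ≤ C * M ∧ |g.derivative.eval 0| ≤ C * M := by
  set v : ℕ → ℝ := fun j => ((j : ℝ) + 1) / (N + 1) with hv
  set s := Finset.range (N + 1)
  have hvs : Set.InjOn v s := by
    intro i _ j _ hij
    have hN : (N : ℝ) + 1 ≠ 0 := by positivity
    simp only [hv] at hij
    field_simp at hij
    exact_mod_cast (add_right_cancel hij)
  set L : ℕ → Polynomial ℝ := fun j => Lagrange.basis s v j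
  refine ⟨∑ j ∈ s, (|(L j).eval 0| + |(L j).derivative.eval 0|), by positivity, ?_⟩
  intro g hg M hM
  have hM0 : 0 ≤ M := (abs_nonneg _).trans (hM 0 (by simp [s]))
  have key : g = ∑ j ∈ s, Polynomial.C (g.eval (v j)) * L j := by
    have h := Lagrange.eq_interpolate (s := s) (v := v) (f := g) hvs (by
      calc g.degree ≤ g.natDegree := Polynomial.degree_le_natDegree
        _ ≤ (N : WithBot ℕ) := by exact_mod_cast hg
        _ < _ := by simp only [s, Finset.card_range]; exact_mod_cast Nat.lt_succ_self N)
    rw [Lagrange.interpolate_apply] at h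
    exact h
  have bd : ∀ c : ℕ → ℝ, (∀ j ∈ s, |c j| ≤ |(L j).eval 0| + |(L j).derivative.eval 0|) →
      |∑ j ∈ s, g.eval (v j) * c j| ≤
        (∑ j ∈ s, (|(L j).eval 0| + |(L j).derivative.eval 0|)) * M := by
    intro c hc
    rw [Finset.sum_mul]
    refine (Finset.abs_sum_le_sum_abs _ _).trans (Finset.sum_le_sum fun j hj => ?_)
    rw [abs_mul, mul_comm]
    exact mul_le_mul (hc j hj) (hM j hj) (abs_nonneg _) (by positivity)
  constructor
  · have : g.eval 0 = ∑ j ∈ s, g.eval (v j) * (L j).eval 0 := by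
      conv_lhs => rw [key]
      simp [Polynomial.eval_finsetSum]
    rw [this]
    exact bd _ fun j _ => le_add_of_nonneg_right (abs_nonneg _)
  · have : g.derivative.eval 0 = ∑ j ∈ s, g.eval (v j) * (L j).derivative.eval 0 := by
      conv_lhs => rw [key]
      simp [Polynomial.eval_finsetSum]
    rw [this]
    exact bd _ fun j _ => le_add_of_nonneg_left (abs_nonneg _)

/-- The restriction of a polynomial to the line `t ↦ v + t u`. -/
def lineRestrict {d : ℕ} (q : MvPolynomial (Fin d) ℝ) (v u : Fin d → ℝ) : Polynomial ℝ :=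
  MvPolynomial.aeval (fun i => Polynomial.C (v i) + Polynomial.X * Polynomial.C (u i)) q

theorem eval_lineRestrict {d : ℕ} (q : MvPolynomial (Fin d) ℝ) (v u : Fin d → ℝ) (t : ℝ) :
    (lineRestrict q v u).eval t = MvPolynomial.eval (v + t • u) q := by
  unfold lineRestrict
  induction q using MvPolynomial.induction_on with
  | C a => simp
  | add p q hp hq => rw [map_add, map_add, Polynomial.eval_add, hp, hq]
  | mul_X p i hp => rw [map_mul, map_mul, Polynomial.eval_mul, hp]; simp; ring_nf; simp

theorem natDegree_lineRestrict_le {d : ℕ} (q : MvPolynomial (Fin d) ℝ) (v u : Fin d → ℝ) :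
    (lineRestrict q v u).natDegree ≤ q.totalDegree := by
  have := MvPolynomial.aeval_natDegree_le (m := q.totalDegree) (n := 1) q le_rfl
    (fun i => Polynomial.C (v i) + Polynomial.X * Polynomial.C (u i)) (fun i => by
      refine (Polynomial.natDegree_add_le _ _).trans ?_
      simp only [Polynomial.natDegree_C, zero_le, sup_of_le_right]
      exact Polynomial.natDegree_mul_le.trans (by simp))
  simpa [lineRestrict] using this

/-- The total derivative at `z` of the polynomial function given by `q`. -/
def polyDeriv {d : ℕ} (q : MvPolynomial (Fin d) ℝ) (z : Fin d → ℝ) : (Fin d → ℝ) →L[ℝ] ℝ :=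
  ∑ a, MvPolynomial.eval z (MvPolynomial.pderiv a q) • ContinuousLinearMap.proj a

theorem polyDeriv_apply {d : ℕ} (q : MvPolynomial (Fin d) ℝ) (z v : Fin d → ℝ) :
    polyDeriv q z v = ∑ a, MvPolynomial.eval z (MvPolynomial.pderiv a q) * v a := by
  simp [polyDeriv]

theorem hasFDerivAt_eval {d : ℕ} (q : MvPolynomial (Fin d) ℝ) (z : Fin d → ℝ) :
    HasFDerivAt (fun v => MvPolynomial.eval v q) (polyDeriv q z) z := by
  induction q using MvPolynomial.induction_on with
  | C a =>
    have : polyDeriv (MvPolynomial.C a) z = 0 := by ext v; simp [polyDeriv_apply]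
    rw [this]; simpa using hasFDerivAt_const a z
  | add p q hp hq =>
    have : polyDeriv (p + q) z = polyDeriv p z + polyDeriv q z := by
      ext v; simp [polyDeriv_apply, add_mul, Finset.sum_add_distrib]
    rw [this]
    exact (hp.add hq).congr_of_eventuallyEq (.of_forall fun v => map_add _ _ _)
  | mul_X p i hp =>
    have : polyDeriv (p * MvPolynomial.X i) z = MvPolynomial.eval z p •
        (ContinuousLinearMap.proj i : (Fin d → ℝ) →L[ℝ] ℝ) + z i • polyDeriv p z := by
      ext v
      simp only [polyDeriv_apply, MvPolynomial.pderiv_mul, MvPolynomial.pderiv_X, map_add, map_mul,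
        MvPolynomial.eval_X, add_mul, Finset.sum_add_distrib, add_apply,
        smul_apply, ContinuousLinearMap.proj_apply, smul_eq_mul,
        Finset.mul_sum]
      rw [add_comm]
      congr 1
      · rw [Finset.sum_eq_single i]
        · simp
        · intro b _ hb; simp [hb.symm]
        · simp
      · exact Finset.sum_congr rfl fun _ _ => by ring
    rw [this]
    exact (hp.mul (ContinuousLinearMap.proj (R := ℝ) (φ := fun _ : Fin d => ℝ) i).hasFDerivAt
      ).congr_of_eventuallyEq (.of_forall fun v => by simp)

theorem continuous_eval_poly {d : ℕ} (q : MvPolynomial (Fin d) ℝ) :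
    Continuous fun v : Fin d → ℝ => MvPolynomial.eval v q :=
  continuous_iff_continuousAt.2 fun z => (hasFDerivAt_eval q z).continuousAt

theorem hasDerivAt_line {d : ℕ} (q : MvPolynomial (Fin d) ℝ) (v u : Fin d → ℝ) (t : ℝ) :
    HasDerivAt (fun t : ℝ => MvPolynomial.eval (v + t • u) q) (polyDeriv q (v + t • u) u) t := by
  have h1 : HasDerivAt (fun t : ℝ => v + t • u) u t := by
    simpa using ((hasDerivAt_id t).smul_const u).const_add v
  exact (hasFDerivAt_eval q (v + t • u)).comp_hasDerivAt t h1

theorem eval_derivative_lineRestrict {d : ℕ} (q : MvPolynomial (Fin d) ℝ) (v u : Fin d → ℝ) :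
    (lineRestrict q v u).derivative.eval 0 = polyDeriv q v u := by
  have h1 := (lineRestrict q v u).hasDerivAt 0
  have h2 := hasDerivAt_line q v u 0
  simp only [eval_lineRestrict] at h1
  simpa using h1.unique h2

theorem exists_poly_mean_value {d : ℕ} (q : MvPolynomial (Fin d) ℝ) (u u' : Fin d → ℝ) :
    ∃ t ∈ Set.Icc (0 : ℝ) 1, MvPolynomial.eval u' q - MvPolynomial.eval u q =
      polyDeriv q (u + t • (u' - u)) (u' - u) := by
  have hd := hasDerivAt_line q u (u' - u)
  obtain ⟨t, ht, h⟩ := exists_hasDerivAt_eq_slope _ _ (zero_lt_one' ℝ)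
    (fun t _ => (hd t).continuousAt.continuousWithinAt) (fun t _ => hd t)
  exact ⟨t, Ioo_subset_Icc_self ht, by simpa using h.symm⟩

theorem exists_bound_eval {d : ℕ} (q : MvPolynomial (Fin d) ℝ) (z : Fin d → ℝ) (R : ℝ) :
    ∃ K : ℝ, 0 ≤ K ∧ ∀ v, ‖v - z‖ ≤ R → |MvPolynomial.eval v q| ≤ K := by
  obtain ⟨K, hK⟩ := (isCompact_closedBall z R).exists_bound_of_continuousOn
    (continuous_eval_poly q).continuousOn
  exact ⟨max K 0, le_max_right _ _, fun v hv =>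
    (hK v (by simpa [dist_eq_norm] using hv)).trans (le_max_left _ _)⟩

theorem norm_line_sub_le {d : ℕ} {z u u' : Fin d → ℝ} {R t : ℝ} (ht : t ∈ Set.Icc (0 : ℝ) 1)
    (hu : ‖u - z‖ ≤ R) (hu' : ‖u' - z‖ ≤ R) : ‖u + t • (u' - u) - z‖ ≤ R := by
  have := (convex_closedBall z R).add_smul_sub_mem (x := u) (y := u')
    (by simpa [dist_eq_norm] using hu) (by simpa [dist_eq_norm] using hu') ht
  simpa [dist_eq_norm] using this

theorem abs_eval_sub_le {d : ℕ} (q : MvPolynomial (Fin d) ℝ) (z : Fin d → ℝ) {R K : ℝ}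
    (hK : ∀ a v, ‖v - z‖ ≤ R → |MvPolynomial.eval v (MvPolynomial.pderiv a q)| ≤ K)
    {u u' : Fin d → ℝ} (hu : ‖u - z‖ ≤ R) (hu' : ‖u' - z‖ ≤ R) :
    |MvPolynomial.eval u q - MvPolynomial.eval u' q| ≤ d * K * ‖u - u'‖ := by
  obtain ⟨t, ht, h⟩ := exists_poly_mean_value q u' u
  rw [h, polyDeriv_apply]
  refine (Finset.abs_sum_le_sum_abs _ _).trans ?_
  calc _ ≤ ∑ a : Fin d, K * ‖u - u'‖ := by
        refine Finset.sum_le_sum fun a _ => ?_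
        rw [abs_mul]
        have h0 := hK a _ (norm_line_sub_le ht hu' hu)
        exact mul_le_mul h0 (norm_le_pi_norm (u - u') a) (abs_nonneg _) ((abs_nonneg _).trans h0)
    _ = _ := by simp; ring

/-- Iterated partial derivative along a list of coordinates. -/
def iterPDeriv {d : ℕ} (β : List (Fin d)) (q : MvPolynomial (Fin d) ℝ) : MvPolynomial (Fin d) ℝ :=
  β.foldr (fun a q => MvPolynomial.pderiv a q) q

theorem iterPDeriv_sub {d : ℕ} (β : List (Fin d)) (p q : MvPolynomial (Fin d) ℝ) :
    iterPDeriv β (p - q) = iterPDeriv β p - iterPDeriv β q := by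
  induction β with
  | nil => rfl
  | cons a β ih => simp only [iterPDeriv, List.foldr_cons] at ih ⊢; rw [ih, map_sub]

theorem exists_flat_bound {d : ℕ} (l : ℕ) (q : MvPolynomial (Fin d) ℝ) (z : Fin d → ℝ)
    (h : ∀ γ : List (Fin d), 1 ≤ γ.length → γ.length ≤ l →
      MvPolynomial.eval z (iterPDeriv γ q) = 0) :
    ∃ K : ℝ, 0 ≤ K ∧ ∀ R : ℝ, 0 ≤ R → R ≤ 1 → ∀ u u' : Fin d → ℝ, ‖u - z‖ ≤ R → ‖u' - z‖ ≤ R →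
      |MvPolynomial.eval u q - MvPolynomial.eval u' q| ≤ K * R ^ l * ‖u - u'‖ := by
  induction l generalizing q with
  | zero =>
    choose K hK0 hK using fun a => exists_bound_eval (MvPolynomial.pderiv a q) z 1
    refine ⟨d * ∑ a, K a, mul_nonneg (by positivity) (Finset.sum_nonneg fun a _ => hK0 a), ?_⟩
    intro R _ hR1 u u' hu hu'
    rw [pow_zero, mul_one]
    exact abs_eval_sub_le q z (fun a v hv => (hK a v hv).trans
      (Finset.single_le_sum (fun a _ => hK0 a) (Finset.mem_univ a))) (hu.trans hR1) (hu'.trans hR1)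
  | succ l ih =>
    have hstep : ∀ a, ∃ K : ℝ, 0 ≤ K ∧ ∀ R : ℝ, 0 ≤ R → R ≤ 1 → ∀ u u' : Fin d → ℝ,
        ‖u - z‖ ≤ R → ‖u' - z‖ ≤ R → |MvPolynomial.eval u (MvPolynomial.pderiv a q) -
          MvPolynomial.eval u' (MvPolynomial.pderiv a q)| ≤ K * R ^ l * ‖u - u'‖ := by
      intro a
      refine ih _ fun γ h1 h2 => ?_
      have := h (γ ++ [a]) (by simp) (by simpa using h2)
      simpa [iterPDeriv] using this
    choose K hK0 hK using hstep
    refine ⟨d * ∑ a, K a, mul_nonneg (by positivity) (Finset.sum_nonneg fun a _ => hK0 a), ?_⟩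
    intro R hR hR1 u u' hu hu'
    have := abs_eval_sub_le q z (R := R) (K := (∑ a, K a) * R ^ (l + 1)) (fun a v hv => by
      have h1 := hK a R hR hR1 v z hv (by simpa using hR)
      have h0 : MvPolynomial.eval z (MvPolynomial.pderiv a q) = 0 := by
        simpa [iterPDeriv] using h [a] (by simp) (by simp)
      rw [h0, sub_zero] at h1
      calc _ ≤ K a * R ^ l * ‖v - z‖ := h1
        _ ≤ K a * R ^ l * R := by have := hK0 a; gcongr
        _ = K a * R ^ (l + 1) := by ring
        _ ≤ _ := by
          gcongr
          exact Finset.single_le_sum (fun a _ => hK0 a) (Finset.mem_univ a)) hu hu'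
    calc _ ≤ _ := this
      _ = _ := by ring

theorem totalDegree_pderiv_le {d : ℕ} (a : Fin d) (q : MvPolynomial (Fin d) ℝ) :
    (MvPolynomial.pderiv a q).totalDegree ≤ q.totalDegree := by
  refine Finset.sup_le fun m hm => ?_
  rw [MvPolynomial.mem_support_iff, MvPolynomial.coeff_pderiv] at hm
  have h1 : m + Finsupp.single a 1 ∈ q.support := by
    rw [MvPolynomial.mem_support_iff]; exact left_ne_zero_of_mul hm
  refine le_trans ?_ (MvPolynomial.le_totalDegree h1)
  rw [Finsupp.sum_add_index'] <;> simp

/-- A Markov-type inequality for iterated partial derivatives. -/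
theorem exists_markov_bound (d N l : ℕ) : ∃ C : ℝ, 0 ≤ C ∧ ∀ q : MvPolynomial (Fin d) ℝ,
    q.totalDegree ≤ N → ∀ (z : Fin d → ℝ) (r M : ℝ), 0 < r →
    (∀ v, ‖v - z‖ ≤ 2 ^ l * r → |MvPolynomial.eval v q| ≤ M) →
    ∀ β : List (Fin d), β.length = l → ∀ v, ‖v - z‖ ≤ r →
      |MvPolynomial.eval v (iterPDeriv β q)| ≤ C * M / r ^ l := by
  obtain ⟨C₀, hC₀, hL⟩ := exists_lagrange_bound N
  have deg : ∀ (β : List (Fin d)) (q : MvPolynomial (Fin d) ℝ), q.totalDegree ≤ N →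
      (iterPDeriv β q).totalDegree ≤ N := by
    intro β q hq
    induction β with
    | nil => exact hq
    | cons a β ih => exact (totalDegree_pderiv_le a _).trans ih
  induction l with
  | zero =>
    refine ⟨1, zero_le_one, fun q _ z r M _ h β hβ v hv => ?_⟩
    rw [List.length_eq_zero_iff.1 hβ]
    simpa [iterPDeriv] using h v (by simpa using hv)
  | succ l ih =>
    obtain ⟨C, hC, ih⟩ := ih
    refine ⟨C₀ * C, mul_nonneg hC₀ hC, fun q hq z r M hr h β hβ v hv => ?_⟩
    obtain ⟨a, β, rfl⟩ := List.exists_cons_of_length_eq_add_one hβ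
    have hβ' : β.length = l := by simpa using hβ
    have h2 := ih q hq z (2 * r) M (by positivity) (fun v hv => h v (by
      rw [pow_succ]; linarith [hv])) β hβ'
    have h3 := (hL (lineRestrict (iterPDeriv β q) v (r • Pi.single a 1))
      ((natDegree_lineRestrict_le _ _ _).trans (deg β q hq)) (C * M / (2 * r) ^ l) (fun j hj => by
        rw [eval_lineRestrict]
        refine h2 _ ?_
        have hj' : ((j : ℝ) + 1) / (N + 1) ≤ 1 := by
          rw [div_le_one (by positivity)]
          have : j ≤ N := Nat.lt_succ_iff.1 (Finset.mem_range.1 hj)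
          have : (j : ℝ) ≤ N := by exact_mod_cast this
          linarith
        calc _ = ‖(v - z) + (((j : ℝ) + 1) / (N + 1)) • (r • (Pi.single a 1 : Fin d → ℝ))‖ := by
              congr 1; abel
          _ ≤ r + 1 * (r * 1) := by
            refine (norm_add_le _ _).trans (add_le_add hv ?_)
            have : ‖(Pi.single a 1 : Fin d → ℝ)‖ ≤ 1 := by rw [Pi.norm_single]; simp
            rw [norm_smul, norm_smul,
              Real.norm_of_nonneg (by positivity : (0 : ℝ) ≤ (j + 1) / (N + 1)),
              Real.norm_of_nonneg hr.le]
            gcongr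
          _ = 2 * r := by ring)).2
    rw [eval_derivative_lineRestrict, map_smul, smul_eq_mul, polyDeriv_apply] at h3
    have h4 : ∑ b, MvPolynomial.eval v (MvPolynomial.pderiv b (iterPDeriv β q)) *
        (Pi.single a 1 : Fin d → ℝ) b = MvPolynomial.eval v (iterPDeriv (a :: β) q) := by
      simp [Pi.single_apply, iterPDeriv]
    rw [h4, abs_mul, abs_of_pos hr] at h3
    have hM : 0 ≤ M := (abs_nonneg _).trans (h z (by simp; positivity))
    rw [le_div_iff₀ (by positivity), pow_succ]
    calc _ = (r * |MvPolynomial.eval v (iterPDeriv (a :: β) q)|) * r ^ l := by ring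
      _ ≤ (C₀ * (C * M / (2 * r) ^ l)) * r ^ l := by gcongr
      _ = C₀ * C * M / 2 ^ l := by rw [mul_pow]; field_simp
      _ ≤ C₀ * C * M := div_le_self (by positivity) (one_le_pow₀ (by norm_num))

theorem exists_coord_bound {d : ℕ} (q : MvPolynomial (Fin d) ℝ) (z : Fin d → ℝ) (a : Fin d)
    (h : MvPolynomial.eval z (MvPolynomial.pderiv a q) = 0) :
    ∃ K : ℝ, 0 ≤ K ∧ ∀ R : ℝ, 0 ≤ R → R ≤ 1 → ∀ u u' : Fin d → ℝ, ‖u - z‖ ≤ R → ‖u' - z‖ ≤ R →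
      (∀ b ≠ a, u b = u' b) →
      |MvPolynomial.eval u q - MvPolynomial.eval u' q| ≤ K * R * |u a - u' a| := by
  obtain ⟨K, hK, hb⟩ := exists_flat_bound 0 (MvPolynomial.pderiv a q) z (by intro γ h1 h2; omega)
  refine ⟨K, hK, fun R hR hR1 u u' hu hu' hne => ?_⟩
  obtain ⟨t, ht, hm⟩ := exists_poly_mean_value q u' u
  have hpt := norm_line_sub_le ht hu' hu
  have h1 := hb R hR hR1 _ z hpt (by simpa using hR)
  rw [h, sub_zero, pow_zero, mul_one] at h1
  rw [hm, polyDeriv_apply, Finset.sum_eq_single a (fun b _ hb => by simp [hne b hb]) (by simp),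
    abs_mul]
  exact mul_le_mul_of_nonneg_right (h1.trans (by gcongr)) (abs_nonneg _)

/-- Substitute the polynomial `ψ` for the coordinate `a`. -/
def substCoord {d : ℕ} (a : Fin (d + 1)) (ψ : MvPolynomial (Fin d) ℝ)
    (q : MvPolynomial (Fin (d + 1)) ℝ) : MvPolynomial (Fin d) ℝ :=
  MvPolynomial.bind₁ (a.insertNth (α := fun _ => MvPolynomial (Fin d) ℝ) ψ MvPolynomial.X) q

/-- The point of the graph of `ψ` above `v`. -/
def graphPt {d : ℕ} (a : Fin (d + 1)) (ψ : MvPolynomial (Fin d) ℝ) (v : Fin d → ℝ) :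
    Fin (d + 1) → ℝ :=
  a.insertNth (α := fun _ => ℝ) (MvPolynomial.eval v ψ) v

@[simp] theorem graphPt_same {d : ℕ} (a : Fin (d + 1)) (ψ : MvPolynomial (Fin d) ℝ)
    (v : Fin d → ℝ) : graphPt a ψ v a = MvPolynomial.eval v ψ := by simp [graphPt]

@[simp] theorem graphPt_succAbove {d : ℕ} (a : Fin (d + 1)) (ψ : MvPolynomial (Fin d) ℝ)
    (v : Fin d → ℝ) (i : Fin d) : graphPt a ψ v (a.succAbove i) = v i := by simp [graphPt]

theorem graphPt_of_ne {d : ℕ} (a : Fin (d + 1)) (ψ φ : MvPolynomial (Fin d) ℝ)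
    (v : Fin d → ℝ) (b : Fin (d + 1)) (hb : b ≠ a) : graphPt a ψ v b = graphPt a φ v b := by
  obtain ⟨i, rfl⟩ := Fin.exists_succAbove_eq hb
  simp

theorem eval_substCoord {d : ℕ} (a : Fin (d + 1)) (ψ : MvPolynomial (Fin d) ℝ)
    (q : MvPolynomial (Fin (d + 1)) ℝ) (v : Fin d → ℝ) :
    MvPolynomial.eval v (substCoord a ψ q) = MvPolynomial.eval (graphPt a ψ v) q := by
  unfold substCoord
  induction q using MvPolynomial.induction_on with
  | C a => simp
  | add p q hp hq => rw [map_add, map_add, map_add, hp, hq]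
  | mul_X p i hp =>
    rw [map_mul, map_mul, map_mul, hp, MvPolynomial.bind₁_X_right, MvPolynomial.eval_X]
    congr 1
    refine Fin.succAboveCases a ?_ (fun i => ?_) i <;> simp [graphPt]

theorem graphPt_removeNth {d : ℕ} (a : Fin (d + 1)) (ψ : MvPolynomial (Fin d) ℝ)
    (z : Fin (d + 1) → ℝ) (h : MvPolynomial.eval (a.removeNth z) ψ = z a) :
    graphPt a ψ (a.removeNth z) = z := by
  rw [graphPt, h, Fin.insertNth_self_removeNth]

theorem norm_graphPt_sub_le {d : ℕ} (a : Fin (d + 1)) (ψ : MvPolynomial (Fin d) ℝ)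
    (z : Fin (d + 1) → ℝ) (v : Fin d → ℝ) {R : ℝ} (hR : 0 ≤ R) (h1 : ‖v - a.removeNth z‖ ≤ R)
    (h2 : |MvPolynomial.eval v ψ - z a| ≤ R) : ‖graphPt a ψ v - z‖ ≤ R := by
  rw [pi_norm_le_iff_of_nonneg hR, Fin.forall_iff_succAbove a]
  refine ⟨by simpa using h2, fun i => ?_⟩
  have := (norm_le_pi_norm (v - a.removeNth z) i).trans h1
  simpa [Fin.removeNth] using this

theorem norm_removeNth_sub_le {d : ℕ} (a : Fin (d + 1)) (z z' : Fin (d + 1) → ℝ) :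
    ‖a.removeNth z - a.removeNth z'‖ ≤ ‖z - z'‖ := by
  rw [pi_norm_le_iff_of_nonneg (norm_nonneg _)]
  exact fun i => norm_le_pi_norm (z - z') (a.succAbove i)

theorem norm_graphPt_sub_graphPt_le {d : ℕ} (a : Fin (d + 1)) (ψ φ : MvPolynomial (Fin d) ℝ)
    (v : Fin d → ℝ) :
    ‖graphPt a ψ v - graphPt a φ v‖ ≤ |MvPolynomial.eval v ψ - MvPolynomial.eval v φ| := by
  rw [pi_norm_le_iff_of_nonneg (abs_nonneg _), Fin.forall_iff_succAbove a]
  exact ⟨by simp, fun i => by simp⟩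

theorem exists_lipschitz_eval {d : ℕ} (q : MvPolynomial (Fin d) ℝ) (z : Fin d → ℝ) :
    ∃ K : ℝ, 0 ≤ K ∧ ∀ u, ‖u - z‖ ≤ 1 →
      |MvPolynomial.eval u q - MvPolynomial.eval z q| ≤ K * ‖u - z‖ := by
  obtain ⟨K, hK, hb⟩ := exists_flat_bound 0 q z (by intro γ h1 h2; omega)
  exact ⟨K, hK, fun u hu => by simpa using hb 1 zero_le_one le_rfl u z hu (by simp)⟩

/-- Newton iteration: polynomial solutions, up to any prescribed order, of an implicit
equation. -/
theorem exists_approx_implicit {d : ℕ} (w : MvPolynomial (Fin (d + 1)) ℝ) (z : Fin (d + 1) → ℝ)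
    (a : Fin (d + 1)) (hθ : MvPolynomial.eval z (MvPolynomial.pderiv a w) ≠ 0) (j : ℕ) :
    ∃ ψ : MvPolynomial (Fin d) ℝ, MvPolynomial.eval (a.removeNth z) ψ = z a ∧
      ∃ K δ : ℝ, 0 ≤ K ∧ 0 < δ ∧ ∀ v, ‖v - a.removeNth z‖ ≤ δ →
        |MvPolynomial.eval (graphPt a ψ v) w - MvPolynomial.eval z w|
          ≤ K * ‖v - a.removeNth z‖ ^ (j + 1) := by
  set θ := MvPolynomial.eval z (MvPolynomial.pderiv a w) with hθdef
  set z' : Fin d → ℝ := a.removeNth z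
  induction j with
  | zero =>
    refine ⟨MvPolynomial.C (z a), by simp, ?_⟩
    obtain ⟨K, hK, hb⟩ := exists_lipschitz_eval w z
    refine ⟨K, 1, hK, one_pos, fun v hv => ?_⟩
    have h1 := norm_graphPt_sub_le a (MvPolynomial.C (z a)) z v (norm_nonneg _) le_rfl (by simp)
    rw [zero_add, pow_one]
    exact (hb _ (h1.trans hv)).trans (by gcongr)
  | succ j ih =>
    obtain ⟨ψ, hψ, K, δ, hK, hδ, hb⟩ := ih
    set e : MvPolynomial (Fin d) ℝ := substCoord a ψ w - MvPolynomial.C (MvPolynomial.eval z w)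
    set φ : MvPolynomial (Fin d) ℝ := ψ - MvPolynomial.C θ⁻¹ * e
    have he : ∀ v, MvPolynomial.eval v e =
        MvPolynomial.eval (graphPt a ψ v) w - MvPolynomial.eval z w := by
      intro v; simp [e, eval_substCoord]
    have hφ : ∀ v, MvPolynomial.eval v φ =
        MvPolynomial.eval v ψ - θ⁻¹ * MvPolynomial.eval v e := by
      intro v; simp [φ]
    have hφz : MvPolynomial.eval z' φ = z a := by
      rw [hφ, he, graphPt_removeNth a ψ z hψ, hψ]; simp
    set h : MvPolynomial (Fin (d + 1)) ℝ := w - MvPolynomial.C θ * MvPolynomial.X a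
    have hh : ∀ u, MvPolynomial.eval u h = MvPolynomial.eval u w - θ * u a := by
      intro u; simp [h]
    have hh0 : MvPolynomial.eval z (MvPolynomial.pderiv a h) = 0 := by
      simp [h, hθdef]
    obtain ⟨H, hH, hHb⟩ := exists_coord_bound h z a hh0
    obtain ⟨L₁, hL₁, hLb₁⟩ := exists_lipschitz_eval ψ z'
    obtain ⟨L₂, hL₂, hLb₂⟩ := exists_lipschitz_eval φ z'
    set Λ := 1 + L₁ + L₂
    have hΛ : 0 < Λ := by positivity
    refine ⟨φ, hφz, H * Λ * (|θ⁻¹| * K), min δ (min 1 Λ⁻¹), by positivity, by positivity,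
      fun v hv => ?_⟩
    have hv1 := hv.trans (min_le_left _ _)
    have hv2 := hv.trans ((min_le_right _ _).trans (min_le_left _ _))
    have hv3 := hv.trans ((min_le_right _ _).trans (min_le_right _ _))
    set R := ‖v - z'‖
    have hR : 0 ≤ R := norm_nonneg _
    have hΛR : Λ * R ≤ 1 := by
      calc Λ * R ≤ Λ * Λ⁻¹ := by gcongr
        _ = 1 := mul_inv_cancel₀ hΛ.ne'
    have hRΛ : R ≤ Λ * R := by
      have : 0 ≤ (L₁ + L₂) * R := by positivity
      simp only [Λ]; linarith
    have b1 : ‖graphPt a ψ v - z‖ ≤ Λ * R :=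
      norm_graphPt_sub_le a ψ z v (by positivity) hRΛ (by
        have := hLb₁ v hv2
        rw [hψ] at this
        refine this.trans ?_
        gcongr; simp only [Λ]; linarith)
    have b2 : ‖graphPt a φ v - z‖ ≤ Λ * R :=
      norm_graphPt_sub_le a φ z v (by positivity) hRΛ (by
        have := hLb₂ v hv2
        rw [hφz] at this
        refine this.trans ?_
        gcongr; simp only [Λ]; linarith)
    have key := hHb (Λ * R) (by positivity) hΛR _ _ b2 b1
      (fun b hb => graphPt_of_ne a φ ψ v b hb)
    have e1 : MvPolynomial.eval (graphPt a φ v) w - MvPolynomial.eval z w =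
        MvPolynomial.eval (graphPt a φ v) h - MvPolynomial.eval (graphPt a ψ v) h := by
      rw [hh, hh, graphPt_same, graphPt_same, hφ, he]
      field_simp
      ring
    rw [e1]
    refine key.trans ?_
    have e2 : |graphPt a φ v a - graphPt a ψ v a| ≤ |θ⁻¹| * (K * R ^ (j + 1)) := by
      rw [graphPt_same, graphPt_same, hφ, sub_sub_cancel_left, abs_neg, abs_mul, he]
      exact mul_le_mul_of_nonneg_left (hb v hv1) (abs_nonneg _)
    calc _ ≤ H * (Λ * R) * (|θ⁻¹| * (K * R ^ (j + 1))) := by gcongr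
      _ = _ := by ring

/-- Quantitative data at a single base point allowing the elimination of the coordinate `a` by
means of the function `w`. -/
structure ElimData {d m : ℕ} (k l : ℕ) (a : Fin (d + 1)) (z : Fin (d + 1) → ℝ)
    (w : MvPolynomial (Fin (d + 1)) ℝ) (P : Fin m → MvPolynomial (Fin (d + 1)) ℝ)
    (ψ : MvPolynomial (Fin d) ℝ) (K δ : ℝ) : Prop where
  lip : ∀ v, ‖v - a.removeNth z‖ ≤ δ → |MvPolynomial.eval v ψ - z a| ≤ K * ‖v - a.removeNth z‖
  err : ∀ v, ‖v - a.removeNth z‖ ≤ δ → |MvPolynomial.eval (graphPt a ψ v) w - MvPolynomial.eval z w|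
    ≤ K * ‖v - a.removeNth z‖ ^ (k - l)
  flat : ∀ R, 0 ≤ R → R ≤ 1 → ∀ u u', ‖u - z‖ ≤ R → ‖u' - z‖ ≤ R → ∀ i,
    |MvPolynomial.eval u (P i) - MvPolynomial.eval u' (P i)| ≤ K * R ^ l * ‖u - u'‖
  expand : ∀ u u', ‖u - z‖ ≤ δ → ‖u' - z‖ ≤ δ → (∀ b ≠ a, u b = u' b) →
    |u a - u' a| ≤ K * |MvPolynomial.eval u w - MvPolynomial.eval u' w|

theorem ElimData.mono {d m k l : ℕ} {a : Fin (d + 1)} {z : Fin (d + 1) → ℝ}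
    {w : MvPolynomial (Fin (d + 1)) ℝ} {P : Fin m → MvPolynomial (Fin (d + 1)) ℝ}
    {ψ : MvPolynomial (Fin d) ℝ} {K δ K' δ' : ℝ} (h : ElimData k l a z w P ψ K δ) (hK : K ≤ K')
    (hδ : δ' ≤ δ) : ElimData k l a z w P ψ K' δ' where
  lip v hv := (h.lip v (hv.trans hδ)).trans (by gcongr)
  err v hv := (h.err v (hv.trans hδ)).trans (by gcongr)
  flat R hR hR1 u u' hu hu' i := (h.flat R hR hR1 u u' hu hu' i).trans (by gcongr)
  expand u u' hu hu' hne := (h.expand u u' (hu.trans hδ) (hu'.trans hδ) hne).trans (by gcongr)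

theorem exists_elimData {d m k l : ℕ} (hlk : l < k) (a : Fin (d + 1)) (z : Fin (d + 1) → ℝ)
    (w : MvPolynomial (Fin (d + 1)) ℝ) (P : Fin m → MvPolynomial (Fin (d + 1)) ℝ)
    (hw : MvPolynomial.eval z (MvPolynomial.pderiv a w) ≠ 0)
    (hP : ∀ i, ∀ γ : List (Fin (d + 1)), 1 ≤ γ.length → γ.length ≤ l →
      MvPolynomial.eval z (iterPDeriv γ (P i)) = 0) :
    ∃ ψ, MvPolynomial.eval (a.removeNth z) ψ = z a ∧
      ∃ K δ, 0 ≤ K ∧ 0 < δ ∧ ElimData k l a z w P ψ K δ := by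
  obtain ⟨ψ, hψ, K₁, δ₁, hK₁, hδ₁, h₁⟩ := exists_approx_implicit w z a hw (k - l - 1)
  rw [show k - l - 1 + 1 = k - l by omega] at h₁
  obtain ⟨K₂, hK₂, h₂⟩ := exists_lipschitz_eval ψ (a.removeNth z)
  choose K₃ hK₃ h₃ using fun i => exists_flat_bound l (P i) z (hP i)
  set θ := MvPolynomial.eval z (MvPolynomial.pderiv a w) with hθ
  obtain ⟨H, hH, h₄⟩ := exists_coord_bound (w - MvPolynomial.C θ * MvPolynomial.X a) z a
    (by simp [hθ])
  have hθ0 : 0 < |θ| := abs_pos.2 hw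
  have hS : ∀ i, K₃ i ≤ ∑ i, K₃ i := fun i =>
    Finset.single_le_sum (fun i _ => hK₃ i) (Finset.mem_univ i)
  have hS0 : 0 ≤ ∑ i, K₃ i := Finset.sum_nonneg fun i _ => hK₃ i
  have hT : 0 < 2 / |θ| := by positivity
  set δ₀ := |θ| / 2 / (H + 1) with hδ₀
  refine ⟨ψ, hψ, K₁ + K₂ + ∑ i, K₃ i + 2 / |θ|, min δ₁ (min 1 δ₀), by positivity, by positivity,
    ⟨fun v hv => ?_, fun v hv => ?_, fun R hR hR1 u u' hu hu' i => ?_,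
      fun u u' hu hu' hne => ?_⟩⟩
  · have := h₂ v (hv.trans ((min_le_right _ _).trans (min_le_left _ _)))
    rw [hψ] at this
    exact this.trans (by gcongr; linarith)
  · exact (h₁ v (hv.trans (min_le_left _ _))).trans (by gcongr; linarith)
  · exact (h₃ i R hR hR1 u u' hu hu').trans (by gcongr; linarith [hS i])
  · set R := min (1 : ℝ) δ₀
    have hR : 0 ≤ R := by positivity
    have h5 := h₄ R hR (min_le_left _ _) u u' (hu.trans (min_le_right _ _))
      (hu'.trans (min_le_right _ _)) hne
    have h6 : H * R ≤ |θ| / 2 := by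
      calc H * R ≤ (H + 1) * δ₀ := by gcongr; · linarith
                                      · exact min_le_right _ _
        _ = |θ| / 2 := by rw [hδ₀]; field_simp
    simp only [map_sub, map_mul, MvPolynomial.eval_C, MvPolynomial.eval_X] at h5
    set A := MvPolynomial.eval u w
    set B := MvPolynomial.eval u' w
    have h7 : |θ| * |u a - u' a| ≤ |A - B| + |θ| / 2 * |u a - u' a| := by
      calc |θ| * |u a - u' a| = |(A - B) - (A - θ * u a - (B - θ * u' a))| := by
            rw [← abs_mul]; congr 1; ring
        _ ≤ |A - B| + |A - θ * u a - (B - θ * u' a)| := abs_sub _ _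
        _ ≤ |A - B| + |θ| / 2 * |u a - u' a| := by
          gcongr; exact h5.trans (by gcongr)
    have h8 : |u a - u' a| ≤ 2 / |θ| * |A - B| := by
      rw [div_mul_eq_mul_div, le_div_iff₀ hθ0]; linarith
    exact h8.trans (by gcongr; linarith)

theorem ElimData.abs_sub_le {d m k l : ℕ} (hlk : l ≤ k) {a : Fin (d + 1)}
    {zx zy : Fin (d + 1) → ℝ} {wx wy : MvPolynomial (Fin (d + 1)) ℝ}
    {Px Py : Fin m → MvPolynomial (Fin (d + 1)) ℝ} {ψx ψy : MvPolynomial (Fin d) ℝ}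
    {K δ C Cw r : ℝ} (hx : ElimData k l a zx wx Px ψx K δ) (hy : ElimData k l a zy wy Py ψy K δ)
    (hK : 1 ≤ K) (hr : 0 < r) (hrδ : 3 * K * r ≤ δ) (hr1 : 3 * K * r ≤ 1)
    (hz : ‖zx - zy‖ ≤ r)
    (hP : ∀ v, ‖v - zx‖ ≤ K * r → ∀ i,
      |MvPolynomial.eval v (Px i) - MvPolynomial.eval v (Py i)| ≤ C * (K * r) ^ k)
    (hw : ∀ v, ‖v - zx‖ ≤ 3 * K * r →
      |MvPolynomial.eval v wx - MvPolynomial.eval v wy| ≤ Cw * (3 * K * r) ^ (k - l))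
    (hc : |MvPolynomial.eval zx wx - MvPolynomial.eval zy wy| ≤ r ^ (k - l))
    (v : Fin d → ℝ) (hv : ‖v - a.removeNth zx‖ ≤ r) (i : Fin m) :
    |MvPolynomial.eval v (substCoord a ψx (Px i)) - MvPolynomial.eval v (substCoord a ψy (Py i))| ≤
      (C * K ^ k + K * (3 * K) ^ l *
        (K * (K + 1 + K * 2 ^ (k - l) + Cw * (3 * K) ^ (k - l)))) * r ^ k := by
  rw [eval_substCoord, eval_substCoord]
  set u := graphPt a ψx v with hu
  set u' := graphPt a ψy v with hu'
  have hKr : r ≤ K * r := le_mul_of_one_le_left hr.le hK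
  have hvy : ‖v - a.removeNth zy‖ ≤ 2 * r := by
    calc _ = ‖(v - a.removeNth zx) + (a.removeNth zx - a.removeNth zy)‖ := by congr 1; abel
      _ ≤ r + r := (norm_add_le _ _).trans
        (add_le_add hv ((norm_removeNth_sub_le a zx zy).trans hz))
      _ = 2 * r := by ring
  have hvδ : ‖v - a.removeNth zx‖ ≤ δ := hv.trans (by linarith)
  have hvyδ : ‖v - a.removeNth zy‖ ≤ δ := hvy.trans (by linarith)
  have ux : ‖u - zx‖ ≤ K * r := norm_graphPt_sub_le a ψx zx v (by positivity) (hv.trans hKr)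
    ((hx.lip v hvδ).trans (by gcongr))
  have uy' : ‖u' - zy‖ ≤ 2 * (K * r) := norm_graphPt_sub_le a ψy zy v (by positivity)
    (hvy.trans (by linarith)) ((hy.lip v hvyδ).trans (by
      calc K * ‖v - a.removeNth zy‖ ≤ K * (2 * r) := by gcongr
        _ = _ := by ring))
  have ux' : ‖u' - zx‖ ≤ 3 * K * r := by
    calc _ = ‖(u' - zy) - (zx - zy)‖ := by congr 1; abel
      _ ≤ 2 * (K * r) + r := (norm_sub_le _ _).trans (add_le_add uy' hz)
      _ ≤ _ := by linarith
  have uy : ‖u - zy‖ ≤ 3 * K * r := by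
    calc _ = ‖(u - zx) + (zx - zy)‖ := by congr 1; abel
      _ ≤ K * r + r := (norm_add_le _ _).trans (add_le_add ux hz)
      _ ≤ _ := by linarith
  have uy'3 : ‖u' - zy‖ ≤ 3 * K * r := uy'.trans (by nlinarith)
  have ux3 : ‖u - zx‖ ≤ 3 * K * r := ux.trans (by nlinarith)
  have hne : ∀ b ≠ a, u b = u' b := fun b hb => graphPt_of_ne a ψx ψy v b hb
  have e1 := hx.err v hvδ
  have e2 := hy.err v hvyδ
  have e3 := hw u' ux'
  have E : |u a - u' a| ≤ K * (K + 1 + K * 2 ^ (k - l) + Cw * (3 * K) ^ (k - l)) * r ^ (k - l) := by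
    refine (hx.expand u u' (ux3.trans hrδ) (ux'.trans hrδ) hne).trans ?_
    rw [mul_assoc]
    gcongr
    set p := MvPolynomial.eval u wx
    set p' := MvPolynomial.eval u' wx
    set q' := MvPolynomial.eval u' wy
    set cx := MvPolynomial.eval zx wx
    set cy := MvPolynomial.eval zy wy
    have e1' : |p - cx| ≤ K * r ^ (k - l) := e1.trans (by gcongr)
    have e2' : |q' - cy| ≤ K * (2 * r) ^ (k - l) := e2.trans (by gcongr)
    calc |p - p'| = |((p - cx) + (cx - cy)) - ((q' - cy) + (p' - q'))| := by congr 1; ring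
      _ ≤ (|p - cx| + |cx - cy|) + (|q' - cy| + |p' - q'|) :=
        (abs_sub _ _).trans (add_le_add (abs_add_le _ _) (abs_add_le _ _))
      _ ≤ (K * r ^ (k - l) + r ^ (k - l)) +
          (K * (2 * r) ^ (k - l) + Cw * (3 * K * r) ^ (k - l)) := by gcongr
      _ = _ := by rw [mul_pow, mul_pow (3 * K)]; ring
  have hN : ‖u - u'‖ ≤ |u a - u' a| := by
    simpa [hu, hu'] using norm_graphPt_sub_graphPt_le a ψx ψy v
  have f1 := hP u ux i
  have f2 := hy.flat (3 * K * r) (by positivity) hr1 u u' uy uy'3 i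
  calc _ = |(MvPolynomial.eval u (Px i) - MvPolynomial.eval u (Py i)) +
        (MvPolynomial.eval u (Py i) - MvPolynomial.eval u' (Py i))| := by congr 1; ring
    _ ≤ C * (K * r) ^ k + K * (3 * K * r) ^ l *
        (K * (K + 1 + K * 2 ^ (k - l) + Cw * (3 * K) ^ (k - l)) * r ^ (k - l)) := by
      refine (abs_add_le _ _).trans (add_le_add f1 (f2.trans ?_))
      gcongr
      exact hN.trans E
    _ = C * K ^ k * r ^ k + K * (3 * K) ^ l *
        (K * (K + 1 + K * 2 ^ (k - l) + Cw * (3 * K) ^ (k - l))) * (r ^ l * r ^ (k - l)) := by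
      rw [mul_pow, mul_pow (3 * K)]; ring
    _ = _ := by rw [← pow_add, Nat.add_sub_cancel' hlk]; ring

/-- A set is null for an outer measure if it is covered by countably many null conditions. -/
theorem measure_null_of_forall_exists {X ι : Type*} [Countable ι] (ν : OuterMeasure X) {A : Set X}
    (R : X → ι → Prop) (hR : ∀ x ∈ A, ∃ c, R x c) (h : ∀ c, ν {x ∈ A | R x c} = 0) : ν A = 0 := by
  refine measure_mono_null (t := ⋃ c, {x ∈ A | R x c}) (fun x hx => ?_) (measure_iUnion_null h)
  obtain ⟨c, hc⟩ := hR x hx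
  exact mem_iUnion.2 ⟨c, hx, hc⟩

/-- A family of polynomial jets of order `k - 1` at the points `z x` satisfying uniform
Whitney-type compatibility conditions with respect to the gauge `ρ`. -/
structure JetField {X : Type*} {d m : ℕ} (A : Set X) (ρ : X → X → ℝ) (z : X → Fin d → ℝ)
    (P : X → Fin m → MvPolynomial (Fin d) ℝ) (F : X → Fin m → ℝ) (k : ℕ) (C δ : ℝ) : Prop where
  pos : 0 < δ
  value : ∀ x ∈ A, ∀ i, MvPolynomial.eval (z x) (P x i) = F x i
  near : ∀ x ∈ A, ∀ y ∈ A, ‖z x - z y‖ ≤ ρ x y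
  est : ∀ x ∈ A, ∀ y ∈ A, ∀ r, 0 < r → ρ x y ≤ r → r ≤ δ → ∀ v, ‖v - z x‖ ≤ r → ∀ i,
    |MvPolynomial.eval v (P x i) - MvPolynomial.eval v (P y i)| ≤ C * r ^ k

theorem JetField.subset {X : Type*} {d m k : ℕ} {A B : Set X} {ρ : X → X → ℝ} {z : X → Fin d → ℝ}
    {P : X → Fin m → MvPolynomial (Fin d) ℝ} {F : X → Fin m → ℝ} {C δ : ℝ}
    (h : JetField A ρ z P F k C δ) (hB : B ⊆ A) : JetField B ρ z P F k C δ where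
  pos := h.pos
  value x hx := h.value x (hB hx)
  near x hx y hy := h.near x (hB hx) y (hB hy)
  est x hx y hy := h.est x (hB hx) y (hB hy)

theorem JetField.mono_const {X : Type*} {d m k : ℕ} {A : Set X} {ρ : X → X → ℝ} {z : X → Fin d → ℝ}
    {P : X → Fin m → MvPolynomial (Fin d) ℝ} {F : X → Fin m → ℝ} {C C' δ : ℝ}
    (h : JetField A ρ z P F k C δ) (hC : C ≤ C') : JetField A ρ z P F k C' δ where
  pos := h.pos
  value := h.value
  near := h.near
  est x hx y hy r hr h1 h2 v hv i := (h.est x hx y hy r hr h1 h2 v hv i).trans (by gcongr)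

/-- On `B`, some components of `F` have independent derivatives and control all the others up to
an error of order `k`. -/
def IsControlled {X : Type*} {d m : ℕ} (B : Set X) (ρ : X → X → ℝ) (z : X → Fin d → ℝ)
    (P : X → Fin m → MvPolynomial (Fin d) ℝ) (F : X → Fin m → ℝ) (k : ℕ) : Prop :=
  ∃ (I : Finset (Fin m)) (C δ : ℝ), 0 ≤ C ∧ 0 < δ ∧
    (∀ x ∈ B, ∀ y : Fin m → ℝ, ∃ v, ∀ i ∈ I, polyDeriv (P x i) (z x) v = y i) ∧
    ∀ x ∈ B, ∀ y ∈ B, 0 < ρ x y → ρ x y ≤ δ → (∀ i, |F x i - F y i| ≤ δ) →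
      ∀ i, |F x i - F y i| ≤ C * (ρ x y ^ k + ∑ j ∈ I, |F x j - F y j|)

theorem polyDeriv_substCoord {d : ℕ} (a : Fin (d + 1)) (ψ : MvPolynomial (Fin d) ℝ)
    (q : MvPolynomial (Fin (d + 1)) ℝ) (v u : Fin d → ℝ) :
    polyDeriv (substCoord a ψ q) v u =
      polyDeriv q (graphPt a ψ v) (a.insertNth (α := fun _ => ℝ) (polyDeriv ψ v u) u) := by
  have h1 := (hasFDerivAt_eval (substCoord a ψ q) v)
  have hg : HasFDerivAt (graphPt a ψ) (ContinuousLinearMap.pi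
      (a.insertNth (α := fun _ => (Fin d → ℝ) →L[ℝ] ℝ) (polyDeriv ψ v)
        (fun i => ContinuousLinearMap.proj i))) v := by
    rw [hasFDerivAt_pi']
    intro b
    refine Fin.succAboveCases a ?_ (fun i => ?_) b
    · simpa [ContinuousLinearMap.proj_pi] using hasFDerivAt_eval ψ v
    · simpa [ContinuousLinearMap.proj_pi] using hasFDerivAt_apply (𝕜 := ℝ) i v
  have h2 := (hasFDerivAt_eval q (graphPt a ψ v)).comp v hg
  have h3 : (fun v => MvPolynomial.eval v (substCoord a ψ q)) =
      (fun v => MvPolynomial.eval v q) ∘ graphPt a ψ := by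
    funext v; simp [eval_substCoord]
  rw [h3] at h1
  rw [h1.unique h2]
  simp only [ContinuousLinearMap.comp_apply]
  congr 1
  funext b
  refine Fin.succAboveCases a ?_ (fun i => ?_) b <;> simp

theorem JetField.elim {X : Type*} {d m k l N : ℕ} (hlk : l < k) {B : Set X} {ρ ρ' : X → X → ℝ}
    {z : X → Fin (d + 1) → ℝ} {P : X → Fin m → MvPolynomial (Fin (d + 1)) ℝ} {F : X → Fin m → ℝ}
    {C δ K δ₀ : ℝ} (h : JetField B ρ z P F k C δ) (a : Fin (d + 1)) (i₀ : Fin m)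
    (β : List (Fin (d + 1))) (hβ : β.length = l) (hN : ∀ x ∈ B, ∀ i, (P x i).totalDegree ≤ N)
    (ψ : X → MvPolynomial (Fin d) ℝ)
    (hψ : ∀ x ∈ B, MvPolynomial.eval (a.removeNth (z x)) (ψ x) = z x a)
    (hK : 1 ≤ K) (hδ₀ : 0 < δ₀)
    (hE : ∀ x ∈ B, ElimData k l a (z x) (iterPDeriv β (P x i₀)) (P x) (ψ x) K δ₀)
    (hρ : ∀ x ∈ B, ∀ y ∈ B, ρ x y ≤ ρ' x y)
    (hc : ∀ x ∈ B, ∀ y ∈ B, ∀ r, 0 < r → ρ' x y ≤ r →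
      |MvPolynomial.eval (z x) (iterPDeriv β (P x i₀)) -
        MvPolynomial.eval (z y) (iterPDeriv β (P y i₀))| ≤ r ^ (k - l)) :
    ∃ C' δ', JetField B ρ' (fun x => a.removeNth (z x)) (fun x i => substCoord a (ψ x) (P x i))
      F k C' δ' := by
  wlog hC : 0 ≤ C generalizing C
  · exact this (h.mono_const (le_abs_self C)) (abs_nonneg C)
  obtain ⟨CM, hCM0, hCM⟩ := exists_markov_bound (d + 1) N l
  have h2l : (1 : ℝ) ≤ 2 ^ l := one_le_pow₀ (by norm_num)
  set T : ℝ := 2 ^ l * (3 * K) with hT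
  have hTK : 3 * K ≤ T := by rw [hT]; nlinarith
  have hT0 : 0 < T := by linarith
  have hδ : 0 < min δ₀ (min 1 δ) / T := by
    have := h.pos
    positivity
  refine ⟨C * K ^ k + K * (3 * K) ^ l * (K * (K + 1 + K * 2 ^ (k - l) +
    CM * C * (2 ^ l) ^ k * (3 * K) ^ (k - l))), min δ₀ (min 1 δ) / T, hδ, fun x hx i => ?_,
    fun x hx y hy => ?_, ?_⟩
  · rw [eval_substCoord, graphPt_removeNth _ _ _ (hψ x hx), h.value x hx]
  · exact (norm_removeNth_sub_le _ _ _).trans ((h.near x hx y hy).trans (hρ x hx y hy))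
  · intro x hx y hy r hr hρr hrδ v hv i
    rw [le_div_iff₀ hT0] at hrδ
    have e1 : r * T ≤ δ₀ := hrδ.trans (min_le_left _ _)
    have e2 : r * T ≤ 1 := hrδ.trans ((min_le_right _ _).trans (min_le_left _ _))
    have e3 : r * T ≤ δ := hrδ.trans ((min_le_right _ _).trans (min_le_right _ _))
    have e4 : 3 * K * r ≤ r * T := by nlinarith
    have e5 : r ≤ K * r := by nlinarith
    have e6 : K * r ≤ 3 * K * r := by nlinarith
    have hρ1 : ρ x y ≤ r := (hρ x hx y hy).trans hρr
    refine ElimData.abs_sub_le (C := C) (Cw := CM * C * (2 ^ l) ^ k) hlk.le (hE x hx)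
      (hE y hy) hK hr (e4.trans e1) (e4.trans e2) ((h.near x hx y hy).trans hρ1) ?_ ?_
      (hc x hx y hy r hr hρr) v hv i
    · intro v hv j
      exact h.est x hx y hy (K * r) (by positivity) (hρ1.trans e5) (e6.trans (e4.trans e3)) v hv j
    · intro v hv
      have hR : 0 < 3 * K * r := by positivity
      have := hCM (P x i₀ - P y i₀) ((MvPolynomial.totalDegree_sub _ _).trans
        (max_le (hN x hx i₀) (hN y hy i₀))) (z x) (3 * K * r) (C * (2 ^ l * (3 * K * r)) ^ k) hR
        (fun v hv => by
          rw [map_sub]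
          refine h.est x hx y hy _ (by positivity) ?_ ?_ v hv i₀
          · nlinarith
          · calc _ = r * T := by rw [hT]; ring
              _ ≤ _ := e3) β hβ v hv
      rw [iterPDeriv_sub, map_sub] at this
      refine this.trans (le_of_eq ?_)
      rw [div_eq_iff (by positivity), mul_assoc _ ((3 * K * r) ^ (k - l)), ← pow_add,
        Nat.sub_add_cancel hlk.le]
      ring

theorem IsControlled.of_elim {X : Type*} {d m k : ℕ} {B : Set X} {ρ : X → X → ℝ}
    {z : X → Fin (d + 1) → ℝ} {P : X → Fin m → MvPolynomial (Fin (d + 1)) ℝ} {F : X → Fin m → ℝ}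
    (a : Fin (d + 1)) (ψ : X → MvPolynomial (Fin d) ℝ)
    (hψ : ∀ x ∈ B, MvPolynomial.eval (a.removeNth (z x)) (ψ x) = z x a)
    (h : IsControlled B ρ (fun x => a.removeNth (z x))
      (fun x i => substCoord a (ψ x) (P x i)) F k) :
    IsControlled B ρ z P F k := by
  obtain ⟨I, C, δ, hC, hδ, hs, he⟩ := h
  refine ⟨I, C, δ, hC, hδ, fun x hx y => ?_, he⟩
  obtain ⟨v, hv⟩ := hs x hx y
  refine ⟨a.insertNth (α := fun _ => ℝ) (polyDeriv (ψ x) (a.removeNth (z x)) v) v, fun i hi => ?_⟩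
  rw [← hv i hi, polyDeriv_substCoord, graphPt_removeNth _ _ _ (hψ x hx)]

theorem IsControlled.of_elim_value {X : Type*} {d m k : ℕ} (hk : 1 < k) {B : Set X}
    {ρ : X → X → ℝ} {z : X → Fin (d + 1) → ℝ} {P : X → Fin m → MvPolynomial (Fin (d + 1)) ℝ}
    {F : X → Fin m → ℝ} (a : Fin (d + 1)) (i₀ : Fin m) (ψ : X → MvPolynomial (Fin d) ℝ)
    (hψ : ∀ x ∈ B, MvPolynomial.eval (a.removeNth (z x)) (ψ x) = z x a) {K δ₀ : ℝ} (hδ₀ : 0 < δ₀)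
    (hE : ∀ x ∈ B, ElimData k 0 a (z x) (P x i₀) (P x) (ψ x) K δ₀)
    (ha : ∀ x ∈ B, MvPolynomial.eval (z x) (MvPolynomial.pderiv a (P x i₀)) ≠ 0)
    (h : IsControlled B (fun x y => max (ρ x y) (|F x i₀ - F y i₀| ^ ((1 : ℝ) / k)))
      (fun x => a.removeNth (z x)) (fun x i => substCoord a (ψ x) (P x i)) F k) :
    IsControlled B ρ z P F k := by
  classical
  have hk0 : (k : ℝ) ≠ 0 := by positivity
  obtain ⟨I, C, δ, hC, hδ, hs, he⟩ := h
  refine ⟨insert i₀ I, 2 * C, min δ (δ ^ k), by positivity, by positivity, fun x hx y => ?_, ?_⟩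
  · set g := MvPolynomial.eval (z x) (MvPolynomial.pderiv a (P x i₀)) with hg
    have hg0 : g ≠ 0 := ha x hx
    have hea : ∀ i, polyDeriv (P x i) (z x) (Pi.single a 1) =
        MvPolynomial.eval (z x) (MvPolynomial.pderiv a (P x i)) := by
      intro i
      rw [polyDeriv_apply, Finset.sum_eq_single a] <;> simp +contextual
    obtain ⟨v, hv⟩ := hs x hx (fun i => y i - y i₀ *
      MvPolynomial.eval (z x) (MvPolynomial.pderiv a (P x i)) / g)
    have hz : polyDeriv (substCoord a (ψ x) (P x i₀)) (a.removeNth (z x)) = 0 := by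
      refine (hasFDerivAt_eval _ _).unique ?_
      have hO : (fun v => MvPolynomial.eval v (substCoord a (ψ x) (P x i₀)) -
          MvPolynomial.eval (z x) (P x i₀)) =O[nhds (a.removeNth (z x))]
          fun v => ‖v - a.removeNth (z x)‖ ^ k := by
        refine Asymptotics.IsBigO.of_bound K ?_
        filter_upwards [Metric.closedBall_mem_nhds (a.removeNth (z x)) hδ₀] with v hv
        rw [mem_closedBall, dist_eq_norm] at hv
        have := (hE x hx).err v hv
        rw [eval_substCoord]
        simpa using this
      have := hO.hasFDerivAt (𝕜 := ℝ) hk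
      simpa using this.add_const (MvPolynomial.eval (z x) (P x i₀))
    have hins : ∀ i, polyDeriv (P x i) (z x)
        (a.insertNth (α := fun _ => ℝ) (polyDeriv (ψ x) (a.removeNth (z x)) v) v) =
        polyDeriv (substCoord a (ψ x) (P x i)) (a.removeNth (z x)) v := by
      intro i
      rw [polyDeriv_substCoord, graphPt_removeNth _ _ _ (hψ x hx)]
    refine ⟨a.insertNth (α := fun _ => ℝ) (polyDeriv (ψ x) (a.removeNth (z x)) v) v +
      (y i₀ / g) • Pi.single a 1, fun i hi => ?_⟩
    rw [map_add, map_smul, hea, hins, smul_eq_mul]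
    by_cases hii : i = i₀
    · subst hii
      rw [hz, ← hg]
      simp [hg0]
    · rw [hv i ((Finset.mem_insert.1 hi).resolve_left hii)]
      field_simp
      ring
  · intro x hx y hy hρ0 hρ hF i
    have hpos : 0 ≤ |F x i₀ - F y i₀| := abs_nonneg _
    have hpk : (|F x i₀ - F y i₀| ^ ((1 : ℝ) / k)) ^ k = |F x i₀ - F y i₀| := by
      rw [← Real.rpow_natCast, ← Real.rpow_mul hpos, one_div_mul_cancel hk0, Real.rpow_one]
    have h1 : |F x i₀ - F y i₀| ^ ((1 : ℝ) / k) ≤ δ := by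
      refine le_of_pow_le_pow_left₀ (n := k) (by omega) hδ.le ?_
      rw [hpk]
      exact (hF i₀).trans (min_le_right _ _)
    have := he x hx y hy (lt_max_of_lt_left hρ0) (max_le (hρ.trans (min_le_left _ _)) h1)
      (fun i => (hF i).trans (min_le_left _ _)) i
    have h2 : max (ρ x y) (|F x i₀ - F y i₀| ^ ((1 : ℝ) / k)) ^ k ≤
        ρ x y ^ k + |F x i₀ - F y i₀| := by
      rcases max_choice (ρ x y) (|F x i₀ - F y i₀| ^ ((1 : ℝ) / k)) with hm | hm <;> rw [hm]
      · linarith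
      · rw [hpk]; have : 0 ≤ ρ x y ^ k := by positivity
        linarith
    have h3 : |F x i₀ - F y i₀| ≤ ∑ j ∈ insert i₀ I, |F x j - F y j| :=
      Finset.single_le_sum (f := fun j => |F x j - F y j|) (fun _ _ => abs_nonneg _)
        (Finset.mem_insert_self _ _)
    have h4 : ∑ j ∈ I, |F x j - F y j| ≤ ∑ j ∈ insert i₀ I, |F x j - F y j| :=
      Finset.sum_le_sum_of_subset_of_nonneg (Finset.subset_insert _ _) (fun _ _ _ => abs_nonneg _)
    have h5 : 0 ≤ ρ x y ^ k := by positivity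
    calc _ ≤ _ := this
      _ ≤ C * (2 * (ρ x y ^ k + ∑ j ∈ insert i₀ I, |F x j - F y j|)) := by
          gcongr
          linarith
      _ = _ := by ring

theorem JetField.isControlled_of_flat {X : Type*} {d m k : ℕ} (hk : 1 ≤ k) {B : Set X}
    {ρ : X → X → ℝ} {z : X → Fin d → ℝ} {P : X → Fin m → MvPolynomial (Fin d) ℝ}
    {F : X → Fin m → ℝ} {C δ : ℝ} (h : JetField B ρ z P F k C δ) {K : ℝ} (hK0 : 0 ≤ K)
    (hK : ∀ x ∈ B, ∀ R, 0 ≤ R → R ≤ 1 → ∀ u u', ‖u - z x‖ ≤ R → ‖u' - z x‖ ≤ R → ∀ i,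
      |MvPolynomial.eval u (P x i) - MvPolynomial.eval u' (P x i)| ≤ K * R ^ (k - 1) * ‖u - u'‖) :
    IsControlled B ρ z P F k := by
  refine ⟨∅, K + |C|, min δ 1, by positivity, lt_min h.pos one_pos, by simp, ?_⟩
  intro x hx y hy h0 hρ _ i
  have hn := h.near x hx y hy
  have hn' : ‖z y - z x‖ ≤ ρ x y := by rwa [norm_sub_rev]
  have h1 := hK x hx (ρ x y) h0.le (hρ.trans (min_le_right _ _)) (z x) (z y) (by simpa using h0.le)
    hn' i
  have h2 := h.est x hx y hy (ρ x y) h0 le_rfl (hρ.trans (min_le_left _ _)) (z y) hn' i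
  rw [h.value x hx] at h1
  rw [h.value y hy] at h2
  have h3 : K * ρ x y ^ (k - 1) * ‖z x - z y‖ ≤ K * ρ x y ^ k := by
    calc _ ≤ K * ρ x y ^ (k - 1) * ρ x y := by gcongr
      _ = K * (ρ x y ^ (k - 1) * ρ x y) := by ring
      _ = _ := by rw [← pow_succ, Nat.sub_add_cancel hk]
  have h4 : C * ρ x y ^ k ≤ |C| * ρ x y ^ k := by gcongr; exact le_abs_self C
  calc _ ≤ _ := abs_sub_le _ (MvPolynomial.eval (z y) (P x i)) _
    _ ≤ K * ρ x y ^ k + |C| * ρ x y ^ k := by linarith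
    _ = _ := by simp; ring

theorem exists_minimal_iterPDeriv_ne_zero {d m L : ℕ} (z : Fin d → ℝ)
    (P : Fin m → MvPolynomial (Fin d) ℝ)
    (h : ¬ ∀ i, ∀ γ : List (Fin d), 1 ≤ γ.length → γ.length ≤ L →
      MvPolynomial.eval z (iterPDeriv γ (P i)) = 0) :
    ∃ i a, ∃ β : List (Fin d), β.length < L ∧
      MvPolynomial.eval z (MvPolynomial.pderiv a (iterPDeriv β (P i))) ≠ 0 ∧
      ∀ i, ∀ γ : List (Fin d), 1 ≤ γ.length → γ.length ≤ β.length →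
        MvPolynomial.eval z (iterPDeriv γ (P i)) = 0 := by
  classical
  have hex : ∃ l, ∃ i, ∃ γ : List (Fin d), 1 ≤ γ.length ∧ γ.length ≤ L ∧ γ.length = l ∧
      MvPolynomial.eval z (iterPDeriv γ (P i)) ≠ 0 := by
    push Not at h
    obtain ⟨i, γ, h1, h2, h3⟩ := h
    exact ⟨_, i, γ, h1, h2, rfl, h3⟩
  obtain ⟨i, γ, h1, h2, h3, h4⟩ := Nat.find_spec hex
  match γ, h1, h2, h3, h4 with
  | a :: β, h1, h2, h3, h4 =>
    rw [List.length_cons] at h2 h3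
    refine ⟨i, a, β, by omega, h4, fun j γ hγ1 hγ2 => ?_⟩
    by_contra hne
    exact Nat.find_min hex (m := γ.length) (by omega) ⟨j, γ, hγ1, by omega, rfl, hne⟩

/-- Localisation reduces the nullity of a set carrying a jet field to controlled subsets, by
successive elimination of coordinates. -/
theorem measure_null_of_isControlled {X : Type*} (ν : OuterMeasure X) {m k : ℕ} (hk : 1 ≤ k)
    (F : X → Fin m → ℝ) : ∀ (d : ℕ) (A : Set X) (ρ : X → X → ℝ) (z : X → Fin d → ℝ)
      (P : X → Fin m → MvPolynomial (Fin d) ℝ) (C δ : ℝ), JetField A ρ z P F k C δ →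
      (∀ B ⊆ A, IsControlled B ρ z P F k → ν B = 0) → ν A = 0 := by
  intro d
  induction d with
  | zero =>
    intro A ρ z P C δ h hB
    refine hB A subset_rfl (h.isControlled_of_flat hk le_rfl ?_)
    intro x _ R _ _ u u' _ _ i
    rw [Subsingleton.elim u u']
    simp
  | succ d ih =>
    intro A ρ z P C δ h hB
    set flat : X → Prop := fun x => ∀ i, ∀ γ : List (Fin (d + 1)), 1 ≤ γ.length →
      γ.length ≤ k - 1 → MvPolynomial.eval (z x) (iterPDeriv γ (P x i)) = 0 with hflat
    have key : ν {x ∈ A | flat x} = 0 ∧ ν {x ∈ A | ¬ flat x} = 0 := by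
      constructor
      · refine measure_null_of_forall_exists (ι := ℕ) ν (fun x N => ∀ R : ℝ, 0 ≤ R → R ≤ 1 →
          ∀ u u', ‖u - z x‖ ≤ R → ‖u' - z x‖ ≤ R → ∀ i,
          |MvPolynomial.eval u (P x i) - MvPolynomial.eval u' (P x i)| ≤
            (N : ℝ) * R ^ (k - 1) * ‖u - u'‖) ?_ ?_
        · rintro x ⟨hxA, hx⟩
          choose K hK0 hK using fun i => exists_flat_bound (k - 1) (P x i) (z x) (hx i)
          obtain ⟨N, hN⟩ := exists_nat_ge (∑ i, K i)
          refine ⟨N, fun R h0 h1 u u' hu hu' i => (hK i R h0 h1 u u' hu hu').trans ?_⟩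
          have := (Finset.single_le_sum (fun i _ => hK0 i) (Finset.mem_univ i)).trans hN
          gcongr
        · intro N
          have hsub : {x ∈ {x ∈ A | flat x} | ∀ R : ℝ, 0 ≤ R → R ≤ 1 →
              ∀ u u', ‖u - z x‖ ≤ R → ‖u' - z x‖ ≤ R → ∀ i,
              |MvPolynomial.eval u (P x i) - MvPolynomial.eval u' (P x i)| ≤
              (N : ℝ) * R ^ (k - 1) * ‖u - u'‖} ⊆ A := fun x hx => hx.1.1
          exact hB _ hsub ((h.subset hsub).isControlled_of_flat hk (Nat.cast_nonneg N)
            fun x hx => hx.2)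
      · refine measure_null_of_forall_exists
          (ι := Fin m × Fin (d + 1) × List (Fin (d + 1)) × ℕ) ν
          (fun x c => c.2.2.1.length < k - 1 ∧ MvPolynomial.eval (z x)
            (MvPolynomial.pderiv c.2.1 (iterPDeriv c.2.2.1 (P x c.1))) ≠ 0 ∧
            (1 ≤ c.2.2.1.length → MvPolynomial.eval (z x) (iterPDeriv c.2.2.1 (P x c.1)) = 0) ∧
            (∀ i, (P x i).totalDegree ≤ c.2.2.2) ∧
            ∃ ψ, MvPolynomial.eval (c.2.1.removeNth (z x)) ψ = z x c.2.1 ∧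
              ElimData k c.2.2.1.length c.2.1 (z x) (iterPDeriv c.2.2.1 (P x c.1)) (P x) ψ
                (c.2.2.2 + 1) (1 / (c.2.2.2 + 1))) ?_ ?_
        · rintro x ⟨hxA, hx⟩
          obtain ⟨i, a, β, h1, h2, h3⟩ := exists_minimal_iterPDeriv_ne_zero (z x) (P x) hx
          obtain ⟨ψ, hψ, K, η, hK, hη, hE⟩ := exists_elimData (k := k) (l := β.length) (by omega)
            a (z x) (iterPDeriv β (P x i)) (P x) h2 h3
          obtain ⟨N₁, hN₁⟩ := exists_nat_ge K
          obtain ⟨N₂, hN₂⟩ := exists_nat_one_div_lt hη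
          set N := N₁ + N₂ + ∑ i, (P x i).totalDegree
          have hN1 : N₁ ≤ N := by omega
          have hN2 : N₂ ≤ N := by omega
          refine ⟨(i, a, β, N), h1, h2, fun hl => h3 i β hl le_rfl, fun j => ?_, ψ, hψ, ?_⟩
          · have := Finset.single_le_sum (f := fun i => (P x i).totalDegree)
              (fun i _ => Nat.zero_le _) (Finset.mem_univ j)
            simp only at this ⊢
            omega
          · refine hE.mono ?_ ?_
            · have : (N₁ : ℝ) ≤ N := by exact_mod_cast hN1
              simp only
              linarith
            · refine le_trans ?_ hN₂.le
              have : (N₂ : ℝ) ≤ N := by exact_mod_cast hN2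
              simp only
              gcongr
        · rintro ⟨i₀, a, β, N⟩
          set B : Set X := _
          change ν B = 0
          have hBA : B ⊆ A := fun x hx => hx.1.1
          have hB0 : ∀ x ∈ B, β.length < k - 1 := fun x hx => hx.2.1
          have hB1 : ∀ x ∈ B, MvPolynomial.eval (z x)
              (MvPolynomial.pderiv a (iterPDeriv β (P x i₀))) ≠ 0 := fun x hx => hx.2.2.1
          have hB2 : ∀ x ∈ B, 1 ≤ β.length →
            MvPolynomial.eval (z x) (iterPDeriv β (P x i₀)) = 0 := fun x hx => hx.2.2.2.1
          have hB3 : ∀ x ∈ B, ∀ i, (P x i).totalDegree ≤ N := fun x hx => hx.2.2.2.2.1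
          have hB4 : ∀ x ∈ B, ∃ ψ, MvPolynomial.eval (a.removeNth (z x)) ψ = z x a ∧
              ElimData k β.length a (z x) (iterPDeriv β (P x i₀)) (P x) ψ
                (N + 1) (1 / (N + 1)) := fun x hx => hx.2.2.2.2.2
          have hψe : ∀ x, ∃ ψ, x ∈ B → MvPolynomial.eval (a.removeNth (z x)) ψ = z x a ∧
              ElimData k β.length a (z x) (iterPDeriv β (P x i₀)) (P x) ψ
                (N + 1) (1 / (N + 1)) := by
            intro x
            by_cases hx : x ∈ B
            · obtain ⟨ψ, hψ⟩ := hB4 x hx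
              exact ⟨ψ, fun _ => hψ⟩
            · exact ⟨0, fun hx' => absurd hx' hx⟩
          choose ψ hψ using hψe
          clear_value B
          rcases B.eq_empty_or_nonempty with hBe | ⟨x₀, hx₀⟩
          · rw [hBe]; exact measure_empty
          have hl := hB0 x₀ hx₀
          have hF := h.subset hBA
          have hη : (0 : ℝ) < 1 / (N + 1) := by positivity
          have hK1 : (1 : ℝ) ≤ N + 1 := by simp
          rcases Nat.eq_zero_or_pos β.length with hl0 | hl0
          · obtain rfl : β = [] := List.eq_nil_of_length_eq_zero hl0
            obtain ⟨C', δ', hJ⟩ := hF.elim (l := 0) (by omega)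
              (ρ' := fun x y => max (ρ x y) (|F x i₀ - F y i₀| ^ ((1 : ℝ) / k))) a i₀ [] rfl hB3 ψ
              (fun x hx => (hψ x hx).1) hK1 hη (fun x hx => (hψ x hx).2)
              (fun x hx y hy => le_max_left _ _) (by
                intro x hx y hy r hr hρ
                have hk0 : (k : ℝ) ≠ 0 := by positivity
                change |MvPolynomial.eval (z x) (P x i₀) - MvPolynomial.eval (z y) (P y i₀)| ≤ _
                rw [hF.value x hx, hF.value y hy, Nat.sub_zero]
                have h1 := (le_max_right _ _).trans hρ
                calc |F x i₀ - F y i₀| = (|F x i₀ - F y i₀| ^ ((1 : ℝ) / k)) ^ k := by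
                      rw [← Real.rpow_natCast, ← Real.rpow_mul (abs_nonneg _),
                        one_div_mul_cancel hk0, Real.rpow_one]
                  _ ≤ r ^ k := by gcongr)
            refine ih B _ _ _ C' δ' hJ fun B' hB' hc => hB B' (hB'.trans hBA) ?_
            exact hc.of_elim_value (by omega) a i₀ ψ (fun x hx => (hψ x (hB' hx)).1) hη
              (fun x hx => (hψ x (hB' hx)).2) (fun x hx => hB1 x (hB' hx))
          · obtain ⟨C', δ', hJ⟩ := hF.elim (l := β.length) (by omega)
              (ρ' := ρ) a i₀ β rfl hB3 ψ
              (fun x hx => (hψ x hx).1) hK1 hη (fun x hx => (hψ x hx).2)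
              (fun x hx y hy => le_rfl) (by
                intro x hx y hy r hr hρ
                rw [hB2 x hx hl0, hB2 y hy hl0, sub_self, abs_zero]
                positivity)
            refine ih B _ _ _ C' δ' hJ fun B' hB' hc => hB B' (hB'.trans hBA) ?_
            exact hc.of_elim a ψ (fun x hx => (hψ x (hB' hx)).1)
    refine measure_mono_null (t := {x ∈ A | flat x} ∪ {x ∈ A | ¬ flat x}) (fun x hx => ?_)
      (measure_union_null key.1 key.2)
    by_cases hf : flat x
    · exact Or.inl ⟨hx, hf⟩
    · exact Or.inr ⟨hx, hf⟩

open Pointwise in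
theorem volume_preimage_affine_le {n : ℕ} {x v : Ec n} {R s : ℝ} (hs : 0 < s) (hR : 0 < R)
    {W : Set (Ec n)} {η : ENNReal} (hW : volume (W ∩ ball x R) ≤ η * volume (ball x R))
    (hv : ∀ u ∈ ball (0 : Ec n) 1, v + s • u ∈ ball x R) :
    volume {u ∈ ball (0 : Ec n) 1 | v + s • u ∈ W} ≤
      ENNReal.ofReal ((R / s) ^ n) * η * volume (ball (0 : Ec n) 1) := by
  set S := {u ∈ ball (0 : Ec n) 1 | v + s • u ∈ W} with hS
  have h1 : (fun w => -v + w) ⁻¹' (s • S) ⊆ W ∩ ball x R := by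
    rintro w ⟨u, hu, hw⟩
    simp only at hw
    have : w = v + s • u := by rw [hw]; abel
    rw [this]
    exact ⟨hu.2, hv u hu.1⟩
  have h2 : volume (s • S) ≤ η * volume (ball x R) := by
    rw [← measure_preimage_add volume (-v) (s • S)]
    exact (measure_mono h1).trans hW
  rw [Measure.addHaar_smul_of_nonneg volume hs.le, Measure.addHaar_ball_of_pos volume x hR,
    finrank_euclideanSpace_fin] at h2
  have h3 : ENNReal.ofReal ((s⁻¹) ^ n) * ENNReal.ofReal (s ^ n) = 1 := by
    rw [← ENNReal.ofReal_mul (by positivity), ← mul_pow, inv_mul_cancel₀ hs.ne', one_pow,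
      ENNReal.ofReal_one]
  calc volume S = ENNReal.ofReal ((s⁻¹) ^ n) * (ENNReal.ofReal (s ^ n) * volume S) := by
        rw [← mul_assoc, h3, one_mul]
    _ ≤ ENNReal.ofReal ((s⁻¹) ^ n) *
        (η * (ENNReal.ofReal (R ^ n) * volume (ball (0 : Ec n) 1))) := by gcongr
    _ = (ENNReal.ofReal ((s⁻¹) ^ n) * ENNReal.ofReal (R ^ n)) * η * volume (ball (0 : Ec n) 1) := by
        ring
    _ = _ := by
        rw [← ENNReal.ofReal_mul (by positivity), ← mul_pow, inv_mul_eq_div]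

theorem exists_good_direction (n N : ℕ) : ∃ η : ENNReal, 0 < η ∧ ∀ (x y v : Ec n) (R : ℝ)
    (W₁ W₂ : Set (Ec n)), 0 < R → dist v x ≤ R → dist x y ≤ R →
    volume (W₁ ∩ ball x (3 * R)) ≤ η * volume (ball x (3 * R)) →
    volume (W₂ ∩ ball y (3 * R)) ≤ η * volume (ball y (3 * R)) →
    ∃ u : Ec n, ∀ j ∈ Finset.range (N + 1),
      v + (((j : ℝ) + 1) / (N + 1) * R) • u ∈ (W₁ᶜ ∩ ball x (3 * R)) ∩ (W₂ᶜ ∩ ball y (3 * R)) := by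
  set c : ℝ := (3 * ((N : ℝ) + 1)) ^ n with hc
  have hc0 : 0 < c := by positivity
  refine ⟨ENNReal.ofReal (1 / (4 * ((N : ℝ) + 1) * c)), by
    rw [ENNReal.ofReal_pos]; positivity, fun x y v R W₁ W₂ hR hvx hxy h1 h2 => ?_⟩
  set η := ENNReal.ofReal (1 / (4 * ((N : ℝ) + 1) * c)) with hη
  have ht : ∀ j ∈ Finset.range (N + 1), 1 / ((N : ℝ) + 1) ≤ ((j : ℝ) + 1) / (N + 1) ∧
      ((j : ℝ) + 1) / (N + 1) ≤ 1 := by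
    intro j hj
    rw [Finset.mem_range] at hj
    have : (j : ℝ) + 1 ≤ N + 1 := by exact_mod_cast hj
    constructor
    · gcongr; simp
    · rw [div_le_one (by positivity)]; exact this
  have hin : ∀ j ∈ Finset.range (N + 1), ∀ u ∈ ball (0 : Ec n) 1,
      v + (((j : ℝ) + 1) / (N + 1) * R) • u ∈ ball x (3 * R) ∩ ball y (3 * R) := by
    intro j hj u hu
    rw [mem_ball_zero_iff] at hu
    obtain ⟨ht1, ht2⟩ := ht j hj
    have hpos : (0 : ℝ) ≤ ((j : ℝ) + 1) / (N + 1) * R := by positivity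
    have hd : dist (v + (((j : ℝ) + 1) / (N + 1) * R) • u) v < R := by
      rw [dist_eq_norm, add_sub_cancel_left, norm_smul, Real.norm_of_nonneg hpos]
      have : ((j : ℝ) + 1) / (N + 1) * R ≤ R := by nlinarith
      nlinarith [norm_nonneg u]
    constructor
    · rw [mem_ball]
      linarith [dist_triangle (v + (((j : ℝ) + 1) / (N + 1) * R) • u) v x]
    · rw [mem_ball]
      linarith [dist_triangle (v + (((j : ℝ) + 1) / (N + 1) * R) • u) v y, dist_triangle v x y]
  have hbad : ∀ (w : Ec n) (W : Set (Ec n)), (volume (W ∩ ball w (3 * R)) ≤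
      η * volume (ball w (3 * R))) → ∀ j ∈ Finset.range (N + 1),
      (∀ u ∈ ball (0 : Ec n) 1, v + (((j : ℝ) + 1) / (N + 1) * R) • u ∈ ball w (3 * R)) →
      volume {u ∈ ball (0 : Ec n) 1 | v + (((j : ℝ) + 1) / (N + 1) * R) • u ∈ W} ≤
        ENNReal.ofReal (1 / (4 * ((N : ℝ) + 1))) * volume (ball (0 : Ec n) 1) := by
    intro w W hW j hj hw
    refine (volume_preimage_affine_le (by positivity) (by positivity) hW hw).trans ?_
    gcongr
    rw [hη, ← ENNReal.ofReal_mul (by positivity)]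
    refine ENNReal.ofReal_le_ofReal ?_
    have : 3 * R / (((j : ℝ) + 1) / (N + 1) * R) ≤ 3 * ((N : ℝ) + 1) := by
      rw [div_le_iff₀ (by positivity)]
      have h1 := (ht j hj).1
      rw [div_le_iff₀ (by positivity)] at h1
      nlinarith
    calc _ ≤ (3 * ((N : ℝ) + 1)) ^ n * (1 / (4 * (↑N + 1) * c)) := by gcongr
      _ = _ := by rw [← hc]; field_simp
  by_contra! hcon
  have hcov : ball (0 : Ec n) 1 ⊆ ⋃ j ∈ Finset.range (N + 1),
      ({u ∈ ball (0 : Ec n) 1 | v + (((j : ℝ) + 1) / (N + 1) * R) • u ∈ W₁} ∪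
      {u ∈ ball (0 : Ec n) 1 | v + (((j : ℝ) + 1) / (N + 1) * R) • u ∈ W₂}) := by
    intro u hu
    obtain ⟨j, hj, hju⟩ := hcon u
    simp only [mem_iUnion]
    refine ⟨j, hj, ?_⟩
    have := hin j hj u hu
    by_cases hW : v + (((j : ℝ) + 1) / (N + 1) * R) • u ∈ W₁
    · exact Or.inl ⟨hu, hW⟩
    · refine Or.inr ⟨hu, ?_⟩
      by_contra hW2
      exact hju ⟨⟨hW, this.1⟩, ⟨hW2, this.2⟩⟩
  have hle : volume (ball (0 : Ec n) 1) ≤ ∑ j ∈ Finset.range (N + 1),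
      (ENNReal.ofReal (1 / (4 * ((N : ℝ) + 1))) * volume (ball (0 : Ec n) 1) +
      ENNReal.ofReal (1 / (4 * ((N : ℝ) + 1))) * volume (ball (0 : Ec n) 1)) := by
    refine (measure_mono hcov).trans ((measure_biUnion_finset_le _ _).trans
      (Finset.sum_le_sum fun j hj => (measure_union_le _ _).trans ?_))
    exact add_le_add (hbad x W₁ h1 j hj fun u hu => (hin j hj u hu).1)
      (hbad y W₂ h2 j hj fun u hu => (hin j hj u hu).2)
  have hpos : 0 < volume (ball (0 : Ec n) 1) := measure_ball_pos _ _ one_pos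
  have hfin : volume (ball (0 : Ec n) 1) ≠ ⊤ := measure_ball_lt_top.ne
  rw [← add_mul, ← ENNReal.ofReal_add (by positivity) (by positivity), Finset.sum_const,
    Finset.card_range, nsmul_eq_mul, ← mul_assoc, ← ENNReal.ofReal_natCast,
    ← ENNReal.ofReal_mul (by positivity)] at hle
  have : ((N + 1 : ℕ) : ℝ) * (1 / (4 * ((N : ℝ) + 1)) + 1 / (4 * ((N : ℝ) + 1))) = 1 / 2 := by
    push_cast
    field_simp
    norm_num
  rw [this] at hle
  have hlt : ENNReal.ofReal (1 / 2) * volume (ball (0 : Ec n) 1) <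
      1 * volume (ball (0 : Ec n) 1) := by
    refine ENNReal.mul_lt_mul_left hpos.ne' hfin ?_
    rw [ENNReal.ofReal_lt_one]
    norm_num
  rw [one_mul] at hlt
  exact absurd hle (not_le.2 hlt)

/-- The components of the approximate Taylor polynomial, as polynomials in the coordinates. -/
def taylorMv {n m : ℕ} (f : Ec n → Ec m)
    (p : Ec n → FormalMultilinearSeries ℝ (Ec n) (Ec m)) (l : ℕ) (x : Ec n) (i : Fin m) :
    MvPolynomial (Fin n) ℝ :=
  MvPolynomial.C (f x i) + ∑ j ∈ Finset.Icc 1 l, ∑ r : Fin j → Fin n,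
    MvPolynomial.C (p x j (fun a => EuclideanSpace.single (r a) 1) i) *
      ∏ a, (MvPolynomial.X (r a) - MvPolynomial.C (x (r a)))

theorem multilinear_diag_apply {n m j : ℕ} (q : (Ec n) [×j]→L[ℝ] (Ec m)) (v : Ec n) (i : Fin m) :
    q (fun _ => v) i = ∑ r : Fin j → Fin n,
      q (fun a => EuclideanSpace.single (r a) 1) i * ∏ a, v (r a) := by
  classical
  have hv : v = ∑ b, v b • EuclideanSpace.single b (1 : ℝ) := by
    ext c
    simp [Finset.sum_apply, Pi.single_apply]
  conv_lhs => rw [hv]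
  rw [ContinuousMultilinearMap.map_sum]
  simp only [ContinuousMultilinearMap.map_smul_univ, WithLp.ofLp_sum, WithLp.ofLp_smul,
    Finset.sum_apply, Pi.smul_apply, smul_eq_mul]
  exact Finset.sum_congr rfl fun r _ => mul_comm _ _

theorem eval_taylorMv {n m : ℕ} (f : Ec n → Ec m)
    (p : Ec n → FormalMultilinearSeries ℝ (Ec n) (Ec m)) (l : ℕ) (x y : Ec n) (i : Fin m) :
    MvPolynomial.eval y.ofLp (taylorMv f p l x i) = taylorPoly f p l x y i := by
  simp only [taylorMv, taylorPoly, map_add, map_sum, map_mul, map_prod, map_sub,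
    MvPolynomial.eval_C, MvPolynomial.eval_X, WithLp.ofLp_add, WithLp.ofLp_sum, Pi.add_apply,
    Finset.sum_apply]
  congr 1
  refine Finset.sum_congr rfl fun j _ => ?_
  rw [multilinear_diag_apply]
  rfl

theorem taylorPoly_self {n m : ℕ} (f : Ec n → Ec m)
    (p : Ec n → FormalMultilinearSeries ℝ (Ec n) (Ec m)) (l : ℕ) (x : Ec n) :
    taylorPoly f p l x x = f x := by
  rw [taylorPoly, Finset.sum_eq_zero, add_zero]
  intro j hj
  have : NeZero j := ⟨by have := (Finset.mem_Icc.1 hj).1; omega⟩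
  exact (p x j).map_coord_zero (0 : Fin j) (sub_self x)

theorem polyDeriv_taylorMv {n m : ℕ} (f : Ec n → Ec m)
    (p : Ec n → FormalMultilinearSeries ℝ (Ec n) (Ec m)) {l : ℕ} (hl : 1 ≤ l) (x v : Ec n)
    (i : Fin m) : polyDeriv (taylorMv f p l x i) x.ofLp v.ofLp = p x 1 (fun _ => v) i := by
  have h1 := hasDerivAt_line (taylorMv f p l x i) x.ofLp v.ofLp 0
  have h2 : (fun t : ℝ => MvPolynomial.eval (x.ofLp + t • v.ofLp) (taylorMv f p l x i)) =
      fun t => f x i + ∑ j ∈ Finset.Icc 1 l, t ^ j * p x j (fun _ => v) i := by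
    funext t
    rw [← WithLp.ofLp_smul, ← WithLp.ofLp_add, eval_taylorMv, taylorPoly]
    simp only [add_sub_cancel_left, WithLp.ofLp_add, WithLp.ofLp_sum, Pi.add_apply,
      Finset.sum_apply]
    congr 1
    refine Finset.sum_congr rfl fun j _ => ?_
    have := (p x j).map_smul_univ (fun _ => t) (fun _ => v)
    simp only [Finset.prod_const, Finset.card_univ, Fintype.card_fin] at this
    rw [this]
    simp
  rw [h2, zero_smul, add_zero] at h1
  refine h1.unique ?_
  have h3 : HasDerivAt (fun t : ℝ => f x i + ∑ j ∈ Finset.Icc 1 l, t ^ j * p x j (fun _ => v) i)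
      (∑ j ∈ Finset.Icc 1 l, (j * (0 : ℝ) ^ (j - 1)) * p x j (fun _ => v) i) 0 :=
    HasDerivAt.const_add _ (HasDerivAt.fun_sum fun j _ => (hasDerivAt_pow j 0).mul_const _)
  refine h3.congr_deriv ?_
  rw [Finset.sum_eq_single 1]
  · simp
  · intro j hj hj1
    have : j - 1 ≠ 0 := by have := (Finset.mem_Icc.1 hj).1; omega
    simp [this]
  · intro h
    exact absurd (Finset.mem_Icc.2 ⟨le_rfl, hl⟩) h

theorem exists_nat_of_apSmall {n : ℕ} {x : Ec n} {g : Ec n → ℝ} {k : ℕ} {η : ENNReal} (hη : 0 < η)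
    (h : ∃ lam : ℝ, apSmall x {y | y ≠ x ∧ lam * ‖y - x‖ ^ k ≤ g y}) :
    ∃ N : ℕ, ∀ r : ℝ, 0 < r → r < 1 / (N + 1) →
      volume ({y | y ≠ x ∧ (N : ℝ) * ‖y - x‖ ^ k ≤ g y} ∩ ball x r) ≤ η * volume (ball x r) := by
  obtain ⟨lam, h⟩ := h
  have h1 := h.eventually (gt_mem_nhds hη)
  rw [eventually_nhdsWithin_iff, Metric.eventually_nhds_iff] at h1
  obtain ⟨δ, hδ, h1⟩ := h1
  obtain ⟨N₁, hN₁⟩ := exists_nat_ge lam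
  obtain ⟨N₂, hN₂⟩ := exists_nat_one_div_lt hδ
  refine ⟨max N₁ N₂, fun r hr0 hr => ?_⟩
  have hN : (1 : ℝ) / ((max N₁ N₂ : ℕ) + 1) ≤ 1 / (N₂ + 1) := by
    have : (N₂ : ℝ) ≤ (max N₁ N₂ : ℕ) := by exact_mod_cast le_max_right _ _
    gcongr
  have h2 := h1 (y := r) (by
    rw [Real.dist_0_eq_abs, abs_of_pos hr0]; linarith) hr0
  have hb0 : volume (ball x r) ≠ 0 := (measure_ball_pos _ _ hr0).ne'
  have hbt : volume (ball x r) ≠ ⊤ := measure_ball_lt_top.ne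
  have h3 := (ENNReal.div_le_iff hb0 hbt).1 h2.le
  refine (measure_mono (inter_subset_inter_left _ ?_)).trans h3
  rintro y ⟨hy, hy2⟩
  refine ⟨hy, le_trans ?_ hy2⟩
  have : (N₁ : ℝ) ≤ (max N₁ N₂ : ℕ) := by exact_mod_cast le_max_left _ _
  have := hN₁.trans this
  gcongr

/-- Approximate Taylor expansions give, after countable localisation, jet fields. -/
theorem measure_null_of_jetField {n m k : ℕ} (f : Ec n → Ec m)
    (p : Ec n → FormalMultilinearSeries ℝ (Ec n) (Ec m)) (ν : OuterMeasure (Ec n)) (A : Set (Ec n))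
    (hA : ∀ x ∈ A, ∃ lam : ℝ,
      apSmall x {y | y ≠ x ∧ lam * ‖y - x‖ ^ k ≤ ‖f y - taylorPoly f p (k - 1) x y‖})
    (h : ∀ B ⊆ A, ∀ C δ, JetField B dist (fun x => x.ofLp) (taylorMv f p (k - 1))
      (fun x => (f x).ofLp) k C δ → ν B = 0) : ν A = 0 := by
  refine measure_null_of_forall_exists ν
    (fun x (D : ℕ) => ∀ i, (taylorMv f p (k - 1) x i).totalDegree ≤ D) (fun x _ => ?_) fun D => ?_
  · exact ⟨∑ i, (taylorMv f p (k - 1) x i).totalDegree, fun i =>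
      Finset.single_le_sum (f := fun i => (taylorMv f p (k - 1) x i).totalDegree)
        (fun i _ => Nat.zero_le _) (Finset.mem_univ i)⟩
  obtain ⟨η, hη, hdir⟩ := exists_good_direction n D
  obtain ⟨CL, hCL0, hCL⟩ := exists_lagrange_bound D
  refine measure_null_of_forall_exists ν (fun x (N : ℕ) => ∀ r : ℝ, 0 < r → r < 1 / (N + 1) →
      volume ({y | y ≠ x ∧ (N : ℝ) * ‖y - x‖ ^ k ≤ ‖f y - taylorPoly f p (k - 1) x y‖} ∩ ball x r) ≤
        η * volume (ball x r)) (fun x hx => exists_nat_of_apSmall hη (hA x hx.1)) fun N => ?_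
  set c : ℝ := ‖((EuclideanSpace.equiv (Fin n) ℝ).symm : (Fin n → ℝ) →L[ℝ] Ec n)‖ + 1 with hc
  have hc1 : 1 ≤ c := le_add_of_nonneg_left (norm_nonneg _)
  have hcb : ∀ v : Fin n → ℝ, ‖(WithLp.toLp 2 v : Ec n)‖ ≤ c * ‖v‖ := by
    intro v
    have := ContinuousLinearMap.le_opNorm
      ((EuclideanSpace.equiv (Fin n) ℝ).symm : (Fin n → ℝ) →L[ℝ] Ec n) v
    calc _ ≤ _ := this
      _ ≤ c * ‖v‖ := by gcongr; rw [hc]; linarith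
  refine h _ (fun x hx => hx.1.1) (CL * (2 * N * (3 * c) ^ k)) (1 / (6 * c * (N + 1)))
    ⟨by positivity,
    fun x _ i => ?_, fun x _ y _ => ?_, ?_⟩
  · simp only [eval_taylorMv, taylorPoly_self]
  · rw [dist_eq_norm, ← WithLp.ofLp_sub]
    exact (pi_norm_le_iff_of_nonneg (norm_nonneg _)).2 fun i => PiLp.norm_apply_le (x - y) i
  · intro x hx y hy r hr hxy hrδ v hv i
    have hR : 0 < c * r := by positivity
    have hR3 : 3 * (c * r) < 1 / ((N : ℝ) + 1) := by
      rw [lt_div_iff₀ (by positivity)]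
      rw [le_div_iff₀ (by positivity)] at hrδ
      nlinarith
    have hvx : dist (WithLp.toLp 2 v : Ec n) x ≤ c * r := by
      rw [dist_eq_norm]
      have := hcb (v - x.ofLp)
      rw [WithLp.toLp_sub] at this
      refine le_trans this ?_
      gcongr
    obtain ⟨u, hu⟩ := hdir x y (WithLp.toLp 2 v) (c * r) _ _ hR hvx
      (hxy.trans (by nlinarith)) (hx.2 _ (by positivity) hR3) (hy.2 _ (by positivity) hR3)
    set g := lineRestrict (taylorMv f p (k - 1) x i - taylorMv f p (k - 1) y i) v
      ((c * r) • u.ofLp) with hg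
    have hgd : g.natDegree ≤ D := (natDegree_lineRestrict_le _ _ _).trans
      ((MvPolynomial.totalDegree_sub _ _).trans (max_le (hx.1.2 i) (hy.1.2 i)))
    have hge : ∀ t, g.eval t = taylorPoly f p (k - 1) x (WithLp.toLp 2 v + (t * (c * r)) • u) i -
        taylorPoly f p (k - 1) y (WithLp.toLp 2 v + (t * (c * r)) • u) i := by
      intro t
      rw [hg, eval_lineRestrict, map_sub, ← eval_taylorMv, ← eval_taylorMv, smul_smul]
      rfl
    have hone : ∀ x w : Ec n, dist w x < 3 * (c * r) →
        w ∉ {y | y ≠ x ∧ (N : ℝ) * ‖y - x‖ ^ k ≤ ‖f y - taylorPoly f p (k - 1) x y‖} →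
        |f w i - taylorPoly f p (k - 1) x w i| ≤ N * (3 * c) ^ k * r ^ k := by
      intro x w hd hw
      have h0 : |f w i - taylorPoly f p (k - 1) x w i| ≤ ‖f w - taylorPoly f p (k - 1) x w‖ := by
        have := PiLp.norm_apply_le (f w - taylorPoly f p (k - 1) x w) i
        simpa using this
      refine h0.trans ?_
      by_cases hwx : w = x
      · rw [hwx, taylorPoly_self, sub_self, norm_zero]
        positivity
      · have h1 : ‖f w - taylorPoly f p (k - 1) x w‖ < N * ‖w - x‖ ^ k := by
          by_contra hcon
          exact hw ⟨hwx, not_lt.1 hcon⟩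
        rw [dist_eq_norm] at hd
        calc _ ≤ _ := h1.le
          _ ≤ N * (3 * (c * r)) ^ k := by gcongr
          _ = _ := by rw [← mul_assoc 3 c r, mul_pow, mul_assoc]
    have hfin := (hCL g hgd (2 * N * (3 * c) ^ k * r ^ k) (fun j hj => ?_)).1
    · rw [hge, zero_mul, zero_smul, add_zero, ← eval_taylorMv, ← eval_taylorMv] at hfin
      refine hfin.trans (le_of_eq (by ring))
    · obtain ⟨⟨h1, h2⟩, h3, h4⟩ := hu j hj
      rw [hge]
      have e1 := hone x _ h2 h1
      have e2 := hone y _ h4 h3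
      rw [abs_sub_comm] at e1
      refine (abs_sub_le _
        (f (WithLp.toLp 2 v + (((j : ℝ) + 1) / (D + 1) * (c * r)) • u) i) _).trans ?_
      linarith

theorem volume_image_le_of_controlled_of_pos {X : Type*} {m k : ℕ} (hk : 1 ≤ k) {F : X → Fin m → ℝ}
    (I : Finset (Fin m)) {C r : ℝ} (hC : 0 ≤ C) (hr0 : 0 < r) (hr1 : r ≤ 1) {t : Set X}
    (h1 : ∀ x ∈ t, ∀ y ∈ t, ∀ i, |F x i - F y i| ≤ C * r)
    (h2 : ∀ x ∈ t, ∀ y ∈ t, ∀ i, |F x i - F y i| ≤ C * (r ^ k + ∑ j ∈ I, |F x j - F y j|)) :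
    volume (F '' t) ≤ ENNReal.ofReal ((2 * C + 2) ^ I.card * (C * (1 + m)) ^ m *
      r ^ (I.card + k * (m - I.card))) := by
  rcases t.eq_empty_or_nonempty with rfl | ⟨x₀, hx₀⟩
  · simp
  have hIm : I.card ≤ m := by simpa using Finset.card_le_univ I
  have hrk : 0 < r ^ k := by positivity
  have hrk1 : r ^ k ≤ r := by simpa using pow_le_pow_of_le_one hr0.le hr1 hk
  set L : ℝ := C * r / r ^ k with hL
  set J : Finset (I → ℤ) := Fintype.piFinset fun _ => Finset.Icc ⌊-L⌋ ⌊L⌋ with hJ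
  set φ : X → I → ℤ := fun x i => ⌊(F x i - F x₀ i) / r ^ k⌋ with hφ
  have hcov : F '' t ⊆ ⋃ c ∈ J, F '' {x ∈ t | φ x = c} := by
    rintro _ ⟨x, hx, rfl⟩
    simp only [mem_iUnion]
    refine ⟨φ x, ?_, x, ⟨hx, rfl⟩, rfl⟩
    rw [hJ, Fintype.mem_piFinset]
    intro i
    have := abs_le.1 (h1 x hx x₀ hx₀ i)
    rw [Finset.mem_Icc]
    constructor
    · refine Int.floor_le_floor ?_
      rw [hL, ← neg_div]
      gcongr
      linarith
    · refine Int.floor_le_floor ?_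
      rw [hL]
      gcongr
      linarith
  have hcell : ∀ c ∈ J, volume (F '' {x ∈ t | φ x = c}) ≤
      ENNReal.ofReal ((C * (1 + m) * r ^ k) ^ m) := by
    intro c _
    refine (Real.volume_pi_le_diam_pow _).trans ?_
    rw [ENNReal.ofReal_pow (by positivity), Fintype.card_fin]
    gcongr
    refine ediam_le ?_
    rintro _ ⟨x, ⟨hx, hxc⟩, rfl⟩ _ ⟨y, ⟨hy, hyc⟩, rfl⟩
    rw [edist_dist]
    refine ENNReal.ofReal_le_ofReal ?_
    rw [dist_pi_le_iff (by positivity)]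
    intro i
    rw [Real.dist_eq]
    have hI : ∀ j ∈ I, |F x j - F y j| ≤ r ^ k := by
      intro j hj
      have := congrFun (hxc.trans hyc.symm) ⟨j, hj⟩
      have := (Int.abs_sub_lt_one_of_floor_eq_floor this).le
      rw [← sub_div, abs_div, abs_of_pos hrk, div_le_one hrk] at this
      simpa using this
    have hsum : ∑ j ∈ I, |F x j - F y j| ≤ m * r ^ k := by
      refine (Finset.sum_le_card_nsmul I _ _ hI).trans ?_
      rw [nsmul_eq_mul]
      gcongr
    calc _ ≤ _ := h2 x hx y hy i
      _ ≤ C * (r ^ k + m * r ^ k) := by gcongr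
      _ = _ := by ring
  have hcard : (J.card : ℝ) ≤ ((2 * C + 2) * (r / r ^ k)) ^ I.card := by
    rw [hJ, Fintype.card_piFinset]
    simp only [Finset.prod_const, Finset.card_univ, Fintype.card_coe]
    push_cast
    gcongr
    have hL0 : 0 ≤ L := by positivity
    have hle : ⌊-L⌋ ≤ ⌊L⌋ + 1 := by
      have : ⌊-L⌋ ≤ ⌊L⌋ := Int.floor_le_floor (by linarith)
      linarith
    have hc : ((Finset.Icc ⌊-L⌋ ⌊L⌋).card : ℝ) = (⌊L⌋ : ℝ) + 1 - ⌊-L⌋ := by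
      have := Int.card_Icc_of_le _ _ hle
      exact_mod_cast congrArg (fun z : ℤ => (z : ℝ)) this
    rw [hc]
    have e1 := Int.floor_le L
    have e2 := Int.lt_floor_add_one (-L)
    have e3 : 1 ≤ r / r ^ k := by rwa [one_le_div hrk]
    have e4 : L = C * (r / r ^ k) := by rw [hL]; ring
    nlinarith
  calc volume (F '' t) ≤ ∑ c ∈ J, volume (F '' {x ∈ t | φ x = c}) :=
        (measure_mono hcov).trans (measure_biUnion_finset_le _ _)
    _ ≤ ∑ c ∈ J, ENNReal.ofReal ((C * (1 + m) * r ^ k) ^ m) := Finset.sum_le_sum hcell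
    _ = ENNReal.ofReal (J.card * (C * (1 + m) * r ^ k) ^ m) := by
        rw [Finset.sum_const, nsmul_eq_mul, ENNReal.ofReal_mul (by positivity),
          ENNReal.ofReal_natCast]
    _ ≤ ENNReal.ofReal (((2 * C + 2) * (r / r ^ k)) ^ I.card * (C * (1 + m) * r ^ k) ^ m) := by
        gcongr
    _ = _ := by
        congr 1
        have hsplit : (r ^ k) ^ m = (r ^ k) ^ I.card * r ^ (k * (m - I.card)) := by
          rw [pow_mul, ← pow_add, Nat.add_sub_cancel' hIm]
        rw [mul_pow, mul_pow _ (r ^ k), hsplit, div_pow, pow_add r]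
        field_simp

/-- Covering estimate: a map controlled to order `k` by the components in `I` sends sets that are
null for the appropriate Hausdorff measure to Lebesgue null sets. -/
theorem volume_image_eq_zero_of_controlled {X : Type*} [MetricSpace X] [MeasurableSpace X]
    [BorelSpace X] {m k : ℕ} (hm : 0 < m) (hk : 1 ≤ k)
    {F : X → Fin m → ℝ} (I : Finset (Fin m)) {C δ : ℝ} (hC : 0 ≤ C) (hδ : 0 < δ) {B : Set X}
    (h1 : ∀ x ∈ B, ∀ y ∈ B, dist x y ≤ δ → ∀ i, |F x i - F y i| ≤ C * dist x y)
    (h2 : ∀ x ∈ B, ∀ y ∈ B, dist x y ≤ δ → ∀ i,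
      |F x i - F y i| ≤ C * (dist x y ^ k + ∑ j ∈ I, |F x j - F y j|))
    (hB : μH[((I.card + k * (m - I.card) : ℕ) : ℝ)] B = 0) : volume (F '' B) = 0 := by
  have : Nonempty (Fin m) := ⟨⟨0, hm⟩⟩
  set s := I.card + k * (m - I.card) with hs
  have hs0 : s ≠ 0 := by
    have hIm : I.card ≤ m := by simpa using Finset.card_le_univ I
    rcases Nat.eq_zero_or_pos I.card with h | h
    · rw [hs, h]; simp; omega
    · omega
  set M : ℝ := (2 * C + 2) ^ I.card * (C * (1 + m)) ^ m with hM
  have hM0 : 0 ≤ M := by positivity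
  have hset : ∀ t ⊆ B, ediam t ≤ ENNReal.ofReal (min δ 1) →
      volume (F '' t) ≤ ENNReal.ofReal M * ediam t ^ s := by
    intro t ht hd
    have hfin : ediam t ≠ ⊤ := ne_top_of_le_ne_top ENNReal.ofReal_ne_top hd
    rcases eq_or_ne (ediam t) 0 with h0 | h0
    · have hsub : t.Subsingleton := ediam_eq_zero_iff.1 h0
      rw [(hsub.image F).measure_zero volume]
      exact zero_le
    · have hr0 : 0 < (ediam t).toReal := ENNReal.toReal_pos h0 hfin
      have hr : (ediam t).toReal ≤ min δ 1 :=
        ENNReal.toReal_le_of_le_ofReal (by positivity) hd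
      have hdist : ∀ x ∈ t, ∀ y ∈ t, dist x y ≤ (ediam t).toReal := by
        intro x hx y hy
        rw [dist_edist]
        exact ENNReal.toReal_mono hfin (edist_le_ediam_of_mem hx hy)
      have hδ' : ∀ x ∈ t, ∀ y ∈ t, dist x y ≤ δ := fun x hx y hy =>
        (hdist x hx y hy).trans (hr.trans (min_le_left _ _))
      have := volume_image_le_of_controlled_of_pos hk I hC hr0 (hr.trans (min_le_right _ _))
        (t := t) (F := F)
        (fun x hx y hy i => (h1 x (ht hx) y (ht hy) (hδ' x hx y hy) i).trans
          (by gcongr; exact hdist x hx y hy))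
        (fun x hx y hy i => (h2 x (ht hx) y (ht hy) (hδ' x hx y hy) i).trans
          (by gcongr; exact hdist x hx y hy))
      rwa [ENNReal.ofReal_mul hM0, ENNReal.ofReal_pow hr0.le, ENNReal.ofReal_toReal hfin] at this
  rw [Measure.hausdorffMeasure_apply] at hB
  have hδ1 : 0 < ENNReal.ofReal (min δ 1) := by rw [ENNReal.ofReal_pos]; positivity
  have hz := le_antisymm ((le_iSup₂ (f := fun (r : ENNReal) (_ : 0 < r) => _) _ hδ1).trans_eq hB)
    zero_le
  refine le_antisymm (ENNReal.le_of_forall_pos_le_add fun ε hε _ => ?_) zero_le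
  have hlt : (0 : ENNReal) < ε / (ENNReal.ofReal M + 1) :=
    ENNReal.div_pos (by exact_mod_cast hε.ne') (by finiteness)
  rw [← hz] at hlt
  simp only [iInf_lt_iff] at hlt
  obtain ⟨t, hcov, hdiam, hsum⟩ := hlt
  rw [zero_add]
  have hcov' : F '' B ⊆ ⋃ j, F '' (t j ∩ B) := by
    rintro _ ⟨x, hx, rfl⟩
    obtain ⟨j, hj⟩ := mem_iUnion.1 (hcov hx)
    exact mem_iUnion.2 ⟨j, x, ⟨hj, hx⟩, rfl⟩
  calc volume (F '' B) ≤ ∑' j, volume (F '' (t j ∩ B)) :=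
        (measure_mono hcov').trans (measure_iUnion_le _)
    _ ≤ ∑' j, ENNReal.ofReal M * ⨆ _ : (t j).Nonempty, ediam (t j) ^ (s : ℝ) := by
        refine ENNReal.tsum_le_tsum fun j => ?_
        rcases (t j).eq_empty_or_nonempty with h | h
        · simp [h]
        · refine (hset (t j ∩ B) inter_subset_right
            ((ediam_mono inter_subset_left).trans (hdiam j))).trans ?_
          simp only [h, ciSup_unique, ENNReal.rpow_natCast]
          gcongr
          exact inter_subset_left
    _ = ENNReal.ofReal M * ∑' j, ⨆ _ : (t j).Nonempty, ediam (t j) ^ (s : ℝ) :=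
        ENNReal.tsum_mul_left
    _ ≤ (ENNReal.ofReal M + 1) * (ε / (ENNReal.ofReal M + 1)) := by
        gcongr
        exact le_self_add
    _ = ε := ENNReal.mul_div_cancel (by simp) (by finiteness)

theorem exists_mem_ball_of_dense {k : ℕ} {E : Set (Fin k → ℝ)} {u c : Fin k → ℝ} {R r : ℝ}
    (hr : 0 < r) (hR : 0 < R) (hsub : ball c r ⊆ closedBall u R)
    (h : 1 - ENNReal.ofReal ((r / R) ^ k) <
      volume (E ∩ closedBall u R) / volume (closedBall u R)) : ∃ w ∈ E, w ∈ ball c r := by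
  by_contra! hcon
  have hV0 : volume (closedBall u R) ≠ 0 := (measure_closedBall_pos _ _ hR).ne'
  have hVt : volume (closedBall u R) ≠ ⊤ := measure_closedBall_lt_top.ne
  have hfrac : volume (ball c r) = ENNReal.ofReal ((r / R) ^ k) * volume (closedBall u R) := by
    rw [Measure.addHaar_ball_of_pos volume c hr, Measure.addHaar_closedBall volume u hR.le,
      ← mul_assoc, ← ENNReal.ofReal_mul (by positivity), Module.finrank_fin_fun, div_pow,
      div_mul_cancel₀ _ (by positivity)]
  have h1 : E ∩ closedBall u R ⊆ closedBall u R \ ball c r := fun w hw =>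
    ⟨hw.2, hcon w hw.1⟩
  have h2 : volume (E ∩ closedBall u R) ≤
      (1 - ENNReal.ofReal ((r / R) ^ k)) * volume (closedBall u R) := by
    refine (measure_mono h1).trans ?_
    rw [measure_sdiff hsub measurableSet_ball.nullMeasurableSet measure_ball_lt_top.ne, hfrac,
      ENNReal.sub_mul (fun _ _ => hVt), one_mul]
  rw [ENNReal.lt_div_iff_mul_lt (Or.inl hV0) (Or.inl hVt)] at h
  exact absurd h2 (not_le.2 h)

theorem eventually_holder_small {k : ℕ} (hk : 2 ≤ k) {E : Set (Fin k → ℝ)} {g : (Fin k → ℝ) → ℝ}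
    {C : ℝ} (hg : ∀ x ∈ E, ∀ y ∈ E, |g x - g y| ≤ C * ‖x - y‖ ^ k) (hC : 0 ≤ C)
    {u : Fin k → ℝ} (hu : u ∈ E)
    (hd : Tendsto (fun r => volume (E ∩ closedBall u r) / volume (closedBall u r))
      (nhdsWithin 0 (Ioi 0)) (nhds 1)) (M : ℕ) :
    ∃ j : ℕ, ∀ y ∈ E, ‖y - u‖ < 1 / (j + 1) → |g y - g u| ≤ C * 3 ^ k / (M + 1) * ‖y - u‖ ^ k := by
  set M' : ℝ := (M : ℝ) + 1 with hM'
  have hM0 : 0 < M' := by positivity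
  have hM1 : 1 ≤ M' := by rw [hM']; simp
  have hlt : 1 - ENNReal.ofReal ((1 / (2 * M')) ^ k) < 1 := by
    refine ENNReal.sub_lt_self ENNReal.one_ne_top one_ne_zero ?_
    rw [Ne, ENNReal.ofReal_eq_zero, not_le]
    positivity
  have h1 := hd.eventually (lt_mem_nhds hlt)
  rw [eventually_nhdsWithin_iff, Metric.eventually_nhds_iff] at h1
  obtain ⟨δ, hδ, h1⟩ := h1
  obtain ⟨j, hj⟩ := exists_nat_one_div_lt (half_pos hδ)
  refine ⟨j, fun y hy hyu => ?_⟩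
  rcases eq_or_ne y u with rfl | hne
  · simp; positivity
  have hρ : 0 < ‖y - u‖ := norm_pos_iff.2 (sub_ne_zero.2 hne)
  set ρ := ‖y - u‖ with hρd
  have hdens := h1 (y := 2 * ρ) (by rw [Real.dist_0_eq_abs, abs_of_pos (by positivity)]; linarith)
    (by simpa using hρ)
  have hw : ∀ i : ℕ, ∃ w, i ≤ M + 1 → w ∈ E ∧ ‖w - (u + ((i : ℝ) / M') • (y - u))‖ ≤ ρ / M' ∧
      (i = 0 → w = u) ∧ (i = M + 1 → w = y) := by
    intro i
    rcases Nat.eq_zero_or_pos i with rfl | hi0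
    · exact ⟨u, fun _ => ⟨hu, by simp; positivity, fun _ => rfl, fun h => by omega⟩⟩
    by_cases hiM : i = M + 1
    · refine ⟨y, fun _ => ⟨hy, ?_, fun h => by omega, fun _ => rfl⟩⟩
      have : (i : ℝ) / M' = 1 := by rw [hiM, hM']; push_cast; exact div_self (by positivity)
      rw [this]
      simp
      positivity
    by_cases hle : i ≤ M + 1
    · obtain ⟨w, hwE, hwb⟩ := exists_mem_ball_of_dense (E := E) (u := u) (R := 2 * ρ)
        (c := u + ((i : ℝ) / M') • (y - u)) (r := ρ / M') (by positivity) (by positivity) (by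
          intro w hw
          rw [mem_ball, dist_eq_norm] at hw
          rw [mem_closedBall, dist_eq_norm]
          have hi : (i : ℝ) / M' ≤ 1 := by
            rw [div_le_one hM0, hM']; exact_mod_cast hle
          have e1 : ‖((i : ℝ) / M') • (y - u)‖ ≤ ρ := by
            rw [norm_smul, Real.norm_of_nonneg (by positivity), ← hρd]
            nlinarith
          have e2 : ρ / M' ≤ ρ := div_le_self hρ.le hM1
          calc ‖w - u‖ = ‖(w - (u + ((i : ℝ) / M') • (y - u))) + ((i : ℝ) / M') • (y - u)‖ := by
                congr 1; abel
            _ ≤ _ := norm_add_le _ _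
            _ ≤ 2 * ρ := by linarith) (by
          have : ρ / M' / (2 * ρ) = 1 / (2 * M') := by field_simp
          rw [this]
          exact hdens)
      refine ⟨w, fun _ => ⟨hwE, ?_, fun h => by omega, fun h => absurd h hiM⟩⟩
      rw [mem_ball, dist_eq_norm] at hwb
      exact hwb.le
    · exact ⟨u, fun h => absurd h hle⟩
  choose w hw using hw
  have hstep : ∀ i ∈ Finset.range (M + 1), |g (w (i + 1)) - g (w i)| ≤ C * (3 * ρ / M') ^ k := by
    intro i hi
    rw [Finset.mem_range] at hi
    obtain ⟨hE1, hn1, -, -⟩ := hw i (by omega)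
    obtain ⟨hE2, hn2, -, -⟩ := hw (i + 1) (by omega)
    refine (hg _ hE2 _ hE1).trans ?_
    gcongr
    have e : w (i + 1) - w i = (w (i + 1) - (u + (((i + 1 : ℕ) : ℝ) / M') • (y - u))) -
        (w i - (u + ((i : ℝ) / M') • (y - u))) + (1 / M') • (y - u) := by
      have : (((i + 1 : ℕ) : ℝ) / M') = (i : ℝ) / M' + 1 / M' := by push_cast; ring
      rw [this, add_smul]
      abel
    rw [e]
    refine (norm_add_le _ _).trans ?_
    have e3 : ‖(1 / M') • (y - u)‖ = ρ / M' := by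
      rw [norm_smul, Real.norm_of_nonneg (by positivity), ← hρd]
      ring
    rw [e3]
    have := norm_sub_le (w (i + 1) - (u + (((i + 1 : ℕ) : ℝ) / M') • (y - u)))
      (w i - (u + ((i : ℝ) / M') • (y - u)))
    have e4 : 3 * ρ / M' = ρ / M' + ρ / M' + ρ / M' := by ring
    linarith
  have htel := Finset.sum_range_sub (fun i => g (w i)) (M + 1)
  rw [(hw 0 (by omega)).2.2.1 rfl, (hw (M + 1) le_rfl).2.2.2 rfl] at htel
  rw [← htel]
  refine (Finset.abs_sum_le_sum_abs _ _).trans ((Finset.sum_le_sum hstep).trans ?_)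
  rw [Finset.sum_const, Finset.card_range, nsmul_eq_mul]
  push_cast
  rw [← hM']
  have hMk : M' ^ 2 ≤ M' ^ k := pow_le_pow_right₀ hM1 hk
  calc M' * (C * (3 * ρ / M') ^ k) = C * 3 ^ k * ρ ^ k * (M' / M' ^ k) := by
        rw [div_pow, mul_pow]; ring
    _ ≤ C * 3 ^ k * ρ ^ k * (1 / M') := by
        gcongr ?_ * ?_
        rw [div_le_div_iff₀ (by positivity) hM0]
        nlinarith
    _ = _ := by ring

theorem measure_eq_tsum_inter_disjointed {X : Type*} [MeasurableSpace X] (μ : Measure X)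
    (Q : ℕ → Set X) (hQ : ∀ i, MeasurableSet (Q i)) (hU : ⋃ i, Q i = univ) (S : Set X) :
    μ S = ∑' i, μ (S ∩ disjointed Q i) := by
  have h := Measure.restrict_iUnion (μ := μ) (disjoint_disjointed Q)
    (fun i => MeasurableSet.disjointed hQ i)
  rw [iUnion_disjointed, hU, Measure.restrict_univ] at h
  conv_lhs => rw [h]
  have hle : ∑' i, μ (S ∩ disjointed Q i) = ∑' i, μ.restrict (disjointed Q i) S := by
    refine tsum_congr fun i => ?_
    rw [Measure.restrict_apply' (MeasurableSet.disjointed hQ i)]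
  rw [hle]
  refine le_antisymm ?_ (Measure.le_sum_apply _ _)
  rw [← h, ← hle]
  calc μ S ≤ μ (⋃ i, S ∩ disjointed Q i) := by
        rw [← inter_iUnion, iUnion_disjointed, hU, inter_univ]
    _ ≤ _ := measure_iUnion_le _

theorem volume_image_le_of_holder {k : ℕ} (hk : 0 < k) {S : Set (Fin k → ℝ)}
    {g : (Fin k → ℝ) → ℝ} {C : ℝ} (hC : 0 ≤ C)
    (hg : ∀ x ∈ S, ∀ y ∈ S, |g x - g y| ≤ C * ‖x - y‖ ^ k) :
    volume (g '' S) ≤ ENNReal.ofReal C * volume S := by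
  have hH : HolderOnWith C.toNNReal k g S := by
    intro x hx y hy
    rw [edist_dist, edist_dist, Real.dist_eq, dist_eq_norm]
    simp only [NNReal.coe_natCast, ENNReal.rpow_natCast]
    rw [← ENNReal.ofReal_pow (norm_nonneg _)]
    change _ ≤ ENNReal.ofReal C * _
    rw [← ENNReal.ofReal_mul hC]
    exact ENNReal.ofReal_le_ofReal (hg x hx y hy)
  have := hH.hausdorffMeasure_image_le (by exact_mod_cast hk) zero_le_one
  rw [hausdorffMeasure_real, ENNReal.rpow_one, NNReal.coe_natCast, mul_one] at this
  have h2 := hausdorffMeasure_pi_real (ι := Fin k)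
  rw [Fintype.card_fin] at h2
  rwa [h2] at this

/-- A real function on a subset of `ℝᵏ` which is Hölder of order `k ≥ 2` has null image. -/
theorem volume_image_eq_zero_of_holder {k : ℕ} (hk : 2 ≤ k) {E : Set (Fin k → ℝ)}
    (hE : volume E ≠ ⊤) {g : (Fin k → ℝ) → ℝ} {C : ℝ}
    (hg : ∀ x ∈ E, ∀ y ∈ E, |g x - g y| ≤ C * ‖x - y‖ ^ k) : volume (g '' E) = 0 := by
  wlog hC : 0 ≤ C generalizing C
  · exact this (C := |C|) (fun x hx y hy => (hg x hx y hy).trans (by gcongr; exact le_abs_self C))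
      (abs_nonneg C)
  set D := {u | u ∈ E ∧ Tendsto (fun r => volume (E ∩ closedBall u r) / volume (closedBall u r))
      (nhdsWithin 0 (Ioi 0)) (nhds 1)} with hD
  have hnull : volume (E \ D) = 0 := by
    have h1 := Besicovitch.ae_tendsto_measure_inter_div (volume : Measure (Fin k → ℝ)) E
    rw [ae_iff] at h1
    refine measure_mono_null ?_ (le_antisymm ((Measure.le_restrict_apply _ _).trans h1.le) zero_le)
    rintro u ⟨hu, huD⟩
    exact ⟨fun h => huD ⟨hu, h⟩, hu⟩
  have h1 : volume (g '' (E \ D)) = 0 := by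
    refine le_antisymm ((volume_image_le_of_holder (by omega) hC
      fun x hx y hy => hg x hx.1 y hy.1).trans ?_) zero_le
    rw [hnull, mul_zero]
  have h2 : ∀ M : ℕ, volume (g '' D) ≤ ENNReal.ofReal (C * 3 ^ k / (M + 1)) * volume E := by
    intro M
    set c : ℝ := C * 3 ^ k / (M + 1) with hc
    have hc0 : 0 ≤ c := by positivity
    set S : ℕ → Set (Fin k → ℝ) := fun j => {u | u ∈ E ∧ ∀ y ∈ E, ‖y - u‖ < 1 / ((j : ℝ) + 1) →
      |g y - g u| ≤ c * ‖y - u‖ ^ k} with hS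
    have hmono : Monotone fun j => g '' S j := by
      intro i j hij
      refine image_mono fun u hu => ⟨hu.1, fun y hy hyu => hu.2 y hy (hyu.trans_le ?_)⟩
      have : (i : ℝ) ≤ j := by exact_mod_cast hij
      gcongr
    have hcov : g '' D ⊆ ⋃ j, g '' S j := by
      rintro _ ⟨u, hu, rfl⟩
      obtain ⟨j, hj⟩ := eventually_holder_small hk hg hC hu.1 hu.2 M
      exact mem_iUnion.2 ⟨j, u, ⟨hu.1, hj⟩, rfl⟩
    refine (measure_mono hcov).trans ?_
    rw [hmono.measure_iUnion]
    refine iSup_le fun j => ?_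
    set ε : ℝ := 1 / (2 * ((j : ℝ) + 1)) with hε
    have hε0 : 0 < ε := by positivity
    set Q : ℕ → Set (Fin k → ℝ) := fun i =>
      ball (TopologicalSpace.denseSeq (Fin k → ℝ) i) ε with hQ
    have hU : ⋃ i, Q i = univ := by
      refine eq_univ_of_forall fun u => ?_
      obtain ⟨i, hi⟩ := (TopologicalSpace.denseRange_denseSeq (Fin k → ℝ)).exists_dist_lt u hε0
      exact mem_iUnion.2 ⟨i, hi⟩
    have hcov2 : g '' S j ⊆ ⋃ i, g '' (S j ∩ disjointed Q i) := by
      rw [← image_iUnion, ← inter_iUnion, iUnion_disjointed, hU, inter_univ]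
    calc volume (g '' S j) ≤ ∑' i, volume (g '' (S j ∩ disjointed Q i)) :=
          (measure_mono hcov2).trans (measure_iUnion_le _)
      _ ≤ ∑' i, ENNReal.ofReal c * volume (S j ∩ disjointed Q i) := by
          refine ENNReal.tsum_le_tsum fun i => volume_image_le_of_holder (by omega) hc0 ?_
          rintro x ⟨hx, hxQ⟩ y ⟨hy, hyQ⟩
          refine hy.2 x hx.1 ?_
          have e1 := disjointed_subset Q i hxQ
          have e2 := disjointed_subset Q i hyQ
          rw [hQ, mem_ball] at e1 e2
          rw [← dist_eq_norm]
          have e3 : 1 / ((j : ℝ) + 1) = ε + ε := by rw [hε]; field_simp; norm_num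
          linarith [dist_triangle_right x y (TopologicalSpace.denseSeq (Fin k → ℝ) i)]
      _ = ENNReal.ofReal c * volume (S j) := by
          rw [ENNReal.tsum_mul_left, ← measure_eq_tsum_inter_disjointed volume Q
            (fun i => measurableSet_ball) hU]
      _ ≤ _ := by
          gcongr
          exact fun u hu => hu.1
  have h3 : volume (g '' D) = 0 := by
    have hlim : Tendsto (fun M : ℕ => ENNReal.ofReal (C * 3 ^ k / (M + 1)) * volume E) atTop
        (nhds (ENNReal.ofReal 0 * volume E)) := by
      refine ENNReal.Tendsto.mul_const (ENNReal.tendsto_ofReal ?_) (Or.inr hE)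
      have := (tendsto_one_div_add_atTop_nhds_zero_nat (𝕜 := ℝ)).const_mul (C * 3 ^ k)
      rw [mul_zero] at this
      refine this.congr fun M => ?_
      ring
    rw [ENNReal.ofReal_zero, zero_mul] at hlim
    exact le_antisymm (ge_of_tendsto' hlim h2) zero_le
  refine measure_mono_null (t := g '' (E \ D) ∪ g '' D) ?_ (measure_union_null h1 h3)
  rw [← image_union, sdiff_union_self]
  exact image_mono subset_union_left

theorem volume_image_eq_zero_of_slices {X : Type*} {m k : ℕ} (hk : 2 ≤ k) (i₀ : Fin (m + 1))
    {F : X → Fin (m + 1) → ℝ} {L : X → Fin k → ℝ} {B : Set X} {C : ℝ}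
    (hF : Bornology.IsBounded (F '' B)) (hL : Bornology.IsBounded (L '' B))
    (h : ∀ x ∈ B, ∀ y ∈ B, |F x i₀ - F y i₀| ≤
      C * ((‖L x - L y‖ + ∑ j, |F x (i₀.succAbove j) - F y (i₀.succAbove j)|) ^ k +
        ∑ j, |F x (i₀.succAbove j) - F y (i₀.succAbove j)|)) :
    volume (F '' B) = 0 := by
  set Z₀ := (fun x => (L x, F x)) '' B with hZ₀
  set Z := closure Z₀ with hZ
  have hbd : Bornology.IsBounded Z := by
    refine Bornology.IsBounded.closure ((hL.prod hF).subset ?_)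
    rintro _ ⟨x, hx, rfl⟩
    exact ⟨mem_image_of_mem _ hx, mem_image_of_mem _ hx⟩
  have hcpt : IsCompact Z := isCompact_of_isClosed_isBounded isClosed_closure hbd
  have hrel : ∀ a ∈ Z, ∀ b ∈ Z, |a.2 i₀ - b.2 i₀| ≤
      C * ((‖a.1 - b.1‖ + ∑ j, |a.2 (i₀.succAbove j) - b.2 (i₀.succAbove j)|) ^ k +
        ∑ j, |a.2 (i₀.succAbove j) - b.2 (i₀.succAbove j)|) := by
    have hcl : IsClosed {q : ((Fin k → ℝ) × (Fin (m + 1) → ℝ)) × ((Fin k → ℝ) × (Fin (m + 1) → ℝ)) |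
        |q.1.2 i₀ - q.2.2 i₀| ≤ C * ((‖q.1.1 - q.2.1‖ +
          ∑ j, |q.1.2 (i₀.succAbove j) - q.2.2 (i₀.succAbove j)|) ^ k +
          ∑ j, |q.1.2 (i₀.succAbove j) - q.2.2 (i₀.succAbove j)|)} := by
      refine isClosed_le (by fun_prop) (by fun_prop)
    have hsub : closure (Z₀ ×ˢ Z₀) ⊆ _ := hcl.closure_subset_iff.2 (by
      rintro ⟨_, _⟩ ⟨⟨x, hx, rfl⟩, ⟨y, hy, rfl⟩⟩
      exact h x hx y hy)
    rw [closure_prod_eq] at hsub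
    exact fun a ha b hb => hsub (mk_mem_prod ha hb)
  have hS : IsCompact (Prod.snd '' Z) := hcpt.image continuous_snd
  refine measure_mono_null (t := Prod.snd '' Z) ?_ ?_
  · rintro _ ⟨x, hx, rfl⟩
    exact ⟨(L x, F x), subset_closure (mem_image_of_mem _ hx), rfl⟩
  have hmp := (volume_preserving_piFinSuccAbove (fun _ : Fin (m + 1) => ℝ) i₀).symm
  rw [← hmp.measure_preimage hS.measurableSet.nullMeasurableSet, Measure.volume_eq_prod,
    Measure.prod_apply_symm (hmp.measurable hS.measurableSet)]
  refine (lintegral_congr fun t => ?_).trans lintegral_zero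
  have hEx : ∀ u : Fin k → ℝ, ∃ s : ℝ, (∃ s, (u, i₀.insertNth (α := fun _ => ℝ) s t) ∈ Z) →
      (u, i₀.insertNth (α := fun _ => ℝ) s t) ∈ Z := by
    intro u
    by_cases hu : ∃ s, (u, i₀.insertNth (α := fun _ => ℝ) s t) ∈ Z
    · exact ⟨hu.choose, fun _ => hu.choose_spec⟩
    · exact ⟨0, fun h => absurd h hu⟩
  choose g hg using hEx
  have hrel' : ∀ u s u' s', (u, i₀.insertNth (α := fun _ => ℝ) s t) ∈ Z →
      (u', i₀.insertNth (α := fun _ => ℝ) s' t) ∈ Z → |s - s'| ≤ C * ‖u - u'‖ ^ k := by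
    intro u s u' s' h1 h2
    simpa using hrel _ h1 _ h2
  have hfin : volume {u : Fin k → ℝ | ∃ s, (u, i₀.insertNth (α := fun _ => ℝ) s t) ∈ Z} ≠ ⊤ := by
    refine ((hcpt.image continuous_fst).isBounded.subset ?_).measure_lt_top.ne
    rintro u ⟨s, hs⟩
    exact ⟨_, hs, rfl⟩
  refine measure_mono_null ?_ (volume_image_eq_zero_of_holder hk hfin (g := g)
    fun u hu u' hu' => hrel' _ _ _ _ (hg u hu) (hg u' hu'))
  rintro s ⟨⟨u, w⟩, hw, hws⟩
  have hws' : w = i₀.insertNth (α := fun _ => ℝ) s t := hws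
  rw [hws'] at hw
  refine ⟨u, ⟨s, hw⟩, ?_⟩
  have := hrel' _ _ _ _ (hg u ⟨s, hw⟩) hw
  rw [sub_self, norm_zero, zero_pow (by omega), mul_zero, abs_nonpos_iff] at this
  linarith

theorem exists_clm_complement {n k : ℕ} {ι : Type*} [Fintype ι] (hk : Fintype.card ι + k = n)
    (T : (Fin n → ℝ) →ₗ[ℝ] (ι → ℝ)) (hT : Function.Surjective T) :
    ∃ (L : (Fin n → ℝ) →L[ℝ] (Fin k → ℝ)) (N : ℝ), 0 ≤ N ∧
      ∀ v, ‖v‖ ≤ N * (‖L v‖ + ‖T v‖) := by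
  have h1 := T.finrank_range_add_finrank_ker
  rw [LinearMap.range_eq_top.2 hT, finrank_top, Module.finrank_fintype_fun_eq_card,
    Module.finrank_fin_fun] at h1
  have h2 : Module.finrank ℝ (LinearMap.ker T) = Module.finrank ℝ (Fin k → ℝ) := by
    rw [Module.finrank_fin_fun]; omega
  have e := LinearEquiv.ofFinrankEq _ _ h2
  obtain ⟨L, hL⟩ := LinearMap.exists_extend e.toLinearMap
  have hker : LinearMap.ker (L.prod T) = ⊥ := by
    rw [LinearMap.ker_eq_bot']
    intro v hv
    simp only [LinearMap.prod_apply, Function.prod, Prod.mk_eq_zero] at hv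
    have h3 : e ⟨v, LinearMap.mem_ker.2 hv.2⟩ = 0 :=
      (LinearMap.congr_fun hL ⟨v, LinearMap.mem_ker.2 hv.2⟩).symm.trans hv.1
    simpa using h3
  obtain ⟨K, _, hK⟩ := LinearMap.exists_antilipschitzWith _ hker
  refine ⟨L.toContinuousLinearMap, K, K.2, fun v => ?_⟩
  have h4 := hK.le_mul_dist v 0
  rw [map_zero, dist_zero_right, dist_zero_right, LinearMap.prod_apply, Function.prod,
    Prod.norm_mk] at h4
  refine h4.trans (mul_le_mul_of_nonneg_left ?_ K.2)
  exact max_le_add_of_nonneg (norm_nonneg _) (norm_nonneg _)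

theorem exists_denseSeq_complement {n k : ℕ} {ι : Type*} [Fintype ι] (hk : Fintype.card ι + k = n)
    (T : (Fin n → ℝ) →ₗ[ℝ] (ι → ℝ)) (hT : Function.Surjective T) :
    ∃ c N : ℕ, ∀ v, ‖v‖ ≤
      N * (‖TopologicalSpace.denseSeq ((Fin n → ℝ) →L[ℝ] (Fin k → ℝ)) c v‖ + ‖T v‖) := by
  obtain ⟨L, M, hM, hL⟩ := exists_clm_complement hk T hT
  obtain ⟨c, hc⟩ := (TopologicalSpace.denseRange_denseSeq
    ((Fin n → ℝ) →L[ℝ] (Fin k → ℝ))).exists_dist_lt L (ε := 1 / (2 * (M + 1))) (by positivity)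
  obtain ⟨N, hN⟩ := exists_nat_ge (2 * M)
  refine ⟨c, N, fun v => ?_⟩
  set L' := TopologicalSpace.denseSeq ((Fin n → ℝ) →L[ℝ] (Fin k → ℝ)) c
  have h1 : ‖L v - L' v‖ ≤ 1 / (2 * (M + 1)) * ‖v‖ := by
    refine ((L - L').le_opNorm v).trans ?_
    rw [dist_eq_norm] at hc
    gcongr
  have h2 : M * (1 / (2 * (M + 1)) * ‖v‖) ≤ ‖v‖ / 2 := by
    have : M / (M + 1) ≤ 1 := by rw [div_le_one (by positivity)]; linarith
    calc _ = (M / (M + 1)) * (‖v‖ / 2) := by field_simp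
      _ ≤ 1 * (‖v‖ / 2) := by gcongr
      _ = _ := one_mul _
  have h3 : ‖L v‖ ≤ ‖L' v‖ + ‖L v - L' v‖ := by
    have := norm_add_le (L' v) (L v - L' v)
    rwa [add_sub_cancel] at this
  have h4 := hL v
  have h5 : ‖v‖ ≤ M * (‖L' v‖ + ‖T v‖) + ‖v‖ / 2 :=
    calc _ ≤ M * (‖L v‖ + ‖T v‖) := h4
      _ ≤ M * (‖L' v‖ + 1 / (2 * (M + 1)) * ‖v‖ + ‖T v‖) := by gcongr; linarith
      _ = M * (‖L' v‖ + ‖T v‖) + M * (1 / (2 * (M + 1)) * ‖v‖) := by ring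
      _ ≤ _ := by linarith
  calc ‖v‖ ≤ 2 * M * (‖L' v‖ + ‖T v‖) := by linarith
    _ ≤ _ := by gcongr

theorem measure_null_of_dist_le {X : Type*} [PseudoMetricSpace X]
    [TopologicalSpace.SeparableSpace X] (ν : OuterMeasure X) {A : Set X} {η : ℝ} (hη : 0 < η)
    (h : ∀ B ⊆ A, (∀ x ∈ B, ∀ y ∈ B, dist x y ≤ η) → ν B = 0) : ν A = 0 := by
  rcases isEmpty_or_nonempty X with hX | hX
  · rw [Set.eq_empty_of_isEmpty A, measure_empty]
  refine measure_null_of_forall_exists ν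
    (fun x c => dist x (TopologicalSpace.denseSeq X c) < η / 2) (fun x _ => ?_)
    fun c => h _ (fun x hx => hx.1) fun x hx y hy => ?_
  · exact (TopologicalSpace.denseRange_denseSeq X).exists_dist_lt x (by positivity)
  · have := dist_triangle_right x y (TopologicalSpace.denseSeq X c)
    have h1 := hx.2
    have h2 := hy.2
    linarith

theorem JetField.measure_null_of_lipschitz {X : Type*} [MetricSpace X] (ν : OuterMeasure X)
    {d m k : ℕ} (hk : 1 ≤ k) {A : Set X} {z : X → Fin d → ℝ}
    {P : X → Fin m → MvPolynomial (Fin d) ℝ} {F : X → Fin m → ℝ} {C δ : ℝ}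
    (h : JetField A dist z P F k C δ)
    (hB : ∀ B ⊆ A, ∀ K η : ℝ, 0 ≤ K → 0 < η →
      (∀ x ∈ B, ∀ y ∈ B, dist x y ≤ η → ∀ i, |F x i - F y i| ≤ K * dist x y) → ν B = 0) :
    ν A = 0 := by
  refine measure_null_of_forall_exists ν (fun x (N : ℕ) => ∀ i, ∀ u, ‖u - z x‖ ≤ 1 →
    |MvPolynomial.eval u (P x i) - MvPolynomial.eval (z x) (P x i)| ≤ N * ‖u - z x‖)
    (fun x _ => ?_) fun N => ?_
  · choose K hK0 hK using fun i => exists_lipschitz_eval (P x i) (z x)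
    obtain ⟨N, hN⟩ := exists_nat_ge (∑ i, K i)
    refine ⟨N, fun i u hu => (hK i u hu).trans ?_⟩
    gcongr
    exact (Finset.single_le_sum (fun i _ => hK0 i) (Finset.mem_univ i)).trans hN
  · refine hB _ (fun x hx => hx.1) (N + |C|) (min δ 1) (by positivity) (lt_min h.pos one_pos) ?_
    rintro x ⟨hx, hxN⟩ y ⟨hy, -⟩ hxy i
    rcases eq_or_ne x y with rfl | hne
    · simp
    have hd := dist_pos.2 hne
    have hd1 := hxy.trans (min_le_right _ _)
    have hz := h.near x hx y hy
    rw [norm_sub_rev] at hz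
    have h1 := hxN i (z y) (hz.trans hd1)
    have h2 := h.est x hx y hy _ hd le_rfl (hxy.trans (min_le_left _ _)) (z y) hz i
    rw [h.value y hy i] at h2
    rw [h.value x hx i] at h1
    have h3 : C * dist x y ^ k ≤ |C| * dist x y := by
      refine mul_le_mul (le_abs_self C) ?_ (by positivity) (abs_nonneg C)
      exact pow_le_of_le_one hd.le hd1 (by omega)
    have h4 : (N : ℝ) * ‖z y - z x‖ ≤ N * dist x y := by gcongr
    calc |F x i - F y i| ≤ |F x i - MvPolynomial.eval (z y) (P x i)| +
          |MvPolynomial.eval (z y) (P x i) - F y i| := abs_sub_le _ _ _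
      _ ≤ N * dist x y + |C| * dist x y := by
          rw [abs_sub_comm (F x i)]
          exact add_le_add (h1.trans h4) (h2.trans h3)
      _ = _ := by ring

theorem JetField.measure_null_of_polyDeriv {X : Type*} [MetricSpace X] (ν : OuterMeasure X)
    {d m k : ℕ} (hk : 2 ≤ k) {A : Set X} {z : X → Fin d → ℝ}
    {P : X → Fin m → MvPolynomial (Fin d) ℝ} {F : X → Fin m → ℝ} {C δ ε : ℝ}
    (h : JetField A dist z P F k C δ) (hε : 0 < ε)
    (hB : ∀ B ⊆ A, ∀ η : ℝ, 0 < η →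
      (∀ x ∈ B, ∀ y ∈ B, dist x y ≤ η → ∀ i,
        |polyDeriv (P x i) (z x) (z x - z y)| ≤ |F x i - F y i| + ε * dist x y) → ν B = 0) :
    ν A = 0 := by
  refine measure_null_of_forall_exists ν (fun x (N : ℕ) => ∀ i, ∀ u, ‖u - z x‖ ≤ 1 / (N + 1) →
    |MvPolynomial.eval u (P x i) - MvPolynomial.eval (z x) (P x i) -
      polyDeriv (P x i) (z x) (u - z x)| ≤ ε / 2 * ‖u - z x‖)
    (fun x _ => ?_) fun N => ?_
  · have h1 : ∀ i, ∀ᶠ u in nhds (z x),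
        |MvPolynomial.eval u (P x i) - MvPolynomial.eval (z x) (P x i) -
          polyDeriv (P x i) (z x) (u - z x)| ≤ ε / 2 * ‖u - z x‖ := fun i =>
      (hasFDerivAt_eval (P x i) (z x)).isLittleO.bound (half_pos hε)
    obtain ⟨r, hr, h2⟩ := Metric.eventually_nhds_iff.1 (eventually_all.2 h1)
    obtain ⟨N, hN⟩ := exists_nat_one_div_lt hr
    exact ⟨N, fun i u hu => h2 (by rw [dist_eq_norm]; exact hu.trans_lt hN) i⟩
  · have hC : 0 < ε / (2 * (|C| + 1)) := by positivity
    refine hB _ (fun x hx => hx.1) (min (min δ (1 / (N + 1))) (min 1 (ε / (2 * (|C| + 1)))))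
      (lt_min (lt_min h.pos (by positivity)) (lt_min one_pos hC)) ?_
    rintro x ⟨hx, hxN⟩ y ⟨hy, -⟩ hxy i
    rcases eq_or_ne x y with rfl | hne
    · simp
    have hd := dist_pos.2 hne
    have hd1 := hxy.trans ((min_le_right _ _).trans (min_le_left _ _))
    have hd2 := hxy.trans ((min_le_right _ _).trans (min_le_right _ _))
    have hd3 := hxy.trans ((min_le_left _ _).trans (min_le_left _ _))
    have hd4 := hxy.trans ((min_le_left _ _).trans (min_le_right _ _))
    have hz := h.near x hx y hy
    rw [norm_sub_rev] at hz
    have h1 := hxN i (z y) (hz.trans hd4)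
    have h2 := h.est x hx y hy _ hd le_rfl hd3 (z y) hz i
    rw [h.value y hy i] at h2
    rw [h.value x hx i, ← neg_sub (z x) (z y), map_neg, norm_neg, norm_sub_rev] at h1
    have h3 : C * dist x y ^ k ≤ ε / 2 * dist x y := by
      have h5 : dist x y ^ k ≤ dist x y ^ 2 := pow_le_pow_of_le_one hd.le hd1 hk
      calc C * dist x y ^ k ≤ (|C| + 1) * dist x y ^ 2 := by
            refine mul_le_mul ?_ h5 (by positivity) (by positivity)
            linarith [le_abs_self C]
        _ = (|C| + 1) * dist x y * dist x y := by ring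
        _ ≤ (|C| + 1) * (ε / (2 * (|C| + 1))) * dist x y := by gcongr
        _ = _ := by field_simp
    have h4 : ε / 2 * ‖z y - z x‖ ≤ ε / 2 * dist x y := by gcongr
    rw [abs_le] at h1 h2
    have h5 := neg_abs_le (F x i - F y i)
    have h6 := le_abs_self (F x i - F y i)
    rw [abs_le]
    constructor <;> linarith [h1.1, h1.2, h2.1, h2.2]

/-- The outer measure sending a set to the volume of its image. -/
def imageOuter {X : Type*} {m : ℕ} (F : X → Fin m → ℝ) : OuterMeasure X :=
  OuterMeasure.comap F (volume : Measure (Fin m → ℝ)).toOuterMeasure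

theorem imageOuter_apply {X : Type*} {m : ℕ} (F : X → Fin m → ℝ) (A : Set X) :
    imageOuter F A = volume (F '' A) := rfl

theorem sum_erase_eq_sum_succAbove {m : ℕ} (i₀ : Fin (m + 1)) (g : Fin (m + 1) → ℝ) :
    ∑ j ∈ Finset.univ.erase i₀, g j = ∑ j, g (i₀.succAbove j) := by
  have h1 := Finset.add_sum_erase Finset.univ g (Finset.mem_univ i₀)
  have h2 := Fin.sum_univ_succAbove g i₀
  linarith

theorem isBounded_image_of_dist_le {X E : Type*} [PseudoMetricSpace X] [NormedAddCommGroup E]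
    {g : X → E} {B : Set X} {M : ℝ} (h : ∀ x ∈ B, ∀ y ∈ B, ‖g x - g y‖ ≤ M) :
    Bornology.IsBounded (g '' B) := by
  refine Metric.isBounded_iff.2 ⟨M, ?_⟩
  rintro _ ⟨x, hx, rfl⟩ _ ⟨y, hy, rfl⟩
  rw [dist_eq_norm]
  exact h x hx y hy

/-- The critical case, where all components but `i₀` have independent derivatives. -/
theorem JetField.volume_image_eq_zero_of_corank_one {X : Type*} [MetricSpace X]
    [TopologicalSpace.SeparableSpace X]
    {d m k : ℕ} (hk : 2 ≤ k) (hmk : m + k = d) {A : Set X} {z : X → Fin d → ℝ} {c : ℝ} (hc : 0 ≤ c)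
    (hz : ∀ x y, dist x y ≤ c * ‖z x - z y‖)
    {P : X → Fin (m + 1) → MvPolynomial (Fin d) ℝ} {F : X → Fin (m + 1) → ℝ} {C δ : ℝ}
    (h : JetField A dist z P F k C δ) (i₀ : Fin (m + 1)) {C' δ' : ℝ} (hC' : 0 ≤ C') (hδ' : 0 < δ')
    (hsurj : ∀ x ∈ A, ∀ y : Fin (m + 1) → ℝ,
      ∃ v, ∀ i ∈ Finset.univ.erase i₀, polyDeriv (P x i) (z x) v = y i)
    (hctl : ∀ x ∈ A, ∀ y ∈ A, 0 < dist x y → dist x y ≤ δ' → (∀ i, |F x i - F y i| ≤ δ') →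
      ∀ i, |F x i - F y i| ≤
        C' * (dist x y ^ k + ∑ j ∈ Finset.univ.erase i₀, |F x j - F y j|)) :
    volume (F '' A) = 0 := by
  rw [← imageOuter_apply]
  let T : X → (Fin d → ℝ) →ₗ[ℝ] (Fin m → ℝ) := fun x =>
    LinearMap.pi fun j => (polyDeriv (P x (i₀.succAbove j)) (z x)).toLinearMap
  refine measure_null_of_forall_exists _ (fun x (q : ℕ × ℕ) => ∀ v, ‖v‖ ≤
    q.2 * (‖TopologicalSpace.denseSeq ((Fin d → ℝ) →L[ℝ] (Fin k → ℝ)) q.1 v‖ + ‖T x v‖))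
    (fun x hx => ?_) fun ⟨a, N⟩ => ?_
  · obtain ⟨a, N, h1⟩ := exists_denseSeq_complement (k := k) (by simpa using hmk) (T x) (fun y => by
      obtain ⟨v, hv⟩ := hsurj x hx (i₀.insertNth (α := fun _ => ℝ) 0 y)
      refine ⟨v, funext fun j => ?_⟩
      have := hv (i₀.succAbove j) (by simp [Fin.succAbove_ne])
      simpa [T] using this)
    exact ⟨(a, N), h1⟩
  set L := TopologicalSpace.denseSeq ((Fin d → ℝ) →L[ℝ] (Fin k → ℝ)) a
  set ε : ℝ := 1 / (2 * (c * N + 1)) with hε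
  have hε0 : 0 < ε := by positivity
  refine (h.subset fun x hx => hx.1).measure_null_of_polyDeriv _ hk hε0 fun B₁ hB₁ η₁ hη₁ h1 => ?_
  refine (h.subset fun x hx => (hB₁ hx).1).measure_null_of_lipschitz _ (by omega)
    fun B₂ hB₂ K η₂ hK hη₂ h2 => ?_
  set η : ℝ := min (min η₁ η₂) (min δ' (δ' / (K + 1))) with hη
  have hη0 : 0 < η := lt_min (lt_min hη₁ hη₂) (lt_min hδ' (by positivity))
  refine measure_null_of_dist_le _ hη0 fun B₃ hB₃ h3 => ?_
  rw [imageOuter_apply]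
  have hLip : ∀ x ∈ B₃, ∀ y ∈ B₃, ∀ i, |F x i - F y i| ≤ K * dist x y := fun x hx y hy i =>
    h2 x (hB₃ hx) y (hB₃ hy) ((h3 x hx y hy).trans ((min_le_left _ _).trans (min_le_right _ _))) i
  have hKη : ∀ x ∈ B₃, ∀ y ∈ B₃, K * dist x y ≤ δ' := fun x hx y hy => by
    have := (h3 x hx y hy).trans ((min_le_right _ _).trans (min_le_right _ _))
    calc K * dist x y ≤ (K + 1) * (δ' / (K + 1)) := by gcongr; linarith
      _ = δ' := by field_simp
  have hdist : ∀ x ∈ B₃, ∀ y ∈ B₃, dist x y ≤ 2 * c * N * (‖L (z x) - L (z y)‖ +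
      ∑ j, |F x (i₀.succAbove j) - F y (i₀.succAbove j)|) := by
    intro x hx y hy
    have h4 := h1 x (hB₂ (hB₃ hx)) y (hB₂ (hB₃ hy))
      ((h3 x hx y hy).trans ((min_le_left _ _).trans (min_le_left _ _)))
    have h5 : ‖T x (z x - z y)‖ ≤
        ∑ j, |F x (i₀.succAbove j) - F y (i₀.succAbove j)| + ε * dist x y := by
      refine (pi_norm_le_iff_of_nonneg (by positivity)).2 fun j => (h4 (i₀.succAbove j)).trans ?_
      gcongr
      exact Finset.single_le_sum (f := fun j => |F x (i₀.succAbove j) - F y (i₀.succAbove j)|)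
        (fun _ _ => abs_nonneg _) (Finset.mem_univ j)
    have h6 := (hB₁ (hB₂ (hB₃ hx))).2 (z x - z y)
    rw [map_sub] at h6
    have h7 : c * N * (ε * dist x y) ≤ dist x y / 2 := by
      have : c * N / (c * N + 1) ≤ 1 := by rw [div_le_one (by positivity)]; linarith
      calc _ = (c * N / (c * N + 1)) * (dist x y / 2) := by rw [hε]; field_simp
        _ ≤ 1 * (dist x y / 2) := by gcongr
        _ = _ := one_mul _
    have h8 : dist x y ≤ c * (N * (‖L (z x) - L (z y)‖ +
        (∑ j, |F x (i₀.succAbove j) - F y (i₀.succAbove j)| + ε * dist x y))) :=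
      (hz x y).trans (mul_le_mul_of_nonneg_left (h6.trans (by gcongr)) hc)
    linarith
  refine volume_image_eq_zero_of_slices hk i₀ (L := fun x => L (z x))
    (C := C' * ((2 * c * N) ^ k + 1)) (isBounded_image_of_dist_le (M := δ') fun x hx y hy => ?_)
    (isBounded_image_of_dist_le (M := ‖L‖ * η) fun x hx y hy => ?_) fun x hx y hy => ?_
  · exact (pi_norm_le_iff_of_nonneg hδ'.le).2 fun i =>
      (hLip x hx y hy i).trans (hKη x hx y hy)
  · rw [← map_sub]
    refine L.le_of_opNorm_le_of_le le_rfl ((h.near x ?_ y ?_).trans (h3 x hx y hy))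
    · exact (hB₁ (hB₂ (hB₃ hx))).1
    · exact (hB₁ (hB₂ (hB₃ hy))).1
  · set D₁ := ∑ j, |F x (i₀.succAbove j) - F y (i₀.succAbove j)| with hS
    have hS0 : 0 ≤ D₁ := by positivity
    rcases eq_or_ne x y with rfl | hne
    · simp only [sub_self, abs_zero]
      positivity
    have h4 := hctl x (hB₁ (hB₂ (hB₃ hx))).1 y (hB₁ (hB₂ (hB₃ hy))).1 (dist_pos.2 hne)
      ((h3 x hx y hy).trans ((min_le_right _ _).trans (min_le_left _ _)))
      (fun i => (hLip x hx y hy i).trans (hKη x hx y hy)) i₀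
    rw [sum_erase_eq_sum_succAbove i₀ fun j => |F x j - F y j|] at h4
    have h5 : dist x y ^ k ≤ (2 * c * N) ^ k * (‖L (z x) - L (z y)‖ + D₁) ^ k := by
      rw [← mul_pow]
      exact pow_le_pow_left₀ dist_nonneg (hdist x hx y hy) k
    refine h4.trans ?_
    rw [mul_assoc]
    refine mul_le_mul_of_nonneg_left ?_ hC'
    have h6 : 0 ≤ (‖L (z x) - L (z y)‖ + D₁) ^ k := by positivity
    have h7 : 0 ≤ (2 * c * N) ^ k * D₁ := by positivity
    calc _ ≤ (2 * c * N) ^ k * (‖L (z x) - L (z y)‖ + D₁) ^ k + D₁ := by gcongr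
      _ ≤ _ := by linarith

theorem JetField.volume_image_eq_zero_of_hausdorff {X : Type*} [MetricSpace X] [MeasurableSpace X]
    [BorelSpace X] [TopologicalSpace.SeparableSpace X] {d m k : ℕ} (hm : 0 < m) (hk : 1 ≤ k)
    {A : Set X} {z : X → Fin d → ℝ}
    {P : X → Fin m → MvPolynomial (Fin d) ℝ} {F : X → Fin m → ℝ} {C δ : ℝ}
    (h : JetField A dist z P F k C δ) (I : Finset (Fin m)) {C' δ' : ℝ}
    (hδ' : 0 < δ')
    (hctl : ∀ x ∈ A, ∀ y ∈ A, 0 < dist x y → dist x y ≤ δ' → (∀ i, |F x i - F y i| ≤ δ') →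
      ∀ i, |F x i - F y i| ≤ C' * (dist x y ^ k + ∑ j ∈ I, |F x j - F y j|))
    (hA : μH[((I.card + k * (m - I.card) : ℕ) : ℝ)] A = 0) :
    volume (F '' A) = 0 := by
  rw [← imageOuter_apply]
  refine h.measure_null_of_lipschitz _ hk fun B hB K η hK hη h1 => ?_
  have hηδ : 0 < min η (min δ' (δ' / (K + 1))) := lt_min hη (lt_min hδ' (by positivity))
  refine volume_image_eq_zero_of_controlled hm hk I (C := max K C') (le_max_of_le_left hK) hηδ
    (fun x hx y hy hxy i => ?_) (fun x hx y hy hxy i => ?_) (measure_mono_null hB hA)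
  · refine (h1 x hx y hy (hxy.trans (min_le_left _ _)) i).trans ?_
    gcongr
    exact le_max_left _ _
  · rcases eq_or_ne x y with rfl | hne
    · simp only [sub_self, abs_zero]
      have : 0 ≤ max K C' := le_max_of_le_left hK
      positivity
    have h2 : K * dist x y ≤ δ' := by
      have := hxy.trans ((min_le_right _ _).trans (min_le_right _ _))
      calc K * dist x y ≤ (K + 1) * (δ' / (K + 1)) := by gcongr; linarith
        _ = δ' := by field_simp
    refine (hctl x (hB hx) y (hB hy) (dist_pos.2 hne)
      (hxy.trans ((min_le_right _ _).trans (min_le_left _ _)))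
      (fun i => (h1 x hx y hy (hxy.trans (min_le_left _ _)) i).trans h2) i).trans ?_
    gcongr
    exact le_max_right _ _

theorem polyDeriv_taylorMv_zero {n m : ℕ} (f : Ec n → Ec m)
    (p : Ec n → FormalMultilinearSeries ℝ (Ec n) (Ec m)) (x : Ec n) (z : Fin n → ℝ) (i : Fin m) :
    polyDeriv (taylorMv f p 0 x i) z = 0 := by
  have h1 := hasFDerivAt_eval (taylorMv f p 0 x i) z
  have h2 : (fun v => MvPolynomial.eval v (taylorMv f p 0 x i)) = fun _ => f x i := by
    funext v
    have := eval_taylorMv f p 0 x (WithLp.toLp 2 v) i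
    simpa [taylorPoly] using this
  rw [h2] at h1
  exact h1.unique (hasFDerivAt_const _ _)

/-- A full set of components cannot have independent derivatives at a critical point. -/
theorem card_lt_of_polyDeriv_taylorMv {n m k : ℕ} (hm : 0 < m) (f : Ec n → Ec m)
    (p : Ec n → FormalMultilinearSeries ℝ (Ec n) (Ec m)) {x : Ec n}
    (hx : ¬ Function.Surjective fun v : Ec n => p x 1 (fun _ => v)) {I : Finset (Fin m)}
    (h : ∀ y : Fin m → ℝ, ∃ v, ∀ i ∈ I, polyDeriv (taylorMv f p k x i) x.ofLp v = y i) :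
    I.card < m := by
  by_contra! hI
  have hI' : I = Finset.univ := Finset.eq_univ_of_card I
    (le_antisymm (Finset.card_le_univ I) (by simpa using hI))
  subst hI'
  rcases Nat.eq_zero_or_pos k with rfl | hk
  · obtain ⟨v, hv⟩ := h 1
    have := hv ⟨0, hm⟩ (Finset.mem_univ _)
    rw [polyDeriv_taylorMv_zero] at this
    simp at this
  · refine hx fun w => ?_
    obtain ⟨v, hv⟩ := h w.ofLp
    refine ⟨WithLp.toLp 2 v, ?_⟩
    ext i
    rw [← hv i (Finset.mem_univ _)]
    exact (polyDeriv_taylorMv f p hk x (WithLp.toLp 2 v) i).symm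

theorem volume_image_eq_zero_of_isControlled {n m k : ℕ} (hm : 0 < m) (hk : 1 ≤ k) (f : Ec n → Ec m)
    (p : Ec n → FormalMultilinearSeries ℝ (Ec n) (Ec m)) {A : Set (Ec n)}
    (hA : ∀ x ∈ A, ∃ lam : ℝ,
      apSmall x {y | y ≠ x ∧ lam * ‖y - x‖ ^ k ≤ ‖f y - taylorPoly f p (k - 1) x y‖})
    (hcrit : ∀ x ∈ A, ¬ Function.Surjective fun v : Ec n => p x 1 (fun _ => v))
    (h : ∀ B ⊆ A, ∀ (C δ : ℝ) (I : Finset (Fin m)) (C' δ' : ℝ),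
      JetField B dist (fun x => x.ofLp) (taylorMv f p (k - 1)) (fun x => (f x).ofLp) k C δ →
      0 ≤ C' → 0 < δ' → I.card < m →
      (∀ x ∈ B, ∀ y : Fin m → ℝ,
        ∃ v, ∀ i ∈ I, polyDeriv (taylorMv f p (k - 1) x i) x.ofLp v = y i) →
      (∀ x ∈ B, ∀ y ∈ B, 0 < dist x y → dist x y ≤ δ' → (∀ i, |f x i - f y i| ≤ δ') →
        ∀ i, |f x i - f y i| ≤ C' * (dist x y ^ k + ∑ j ∈ I, |f x j - f y j|)) →
      volume ((fun x => (f x).ofLp) '' B) = 0) :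
    volume ((fun x => (f x).ofLp) '' A) = 0 := by
  rw [← imageOuter_apply]
  refine measure_null_of_jetField f p _ A hA fun B₁ hB₁ C δ hJ => ?_
  refine measure_null_of_isControlled _ hk _ _ _ _ _ _ _ _ hJ ?_
  rintro B hB ⟨I, C', δ', hC', hδ', h1, h2⟩
  rcases B.eq_empty_or_nonempty with rfl | ⟨x, hx⟩
  · exact measure_empty
  exact h B (hB.trans hB₁) C δ I C' δ' (hJ.subset hB) hC' hδ'
    (card_lt_of_polyDeriv_taylorMv hm f p (hcrit x (hB₁ (hB hx))) (h1 x hx)) h1 h2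

theorem volume_image_eq_zero_of_hausdorff {n m k : ℕ} (hm : 0 < m) (hk : 1 ≤ k) (f : Ec n → Ec m)
    (p : Ec n → FormalMultilinearSeries ℝ (Ec n) (Ec m)) {A : Set (Ec n)}
    (hA : ∀ x ∈ A, ∃ lam : ℝ,
      apSmall x {y | y ≠ x ∧ lam * ‖y - x‖ ^ k ≤ ‖f y - taylorPoly f p (k - 1) x y‖})
    (hcrit : ∀ x ∈ A, ¬ Function.Surjective fun v : Ec n => p x 1 (fun _ => v))
    (hμ : μH[(k : ℝ) + m - 1] A = 0) :
    volume ((fun x => (f x).ofLp) '' A) = 0 := by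
  refine volume_image_eq_zero_of_isControlled hm hk f p hA hcrit
    fun B hB C δ I C' δ' hJ hC' hδ' hI _ hctl => ?_
  refine hJ.volume_image_eq_zero_of_hausdorff hm hk I hδ' hctl
    (measure_mono_null hB (le_antisymm ((Measure.hausdorffMeasure_mono ?_ A).trans hμ.le) zero_le))
  obtain ⟨c, hc⟩ := Nat.exists_eq_add_of_lt hI
  obtain ⟨l, rfl⟩ := Nat.exists_eq_add_of_le hk
  rw [show m - I.card = c + 1 by omega]
  have hc' : (m : ℝ) = I.card + c + 1 := by exact_mod_cast hc
  push_cast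
  have : (0 : ℝ) ≤ l * c := by positivity
  nlinarith

theorem volume_image_eq_zero_of_dimension_lt {n m k : ℕ} (hm : 0 < m) (hk : 2 ≤ k)
    (hnk : n + 1 ≤ m + k) (f : Ec n → Ec m)
    (p : Ec n → FormalMultilinearSeries ℝ (Ec n) (Ec m)) {A : Set (Ec n)}
    (hA : ∀ x ∈ A, ∃ lam : ℝ,
      apSmall x {y | y ≠ x ∧ lam * ‖y - x‖ ^ k ≤ ‖f y - taylorPoly f p (k - 1) x y‖})
    (hcrit : ∀ x ∈ A, ¬ Function.Surjective fun v : Ec n => p x 1 (fun _ => v)) :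
    volume ((fun x => (f x).ofLp) '' A) = 0 := by
  refine volume_image_eq_zero_of_isControlled hm (by omega) f p hA hcrit
    fun B hB C δ I C' δ' hJ hC' hδ' hI hsurj hctl => ?_
  rcases lt_or_ge n (I.card + k * (m - I.card)) with hs | hs
  · refine hJ.volume_image_eq_zero_of_hausdorff hm (by omega) I hδ' hctl
      (measure_mono_null (subset_univ B) ?_)
    have h1 : dimH (univ : Set (Ec n)) < ((I.card + k * (m - I.card) : ℕ) : NNReal) := by
      rw [Real.dimH_univ_eq_finrank, finrank_euclideanSpace_fin]
      exact_mod_cast hs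
    have h2 := hausdorffMeasure_of_dimH_lt h1
    rwa [NNReal.coe_natCast] at h2
  · have hI' : I.card + 1 = m ∧ I.card + k = n := by
      obtain ⟨c, hc⟩ := Nat.exists_eq_add_of_lt hI
      obtain ⟨l, rfl⟩ := Nat.exists_eq_add_of_le hk
      rw [show m - I.card = c + 1 by omega] at hs
      have h1 : (2 + l) * (c + 1) = 2 + l + (1 + l) * c + c := by ring
      have h2 : c ≤ (1 + l) * c := Nat.le_mul_of_pos_left _ (by omega)
      omega
    obtain ⟨m, rfl⟩ := Nat.exists_eq_add_of_le' hm
    obtain ⟨i₀, hi₀⟩ := Finset.card_eq_one.1 (show (Iᶜ).card = 1 by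
      rw [Finset.card_compl, Fintype.card_fin]; omega)
    have hI₀ : I = Finset.univ.erase i₀ := by
      rw [← compl_compl I, hi₀]
      ext j
      simp
    have hcard : I.card = m := by omega
    subst hI₀
    obtain ⟨c, hz⟩ : ∃ c : NNReal, AntilipschitzWith c (WithLp.ofLp : Ec n → Fin n → ℝ) :=
      ⟨_, PiLp.antilipschitzWith_ofLp 2 _⟩
    refine hJ.volume_image_eq_zero_of_corank_one hk (by omega) c.2
      (fun x y => ?_) i₀ hC' hδ' hsurj hctl
    rw [← dist_eq_norm]
    exact hz.le_mul_dist x y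

theorem volume_image_ofLp {n m : ℕ} (f : Ec n → Ec m) (A : Set (Ec n))
    (h : volume ((fun x => (f x).ofLp) '' A) = 0) : volume (f '' A) = 0 := by
  have h1 := (EuclideanSpace.volume_preserving_symm_measurableEquiv_toLp
    (Fin m)).measure_preimage_equiv ((fun x => (f x).ofLp) '' A)
  rw [h] at h1
  refine measure_mono_null ?_ h1
  rintro _ ⟨x, hx, rfl⟩
  exact ⟨x, hx, rfl⟩

/-- Morse–Sard theorem for approximately differentiable functions with
`H^{i+m-1}`-null exceptional sets. -/
theorem morse_sard_approx {n m : ℕ} (hm : 0 < m) (hmn : m ≤ n)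
    (f : Ec n → Ec m)
    (p : Ec n → FormalMultilinearSeries ℝ (Ec n) (Ec m))
    (N₀ : Set (Ec n)) (hN₀ : N₀.Countable)
    -- (a)
    (ha : ∀ x ∉ N₀, ∃ lam : ℝ,
      apSmall x {y | y ≠ x ∧ lam * ‖y - x‖ ≤ ‖f y - f x‖})
    -- (b)
    (hb : μH[(m : ℝ)] {x : Ec n | ¬ ∃ lam : ℝ,
      apSmall x {y | y ≠ x ∧ lam * ‖y - x‖ ^ 2 ≤ ‖f y - taylorPoly f p 1 x y‖}} = 0)
    -- (c)
    (hc : ∀ i : ℕ, 2 ≤ i → i ≤ n - m →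
      μH[(i : ℝ) + m - 1] {x : Ec n | ¬ ∃ lam : ℝ,
        apSmall x {y | y ≠ x ∧
          lam * ‖y - x‖ ^ (i + 1) ≤ ‖f y - taylorPoly f p i x y‖}} = 0) :
    volume (f '' approxCrit f p) = 0 := by
  set G : ℕ → Set (Ec n) := fun i => {x | ∃ lam : ℝ, apSmall x {y | y ≠ x ∧
    lam * ‖y - x‖ ^ (i + 1) ≤ ‖f y - taylorPoly f p i x y‖}} with hG
  set K := max (n - m) 1 with hK
  have hnull : ∀ i, 1 ≤ i → i ≤ K → μH[(i : ℝ) + m - 1] (G i)ᶜ = 0 := by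
    intro i hi1 hiK
    rcases hi1.eq_or_lt with rfl | hi2
    · rw [Nat.cast_one, add_sub_cancel_left]
      exact hb
    · exact hc i hi2 (by omega)
  have h0 : ∀ x ∉ N₀, x ∈ G 0 := by
    intro x hx
    simpa [hG, taylorPoly] using ha x hx
  refine volume_image_ofLp f _ ?_
  rw [← imageOuter_apply]
  refine measure_mono_null (t := N₀ ∪ approxCrit f p \ N₀) (by
    rw [union_sdiff_self]; exact subset_union_right) (measure_union_null ?_ ?_)
  · have : Nonempty (Fin m) := ⟨⟨0, hm⟩⟩
    exact (hN₀.image _).measure_zero volume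
  refine measure_null_of_forall_exists _ (fun x i =>
    (i < K ∧ x ∈ G i \ G (i + 1)) ∨ (i = K ∧ x ∈ G K)) (fun x hx => ?_) fun i => ?_
  · by_cases hxK : x ∈ G K
    · exact ⟨K, Or.inr ⟨rfl, hxK⟩⟩
    · by_contra! h
      have h2 : ∀ i ≤ K, x ∈ G i := by
        intro i
        induction i with
        | zero => exact fun _ => h0 x hx.2
        | succ i ih =>
          intro hi
          by_contra h3
          exact (h i).1 (by omega) ⟨ih (by omega), h3⟩
      exact hxK (h2 K le_rfl)
  · rcases lt_or_ge i K with hi | hi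
    · refine volume_image_eq_zero_of_hausdorff (k := i + 1) hm (by omega) f p ?_
        (fun x hx => hx.1.1.2) (measure_mono_null ?_ (hnull (i + 1) (by omega) hi))
      · rintro x ⟨-, ⟨-, hx⟩ | ⟨hx, -⟩⟩
        · exact hx.1
        · omega
      · rintro x ⟨-, ⟨-, hx⟩ | ⟨hx, -⟩⟩
        · exact hx.2
        · omega
    · refine volume_image_eq_zero_of_dimension_lt (k := K + 1) hm (by omega) (by omega) f p ?_
        (fun x hx => hx.1.1.2)
      rintro x ⟨-, ⟨hx, -⟩ | ⟨-, hx⟩⟩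
      · omega
      · exact hx

end
end

section
/- Let n > m and f: ℝⁿ → ℝᵐ be locally Lipschitz. Suppose that for each i = 2, …, n-m+1, f has the Luzin property of order i with respect to the Hausdorff measure H^{i+m-2}: for every ε > 0 there exists g ∈ C^i(ℝⁿ;ℝᵐ) with H^{i+m-2}({x : f(x) ≠ g(x)}) < ε. Then Lᵐ(f(C_f)) = 0, where C_f is the set of points where the (a.e. existing) derivative of f has rank < m. -/
open MeasureTheory Metric Filter Set

noncomputable section

open scoped Topology NNReal ENNReal

lemma compl_mem_of_forall_exists_nhds {X : Type*} [TopologicalSpace X]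
    [SecondCountableTopology X] {l : Filter X} [CountableInterFilter l] {A : Set X}
    (h : ∀ x ∈ A, ∃ O ∈ 𝓝 x, (A ∩ O)ᶜ ∈ l) : Aᶜ ∈ l := by
  choose! O hO hl using h
  obtain ⟨t, htA, htc, hcov⟩ := TopologicalSpace.countable_cover_nhdsWithin
    (f := O) (s := A) fun x hx ↦ mem_nhdsWithin_of_mem_nhds (hO x hx)
  filter_upwards [(countable_bInter_mem htc).2 fun x hx ↦ hl x (htA hx)] with y hy hyA
  obtain ⟨x, hx, hyx⟩ := mem_iUnion₂.1 (hcov hyA)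
  exact mem_iInter₂.1 hy x hx ⟨hyA, hyx⟩

lemma exists_equiv_prod_fst_eq {E : Type*} [NormedAddCommGroup E] [NormedSpace ℝ E]
    [FiniteDimensional ℝ E] {d : ℕ} (hd : Module.finrank ℝ E = d + 1) {ℓ : E →L[ℝ] ℝ}
    (hℓ : ℓ ≠ 0) : ∃ T : E ≃L[ℝ] ℝ × Ec d, ∀ x, (T x).1 = ℓ x := by
  obtain ⟨u, hu⟩ : ∃ u, ℓ u ≠ 0 := by
    by_contra! h
    exact hℓ (ContinuousLinearMap.ext h)
  let σ : ℝ →L[ℝ] E := (ContinuousLinearMap.id ℝ ℝ).smulRight ((ℓ u)⁻¹ • u)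
  have hσ : Function.RightInverse σ ℓ := fun t ↦ by simp [σ, hu]
  let T₀ := ContinuousLinearEquiv.equivOfRightInverse ℓ σ hσ
  have hfin : Module.finrank ℝ ℓ.ker = Module.finrank ℝ (Ec d) := by
    have := T₀.toLinearEquiv.finrank_eq
    rw [hd, Module.finrank_prod, Module.finrank_self] at this
    rw [finrank_euclideanSpace_fin]
    omega
  let j : ℓ.ker ≃L[ℝ] Ec d := ContinuousLinearEquiv.ofFinrankEq hfin
  refine ⟨T₀.trans ((ContinuousLinearEquiv.refl ℝ ℝ).prodCongr j), fun x ↦ ?_⟩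
  simp [T₀]

lemma exists_straightening {d k : ℕ} {w : Ec (d + 1) → ℝ} {x : Ec (d + 1)}
    (hw : ContDiffAt ℝ (k + 1 : ℕ) w x) (hx : fderiv ℝ w x ≠ 0) :
    ∃ (Ψ : ℝ × Ec d → Ec (d + 1)) (W : Set (ℝ × Ec d)), Ψ '' W ∈ 𝓝 x ∧
      ∀ p ∈ W, ContDiffAt ℝ (k + 1 : ℕ) Ψ p ∧ ∀ᶠ q in 𝓝 p, w (Ψ q) = q.1 := by
  obtain ⟨T, hT⟩ := exists_equiv_prod_fst_eq (d := d) (by simp) hx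
  let Φ : Ec (d + 1) → ℝ × Ec d := fun y ↦ (w y, (T y).2)
  have hsnd : ContDiff ℝ (k + 1 : ℕ) fun y ↦ (T y).2 := contDiff_snd.comp T.contDiff
  have hΦ : ContDiffAt ℝ (k + 1 : ℕ) Φ x := hw.prodMk hsnd.contDiffAt
  have hk : ((k + 1 : ℕ) : WithTop ℕ∞) ≠ 0 := by exact_mod_cast Nat.succ_ne_zero k
  have hΦ' : HasFDerivAt Φ (T : Ec (d + 1) →L[ℝ] ℝ × Ec d) x := by
    have h := (hw.differentiableAt hk).hasFDerivAt.prodMk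
      ((ContinuousLinearMap.snd ℝ ℝ (Ec d)).comp (T : Ec (d + 1) →L[ℝ] ℝ × Ec d)).hasFDerivAt
        (x := x)
    convert! h using 1
    ext y
    all_goals simp [hT]
  let e := hΦ.toOpenPartialHomeomorph Φ hΦ' hk
  have hxs : x ∈ e.source := hΦ.mem_toOpenPartialHomeomorph_source hΦ' hk
  have hsymm : ContDiffAt ℝ (k + 1 : ℕ) e.symm (e x) :=
    e.contDiffAt_symm (e.map_source hxs) (by rw [e.left_inv hxs]; exact hΦ')
      (by rw [e.left_inv hxs]; exact hΦ)
  have hev : ∀ᶠ p in 𝓝 (e x), ContDiffAt ℝ (k + 1 : ℕ) e.symm p :=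
    hsymm.eventually (by simp)
  refine ⟨e.symm, {p | ContDiffAt ℝ (k + 1 : ℕ) e.symm p} ∩ e.target, ?_, ?_⟩
  · filter_upwards [(e.continuousAt hxs).eventually hev, e.open_source.mem_nhds hxs]
      with y hy hys
    exact ⟨e y, ⟨hy, e.map_source hys⟩, e.left_inv hys⟩
  · rintro p ⟨hp, hpt⟩
    refine ⟨hp, ?_⟩
    filter_upwards [e.open_target.mem_nhds hpt] with q hq
    exact congrArg Prod.fst (e.right_inv hq)

lemma isLittleO_comp_sub_of_fderiv {E F G : Type*} [NormedAddCommGroup E] [NormedSpace ℝ E]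
    [NormedAddCommGroup F] [NormedSpace ℝ F] [NormedAddCommGroup G] [NormedSpace ℝ G]
    {g : F → G} {ψ : E → F} {s : E} {k : ℕ} (hψ : ContDiffAt ℝ 1 ψ s)
    (hg : ContDiffAt ℝ 1 g (ψ s))
    (h : (fun y ↦ fderiv ℝ g (ψ y)) =o[𝓝 s] fun y ↦ ‖y - s‖ ^ k) :
    (fun y ↦ g (ψ y) - g (ψ s)) =o[𝓝 s] fun y ↦ ‖y - s‖ ^ (k + 1) := by
  have hev : ∀ᶠ y in 𝓝 s, DifferentiableAt ℝ ψ y ∧ DifferentiableAt ℝ g (ψ y) := by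
    filter_upwards [hψ.eventually (by simp), hψ.continuousAt.eventually (hg.eventually (by simp))]
      with y h₁ h₂ using ⟨h₁.differentiableAt one_ne_zero, h₂.differentiableAt one_ne_zero⟩
  obtain ⟨r, hr, hball⟩ := Metric.eventually_nhds_iff_ball.1 hev
  have hs : s ∈ ball s r := mem_ball_self hr
  have hnhds : 𝓝[ball s r] s = 𝓝 s := isOpen_ball.nhdsWithin_eq hs
  have hbound : (fun y ↦ fderiv ℝ ψ y) =O[𝓝 s] fun _ ↦ (1 : ℝ) :=
    (hψ.fderiv_right (m := 0) (by simp)).continuousAt.isBigO_one ℝ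
  have hcomp : (fun y ↦ (fderiv ℝ g (ψ y)).comp (fderiv ℝ ψ y)) =o[𝓝 s]
      fun y ↦ ‖y - s‖ ^ k := by
    have := h.norm_left.mul_isBigO hbound.norm_left
    simp only [mul_one] at this
    refine Asymptotics.IsBigO.trans_isLittleO (.of_norm_le fun y ↦ ?_) this
    exact ContinuousLinearMap.opNorm_comp_le _ _
  have := (convex_ball s r).isLittleO_pow_succ (f := fun y ↦ g (ψ y)) hs
    (fun y hy ↦ ((hball y hy).2.hasFDerivAt.comp y
      (hball y hy).1.hasFDerivAt).hasFDerivWithinAt) (hnhds ▸ hcomp)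
  rwa [hnhds] at this

lemma volume_image_eq_zero_of_isLittleO {d M k : ℕ} (hk : 0 < k) (hM : 0 < M)
    (hd : d ≤ k * M) {H : Ec d → Ec M} {S : Set (Ec d)}
    (h : ∀ s ∈ S, (fun y ↦ H y - H s) =o[𝓝 s] fun y ↦ ‖y - s‖ ^ k) :
    volume (H '' S) = 0 := by
  have hac : (volume : Measure (Ec M)) ≪ μH[M] := Measure.absolutelyContinuous_isAddHaarMeasure _ _
  refine hac ?_
  have hS : S = ⋃ R : ℕ, S ∩ ball 0 R := by rw [← inter_iUnion, iUnion_ball_nat, inter_univ]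
  rw [hS, image_iUnion, measure_iUnion_null_iff]
  intro R
  set c : ℝ≥0∞ := μH[d] (ball (0 : Ec d) R) with hc
  have hcfin : c ≠ ⊤ := measure_ball_lt_top.ne
  have key : ∀ ε : ℝ≥0, 0 < ε → ε ≤ 1 → μH[M] (H '' (S ∩ ball 0 R)) ≤ (ε : ℝ≥0∞) * c := by
    intro ε hε hε1
    let T : ℕ → Set (Ec d) := fun j ↦ {s ∈ S ∩ ball 0 R |
      ∀ y, dist y s ≤ 1 / (j + 1 : ℝ) → ‖H y - H s‖ ≤ ε * ‖y - s‖ ^ k}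
    have hTmono : Monotone T := fun i j hij s hs ↦
      ⟨hs.1, fun y hy ↦ hs.2 y (hy.trans (Nat.one_div_le_one_div hij))⟩
    have hTU : S ∩ ball 0 R = ⋃ j, T j := by
      refine Subset.antisymm (fun s hs ↦ ?_) (iUnion_subset fun j s hs ↦ hs.1)
      obtain ⟨r, hr, hball⟩ := Metric.eventually_nhds_iff.1
        ((Asymptotics.isLittleO_iff.1 (h s hs.1)) (c := ε) (by exact_mod_cast hε))
      obtain ⟨j, hj⟩ := exists_nat_one_div_lt hr
      refine mem_iUnion.2 ⟨j, hs, fun y hy ↦ ?_⟩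
      simpa using hball (hy.trans_lt hj)
    rw [hTU, image_iUnion, Monotone.measure_iUnion fun i j hij ↦ image_mono (hTmono hij)]
    refine iSup_le fun j ↦ ?_
    obtain ⟨P, hPm, hPb, hPd, hPu, hPdisj⟩ :=
      SeparableSpace.exists_measurable_partition_diam_le (Ec d)
        (Nat.one_div_pos_of_nat (α := ℝ) (n := j))
    have hpiece : ∀ i, μH[M] (H '' (T j ∩ P i)) ≤ (ε : ℝ≥0∞) * μH[d] (ball 0 R ∩ P i) := by
      intro i
      have hholder : HolderOnWith ε k H (T j ∩ P i) := by
        intro x hx y hy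
        have hxy : dist x y ≤ 1 / (j + 1 : ℝ) :=
          (dist_le_diam_of_mem (hPb i) hx.2 hy.2).trans (hPd i)
        have := hy.1.2 x hxy
        rw [← dist_eq_norm, ← dist_eq_norm] at this
        rw [edist_nndist, edist_nndist, NNReal.coe_natCast, ENNReal.rpow_natCast]
        exact_mod_cast this
      calc μH[M] (H '' (T j ∩ P i))
          ≤ (ε : ℝ≥0∞) ^ (M : ℝ) * μH[(k : ℝ≥0) * (M : ℝ)] (T j ∩ P i) :=
            hholder.hausdorffMeasure_image_le (by exact_mod_cast hk) (by positivity)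
        _ ≤ (ε : ℝ≥0∞) * μH[d] (ball 0 R ∩ P i) := by
            gcongr ?_ * ?_
            · rw [ENNReal.rpow_natCast]
              exact pow_le_of_le_one zero_le (by exact_mod_cast hε1) hM.ne'
            · refine (Measure.hausdorffMeasure_mono (d₁ := d)
                (by push_cast; exact_mod_cast hd) _).trans ?_
              exact measure_mono (inter_subset_inter_left _ fun s hs ↦ hs.1.2)
    calc μH[M] (H '' T j)
        = μH[M] (⋃ i, H '' (T j ∩ P i)) := by
          rw [← image_iUnion, ← inter_iUnion, hPu, inter_univ]
      _ ≤ ∑' i, (ε : ℝ≥0∞) * μH[d] (ball 0 R ∩ P i) :=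
          (measure_iUnion_le _).trans (ENNReal.tsum_le_tsum hpiece)
      _ = (ε : ℝ≥0∞) * c := by
          rw [ENNReal.tsum_mul_left, ← measure_iUnion
            (fun a b hab ↦ (hPdisj hab).mono inter_subset_right inter_subset_right)
            (fun i ↦ measurableSet_ball.inter (hPm i)), ← inter_iUnion, hPu, inter_univ]
  by_contra hne
  obtain ⟨ε, hε, hlt⟩ := ENNReal.exists_nnreal_pos_mul_lt hcfin hne
  refine absurd ((key (min ε 1) (by positivity) (min_le_right _ _)).trans ?_) hlt.not_ge
  gcongr
  exact min_le_left _ _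

/-- `B ⊆ A` is the image of a set `S` under a map which is `C¹` on `S`, such that every function
which is `C^k` at the points of `A` and vanishes on `A` pulls back to a function which is
`o(‖y - s‖ ^ k)` at each `s ∈ S`. -/
def IsFlatPiece {N : ℕ} (k : ℕ) (A B : Set (Ec N)) : Prop :=
  B ⊆ A ∧ ∃ d ≤ N, ∃ (ψ : Ec d → Ec N) (S : Set (Ec d)), ψ '' S = B ∧
    (∀ s ∈ S, ContDiffAt ℝ 1 ψ s) ∧
    ∀ (G : Type) [NormedAddCommGroup G] [NormedSpace ℝ G] (g : Ec N → G),
      (∀ x ∈ A, ContDiffAt ℝ k g x) → (∀ x ∈ A, g x = 0) →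
      ∀ s ∈ S, (fun y ↦ g (ψ y)) =o[𝓝 s] fun y ↦ ‖y - s‖ ^ k

lemma isFlatPiece_zero {N : ℕ} (A : Set (Ec N)) : IsFlatPiece 0 A A := by
  refine ⟨subset_rfl, N, le_rfl, id, A, image_id A, fun s _ ↦ contDiffAt_id,
    fun G _ _ g hg hg0 s hs ↦ ?_⟩
  simp only [pow_zero, Asymptotics.isLittleO_one_iff, id]
  simpa [hg0 s hs] using (hg s hs).continuousAt.tendsto

/-- The points of `A` at which every `C^(k+1)` function vanishing on `A` is critical. -/
def jointCritical {N : ℕ} (k : ℕ) (A : Set (Ec N)) : Set (Ec N) :=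
  {x ∈ A | ∀ g : Ec N → ℝ, (∀ y ∈ A, ContDiffAt ℝ (k + 1 : ℕ) g y) → (∀ y ∈ A, g y = 0) →
    fderiv ℝ g x = 0}

lemma fderiv_eq_zero_of_mem_jointCritical {N k : ℕ} {A : Set (Ec N)} {x : Ec N}
    (hx : x ∈ jointCritical k A) {G : Type*} [NormedAddCommGroup G] [NormedSpace ℝ G]
    {g : Ec N → G} (hg : ∀ y ∈ A, ContDiffAt ℝ (k + 1 : ℕ) g y) (hg0 : ∀ y ∈ A, g y = 0) :
    fderiv ℝ g x = 0 := by
  ext v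
  refine (SeparatingDual.eq_zero_iff_forall_dual_eq_zero (R := ℝ) _).2 fun ℓ ↦ ?_
  have hd : DifferentiableAt ℝ g x := (hg x hx.1).differentiableAt (by simp)
  have := hx.2 (ℓ ∘ g) (fun y hy ↦ ℓ.contDiff.contDiffAt.comp y (hg y hy))
    (fun y hy ↦ by simp [hg0 y hy])
  rw [(ℓ.hasFDerivAt.comp x hd.hasFDerivAt).fderiv] at this
  exact congrArg (fun L : Ec N →L[ℝ] ℝ ↦ L v) this

lemma IsFlatPiece.of_jointCritical {N k : ℕ} {A B : Set (Ec N)}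
    (h : IsFlatPiece k (jointCritical k A) B) : IsFlatPiece (k + 1) A B := by
  obtain ⟨hBA, d, hd, ψ, S, rfl, hψ, hflat⟩ := h
  refine ⟨hBA.trans fun x hx ↦ hx.1, d, hd, ψ, S, rfl, hψ, fun G _ _ g hg hg0 s hs ↦ ?_⟩
  have hs' : ψ s ∈ jointCritical k A := hBA (mem_image_of_mem ψ hs)
  have := hflat _ (fderiv ℝ g)
    (fun x hx ↦ (hg x hx.1).fderiv_right (by simp))
    (fun x hx ↦ fderiv_eq_zero_of_mem_jointCritical hx hg hg0) s hs
  simpa [hg0 _ hs'.1] using isLittleO_comp_sub_of_fderiv (hψ s hs)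
    ((hg _ hs'.1).of_le (by exact_mod_cast Nat.le_add_left 1 k)) this

lemma IsFlatPiece.image {N k : ℕ} {A : Set (Ec (N + 1))} {φ : Ec N → Ec (N + 1)}
    {V B : Set (Ec N)} (hφ : ∀ v ∈ V, ContDiffAt ℝ (k + 1 : ℕ) φ v) (hVA : MapsTo φ V A)
    (h : IsFlatPiece (k + 1) V B) : IsFlatPiece (k + 1) A (φ '' B) := by
  obtain ⟨hBV, d, hd, ψ, S, rfl, hψ, hflat⟩ := h
  have hS : ∀ s ∈ S, ψ s ∈ V := fun s hs ↦ hBV (mem_image_of_mem ψ hs)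
  refine ⟨(image_mono hBV).trans hVA.image_subset, d, hd.trans N.le_succ, φ ∘ ψ, S,
    image_comp φ ψ S, fun s hs ↦ ?_, fun G _ _ g hg hg0 ↦ ?_⟩
  · exact ((hφ _ (hS s hs)).of_le (by exact_mod_cast Nat.le_add_left 1 k)).comp s (hψ s hs)
  · exact hflat G (g ∘ φ) (fun v hv ↦ (hg _ (hVA hv)).comp v (hφ v hv))
      fun v hv ↦ hg0 _ (hVA hv)

/-- Every set is a countable union of flat pieces, phrased as an induction principle for
`σ`-ideals. -/
theorem compl_mem_of_forall_isFlatPiece (k : ℕ) : ∀ (N : ℕ) (A : Set (Ec N)) (l : Filter (Ec N))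
    [CountableInterFilter l], (∀ B, IsFlatPiece k A B → Bᶜ ∈ l) → Aᶜ ∈ l := by
  induction k with
  | zero => exact fun N A l _ h ↦ h A (isFlatPiece_zero A)
  | succ k ihk =>
    intro N
    induction N using Nat.strong_induction_on with
    | _ N ihN =>
    intro A l _ h
    have hcrit : (jointCritical k A)ᶜ ∈ l :=
      ihk N _ l fun B hB ↦ h B hB.of_jointCritical
    have hreg : (A \ jointCritical k A)ᶜ ∈ l := by
      refine compl_mem_of_forall_exists_nhds fun x hx ↦ ?_
      obtain ⟨g, hg, hg0, hgx⟩ : ∃ g : Ec N → ℝ, (∀ y ∈ A, ContDiffAt ℝ (k + 1 : ℕ) g y) ∧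
          (∀ y ∈ A, g y = 0) ∧ fderiv ℝ g x ≠ 0 := by
        by_contra! hcon
        exact hx.2 ⟨hx.1, hcon⟩
      cases N with
      | zero => exact absurd (Subsingleton.elim _ _) hgx
      | succ N =>
        obtain ⟨Ψ, W, hW, hΨ⟩ := exists_straightening (hg x hx.1) hgx
        let φ : Ec N → Ec (N + 1) := fun v ↦ Ψ (0, v)
        let V : Set (Ec N) := {v | (0, v) ∈ W ∧ φ v ∈ A}
        have hφ : ∀ v ∈ V, ContDiffAt ℝ (k + 1 : ℕ) φ v := fun v hv ↦
          (hΨ _ hv.1).1.comp v (contDiff_prodMk_right 0).contDiffAt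
        have hV : Vᶜ ∈ comap φ l := ihN N N.lt_succ_self V (comap φ l) fun B hB ↦
          compl_mem_comap.2 (h _ (hB.image hφ fun v hv ↦ hv.2))
        refine ⟨_, hW, mem_of_superset (compl_mem_comap.1 hV) (compl_subset_compl.2 ?_)⟩
        rintro _ ⟨⟨hyA, -⟩, ⟨t, v⟩, hp, rfl⟩
        obtain rfl : t = 0 := (hΨ _ hp).2.self_of_nhds.symm.trans (hg0 _ hyA)
        exact ⟨v, ⟨hp, hyA⟩, rfl⟩
    filter_upwards [hcrit, hreg] with x h₁ h₂ hxA using h₂ ⟨hxA, h₁⟩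

lemma compl_mem_comap_ae {X Y : Type*} [MeasurableSpace Y] {μ : Measure Y} {f : X → Y}
    {A : Set X} : Aᶜ ∈ comap f (ae μ) ↔ μ (f '' A) = 0 := by
  rw [compl_mem_comap, compl_mem_ae_iff]

theorem volume_image_eq_zero_of_fderiv_eq_zero {N M k : ℕ} (hM : 0 < M)
    (hN : N ≤ (k + 1) * M) {h : Ec N → Ec M} {A : Set (Ec N)}
    (hh : ∀ x ∈ A, ContDiffAt ℝ (k + 1 : ℕ) h x) (hh0 : ∀ x ∈ A, fderiv ℝ h x = 0) :
    volume (h '' A) = 0 := by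
  refine compl_mem_comap_ae.1 <| compl_mem_of_forall_isFlatPiece k N A _ fun B hB ↦ ?_
  obtain ⟨hBA, d, hd, ψ, S, rfl, hψ, hflat⟩ := hB
  rw [compl_mem_comap_ae, image_image]
  refine volume_image_eq_zero_of_isLittleO k.succ_pos hM (hd.trans hN) fun s hs ↦ ?_
  exact isLittleO_comp_sub_of_fderiv (hψ s hs)
    ((hh _ (hBA (mem_image_of_mem ψ hs))).of_le (by exact_mod_cast Nat.le_add_left 1 k))
    (hflat _ (fderiv ℝ h) (fun x hx ↦ (hh x hx).fderiv_right (by simp)) hh0 s hs)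

lemma isOpen_setOf_surjective (n m : ℕ) :
    IsOpen {L : Ec n →L[ℝ] Ec m | Function.Surjective L} := by
  convert! isOpen_setOfPred_nat_le_rank (𝕜 := ℝ) (E := Ec n) (F := Ec m) m using 1
  ext L
  change Function.Surjective (L : Ec n →ₗ[ℝ] Ec m) ↔ (m : Cardinal) ≤ LinearMap.rank _
  rw [← LinearMap.range_eq_top, LinearMap.rank, ← Module.finrank_eq_rank, Nat.cast_le]
  refine ⟨fun h ↦ by rw [h, finrank_top, finrank_euclideanSpace_fin],
    fun h ↦ Submodule.eq_top_of_finrank_eq ?_⟩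
  exact le_antisymm (Submodule.finrank_le _) (by simpa using h)

lemma surjective_of_surjective_fderiv_slice {d m : ℕ} {f : Ec (d + 1) → Ec (m + 1)}
    {T : Ec (m + 1) ≃L[ℝ] ℝ × Ec m} {Ψ : ℝ × Ec d → Ec (d + 1)} {t : ℝ} {v : Ec d}
    (hΨ : DifferentiableAt ℝ Ψ (t, v)) (hf : DifferentiableAt ℝ f (Ψ (t, v)))
    (hfst : ∀ᶠ q in 𝓝 (t, v), (T (f (Ψ q))).1 = q.1)
    (hsurj : Function.Surjective (fderiv ℝ (fun u ↦ (T (f (Ψ (t, u)))).2) v)) :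
    Function.Surjective (fderiv ℝ f (Ψ (t, v))) := by
  set P := fderiv ℝ Ψ (t, v)
  set L := fderiv ℝ f (Ψ (t, v))
  have hQ : HasFDerivAt (fun q ↦ T (f (Ψ q)))
      ((T : Ec (m + 1) →L[ℝ] ℝ × Ec m).comp (L.comp P)) (t, v) :=
    T.hasFDerivAt.comp (t, v) (hf.hasFDerivAt.comp (t, v) hΨ.hasFDerivAt)
  have hQ₁ : ∀ q, (T (L (P q))).1 = q.1 := by
    have h₁ : HasFDerivAt (fun q : ℝ × Ec d ↦ q.1) _ (t, v) :=
      hQ.fst.congr_of_eventuallyEq (hfst.mono fun q hq ↦ hq.symm)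
    intro q
    exact congrArg (fun L : ℝ × Ec d →L[ℝ] ℝ ↦ L q) (h₁.unique hasFDerivAt_fst)
  have hQ₂ : ∀ u, fderiv ℝ (fun u ↦ (T (f (Ψ (t, u)))).2) v u = (T (L (P (0, u)))).2 := by
    have h₂ : HasFDerivAt (fun u ↦ (T (f (Ψ (t, u)))).2) _ v :=
      hQ.snd.comp v (hasFDerivAt_prodMk_right t v)
    intro u
    rw [h₂.fderiv]
    rfl
  intro z
  obtain ⟨c, hc⟩ := hsurj ((T z).2 - (T (L (P ((T z).1, 0)))).2)
  refine ⟨P ((T z).1, c), T.injective (Prod.ext (hQ₁ _) ?_)⟩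
  have hsplit : ((T z).1, c) = ((T z).1, (0 : Ec d)) + (0, c) := by simp
  rw [hsplit, map_add, map_add, map_add, Prod.snd_add, ← hQ₂, hc]
  abel

/-- **Morse–Sard theorem**: the set of critical values of a `C^(k+1)` map `ℝⁿ → ℝᵐ` with
`n ≤ k + m` has measure zero. -/
theorem volume_image_eq_zero_of_not_surjective_fderiv (m : ℕ) : ∀ (n k : ℕ), n ≤ k + m →
    ∀ (f : Ec n → Ec m) (A : Set (Ec n)), (∀ x ∈ A, ContDiffAt ℝ (k + 1 : ℕ) f x) →
      (∀ x ∈ A, ¬ Function.Surjective (fderiv ℝ f x)) → volume (f '' A) = 0 := by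
  induction m with
  | zero =>
    intro n k _ f A _ hA
    have : A = ∅ := eq_empty_of_forall_notMem fun x hx ↦
      hA x hx fun z ↦ ⟨0, Subsingleton.elim _ _⟩
    simp [this]
  | succ m ih =>
    intro n k hn f A hf hA
    rw [← compl_mem_comap_ae]
    have hzero : {x ∈ A | fderiv ℝ f x = 0}ᶜ ∈ comap f (ae volume) :=
      compl_mem_comap_ae.2 <| volume_image_eq_zero_of_fderiv_eq_zero m.succ_pos
        (by nlinarith [Nat.zero_le (k * m)]) (fun x hx ↦ hf x hx.1) fun x hx ↦ hx.2
    have hnonzero : {x ∈ A | fderiv ℝ f x ≠ 0}ᶜ ∈ comap f (ae volume) := by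
      refine compl_mem_of_forall_exists_nhds fun x hx ↦ ?_
      obtain ⟨hxA, hfx⟩ := hx
      have hd : DifferentiableAt ℝ f x := (hf x hxA).differentiableAt (by simp)
      obtain ⟨u, hu⟩ : ∃ u, fderiv ℝ f x u ≠ 0 := by
        by_contra! h
        exact hfx (ContinuousLinearMap.ext h)
      obtain ⟨ℓ, hℓ⟩ := SeparatingDual.exists_ne_zero (R := ℝ) hu
      obtain ⟨T, hT⟩ := exists_equiv_prod_fst_eq (d := m) (ℓ := ℓ) (by simp)
        (by rintro rfl; simp at hℓ)
      cases n with
      | zero => exact absurd (Subsingleton.elim u 0) (by rintro rfl; simp at hu)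
      | succ n =>
      have hw : ContDiffAt ℝ (k + 1 : ℕ) (ℓ ∘ f) x := ℓ.contDiff.contDiffAt.comp x (hf x hxA)
      obtain ⟨Ψ, W, hW, hΨ⟩ := exists_straightening hw (by
        rw [(ℓ.hasFDerivAt.comp x hd.hasFDerivAt).fderiv]
        exact fun h ↦ hℓ (congrArg (fun L : Ec (n + 1) →L[ℝ] ℝ ↦ L u) h))
      obtain ⟨K, hKx, hKsub, hK⟩ := local_compact_nhds
        (inter_mem hW ((hf x hxA).eventually (by simp)))
      let C : Set (Ec (n + 1)) := {y ∈ K | ¬ Function.Surjective (fderiv ℝ f y)}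
      have hCf : ∀ y ∈ K, ContDiffAt ℝ (k + 1 : ℕ) f y := fun y hy ↦ (hKsub hy).2
      have hC : IsCompact C := by
        refine hK.of_isClosed_subset ?_ fun y hy ↦ hy.1
        have hcont : ContinuousOn (fderiv ℝ f) K := fun y hy ↦
          ((hCf y hy).fderiv_right (m := 0) (by simp)).continuousAt.continuousWithinAt
        exact hcont.preimage_isClosed_of_isClosed hK.isClosed
          (isOpen_setOf_surjective _ _).isClosed_compl
      have hTf : ContinuousOn (fun y ↦ T (f y)) C := fun y hy ↦
        (T.continuous.continuousAt.comp (hCf y hy.1).continuousAt).continuousWithinAt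
      have hZ : volume ((fun y ↦ T (f y)) '' C) = 0 := by
        rw [Measure.volume_eq_prod, Measure.measure_prod_null
          (hC.image_of_continuousOn hTf).measurableSet]
        refine .of_forall fun t ↦ ?_
        let V : Set (Ec n) := {v | (t, v) ∈ W ∧ Ψ (t, v) ∈ C}
        have hV := ih n k (by omega) (fun v ↦ (T (f (Ψ (t, v)))).2) V
          (fun v hv ↦ contDiffAt_snd.comp v (T.contDiff.contDiffAt.comp v
            ((hCf _ hv.2.1).comp v ((hΨ _ hv.1).1.comp v (contDiff_prodMk_right t).contDiffAt))))
          (fun v hv hsurj ↦ hv.2.2 <| surjective_of_surjective_fderiv_slice (T := T)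
            ((hΨ _ hv.1).1.differentiableAt (by simp))
            ((hCf _ hv.2.1).differentiableAt (by simp))
            ((hΨ _ hv.1).2.mono fun q hq ↦ (hT _).trans hq) hsurj)
        refine measure_mono_null ?_ hV
        rintro z ⟨y, hyC, hyz⟩
        obtain ⟨⟨t', v⟩, hp, rfl⟩ := (hKsub hyC.1).1
        obtain rfl : t' = t :=
          (hΨ _ hp).2.self_of_nhds.symm.trans ((hT _).symm.trans (congrArg Prod.fst hyz))
        exact ⟨v, ⟨hp, hyC⟩, congrArg Prod.snd hyz⟩
      refine ⟨K, hKx, compl_mem_comap_ae.2 (measure_mono_null (t := T ⁻¹' ((fun y ↦ T (f y)) '' C))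
        ?_ ?_)⟩
      · rintro _ ⟨y, ⟨⟨hyA, -⟩, hyK⟩, rfl⟩
        exact ⟨y, ⟨hyK, hA y hyA⟩, rfl⟩
      · have hac : Measure.map T (volume : Measure (Ec (m + 1))) ≪
            (volume : Measure ℝ).prod (volume : Measure (Ec m)) :=
          Measure.absolutelyContinuous_isAddHaarMeasure _ _
        rw [← Measure.map_apply T.continuous.measurable
          (hC.image_of_continuousOn hTf).measurableSet]
        exact hac hZ
    filter_upwards [hzero, hnonzero] with x h₁ h₂ hxA
    by_cases h : fderiv ℝ f x = 0
    exacts [h₁ ⟨hxA, h⟩, h₂ ⟨hxA, h⟩]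

lemma eq_empty_of_isOpen_of_hausdorffMeasure_ne_top {n : ℕ} {s : ℝ≥0} (hs : s < n)
    {U : Set (Ec n)} (hU : IsOpen U) (h : μH[s] U ≠ ⊤) : U = ∅ := by
  by_contra hne
  have hdim := Real.dimH_of_nonempty_interior
    (hU.interior_eq.symm ▸ nonempty_iff_ne_empty.2 hne : (interior U).Nonempty)
  have := dimH_le_of_hausdorffMeasure_ne_top h
  rw [hdim, finrank_euclideanSpace_fin] at this
  exact absurd (by exact_mod_cast this) hs.not_ge

/-- Morse–Sard via Luzin properties. If `n > m`, `f : ℝⁿ → ℝᵐ` is locally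
Lipschitz and, for each `i = 2, …, n-m+1`, `f` has the Luzin property of order `i` with
respect to `H^{i+m-2}`, then `Lᵐ(f(C_f)) = 0`, where
`C_f = {x : Df(x) exists and rank Df(x) < m}`. -/
theorem morse_sard_luzin {n m : ℕ} (hm : 0 < m) (hmn : m < n)
    (f : Ec n → Ec m) (hf : LocallyLipschitz f)
    (hLuzin : ∀ i : ℕ, 2 ≤ i → i ≤ n - m + 1 →
      ∀ ε : ENNReal, 0 < ε → ∃ g : Ec n → Ec m, ContDiff ℝ i g ∧
        μH[(i : ℝ) + m - 2] {x | f x ≠ g x} < ε) :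
    volume (f '' {x | ∃ L : Ec n →L[ℝ] Ec m, HasFDerivAt f L x ∧
      ¬ Function.Surjective ⇑L}) = 0 := by
  obtain ⟨g, hg, hfg⟩ := hLuzin (n - m + 1) (by omega) le_rfl 1 one_pos
  have hexp : ((n - m + 1 : ℕ) : ℝ) + m - 2 = ((n - 1 : ℕ) : ℝ≥0) := by
    rw [NNReal.coe_natCast, Nat.cast_pred (by omega)]
    push_cast [Nat.cast_sub hmn.le]
    ring
  have hempty : {x | f x ≠ g x} = ∅ := by
    refine eq_empty_of_isOpen_of_hausdorffMeasure_ne_top (s := (n - 1 : ℕ))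
      (by exact_mod_cast (by omega : n - 1 < n))
      (isOpen_ne_fun hf.continuous hg.continuous) ?_
    rw [← hexp]
    exact (hfg.trans ENNReal.one_lt_top).ne
  obtain rfl : f = g := funext fun x ↦ not_not.1 fun hx ↦
    eq_empty_iff_forall_notMem.1 hempty x hx
  refine volume_image_eq_zero_of_not_surjective_fderiv m n (n - m) (by omega) f _
    (fun x _ ↦ hg.contDiffAt) ?_
  rintro x ⟨L, hL, hLs⟩
  rwa [hL.fderiv]

end
end
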